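/- Let ω be a radial weight in the class D̂, let 0<p<1 and 0<q≤1, and set μ_q = ω·ω̂^{1/q}. Then (A^{p,q}_ω)* ≃ B(∞,ω) under the pairing ⟨f,g⟩_{ω,p,q} = lim_{r→1⁻} ∑_{n≥0} f̂(n)·conj(ĝ(n))·(μ_q)_{2n+1}·(ν_{1/p−2})_{2n+1}·rⁿ, with equivalence of norms: there exist constants C₁,C₂>0 (depending only on p,q,ω) such that (a) for every g∈B(∞,ω) and every f∈A^{p,q}_ω the limit defining ⟨f,g⟩_{ω,p,q} exists and L_g(f)=⟨f,g⟩_{ω,p,q} defines a bounded linear functional on A^{p,q}_ω with ‖L_g‖ ≤ C₂‖g‖_{B(∞,ω)}, and (b) every bounded linear functional L on A^{p,q}_ω equals L_g for some g∈B(∞,ω) with ‖g‖_{B(∞,ω)} ≤ C₁‖L‖. -/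

import Mathlib

open MeasureTheory Filter Set
open scoped ENNReal

noncomputable section

/-- `ω̂(r) = ∫_r^1 ω(s) ds`. -/
def omegaHat (ω : ℝ → ℝ) (r : ℝ) : ℝ := ∫ s in r..1, ω s

/-- A radial weight: nonnegative and Lebesgue integrable on `[0,1)`. -/
def IsRadialWeight (ω : ℝ → ℝ) : Prop :=
  (∀ r ∈ Set.Ico (0:ℝ) 1, 0 ≤ ω r) ∧ MeasureTheory.IntegrableOn ω (Set.Ico 0 1)

/-- The class `D̂` of upper doubling radial weights. -/
def InDhat (ω : ℝ → ℝ) : Prop :=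
  ∃ C > (0:ℝ), ∀ r ∈ Set.Ico (0:ℝ) 1, omegaHat ω r ≤ C * omegaHat ω ((1 + r) / 2)

/-- The class `Ď`. -/
def InDcheck (ω : ℝ → ℝ) : Prop :=
  ∃ K > (1:ℝ), ∃ C > (1:ℝ), ∀ r ∈ Set.Ico (0:ℝ) 1,
    C * omegaHat ω (1 - (1 - r) / K) ≤ omegaHat ω r

/-- Moments `μ_x = ∫_0^1 r^x μ(r) dr`. -/
def momentW (μ : ℝ → ℝ) (x : ℝ) : ℝ := ∫ r in (0:ℝ)..1, r ^ x * μ r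

/-- The coefficients `μ_{2k+1}` of the `A²_μ` pairing. -/
def momentCoeff (μ : ℝ → ℝ) : ℕ → ℝ := fun k => momentW μ (2 * (k:ℝ) + 1)

/-- The point `r e^{iθ}` of the circle of radius `r`. -/
def circlePt (r θ : ℝ) : ℂ := (r:ℂ) * Complex.exp ((θ:ℂ) * Complex.I)

/-- Integral means `M_p(r,f)` (with values in `[0,∞]`). -/
def MpE (p r : ℝ) (f : ℂ → ℂ) : ℝ≥0∞ :=
  (ENNReal.ofReal (1 / (2 * Real.pi)) *
    ∫⁻ θ in Set.Ioo (0:ℝ) (2 * Real.pi), ENNReal.ofReal (‖f (circlePt r θ)‖ ^ p)) ^ (1 / p)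

/-- Integral means of a `[0,∞]`-valued function. -/
def MpEE (p r : ℝ) (F : ℂ → ℝ≥0∞) : ℝ≥0∞ :=
  (ENNReal.ofReal (1 / (2 * Real.pi)) *
    ∫⁻ θ in Set.Ioo (0:ℝ) (2 * Real.pi), (F (circlePt r θ)) ^ p) ^ (1 / p)

/-- The norm of the mixed norm space `L^{p,q}_ω`. -/
def LpqNormE (ω : ℝ → ℝ) (p q : ℝ) (f : ℂ → ℂ) : ℝ≥0∞ :=
  (∫⁻ r in Set.Ioo (0:ℝ) 1, (MpE p r f) ^ q * ENNReal.ofReal (r * ω r)) ^ (1 / q)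

/-- The `L^{p,q}_ω` norm of a `[0,∞]`-valued function. -/
def LpqNormEE (ω : ℝ → ℝ) (p q : ℝ) (F : ℂ → ℝ≥0∞) : ℝ≥0∞ :=
  (∫⁻ r in Set.Ioo (0:ℝ) 1, (MpEE p r F) ^ q * ENNReal.ofReal (r * ω r)) ^ (1 / q)

/-- The norm of `A^{p,∞}_ω` : `sup_{0 ≤ r < 1} M_p(r,f) ω̂(r)`. -/
def ApInfNormE (ω : ℝ → ℝ) (p : ℝ) (f : ℂ → ℂ) : ℝ≥0∞ :=
  ⨆ r ∈ Set.Ico (0:ℝ) 1, MpE p r f * ENNReal.ofReal (omegaHat ω r)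

/-- Membership in the mixed norm space `A^{p,q}_ω`. -/
def InApq (ω : ℝ → ℝ) (p q : ℝ) (f : ℂ → ℂ) : Prop :=
  DifferentiableOn ℂ f (Metric.ball 0 1) ∧ LpqNormE ω p q f < ⊤

/-- Membership in `A^{p,∞}_ω`. -/
def InApInf (ω : ℝ → ℝ) (p : ℝ) (f : ℂ → ℂ) : Prop :=
  DifferentiableOn ℂ f (Metric.ball 0 1) ∧ ApInfNormE ω p f < ⊤

/-- Taylor coefficient of `f` at `0`. -/
def taylorCoeff (f : ℂ → ℂ) (n : ℕ) : ℂ := iteratedDeriv n f 0 / (n.factorial : ℂ)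

/-- The pairing `⟨f,g⟩ = lim_{r→1⁻} ∑_k f̂(k) conj(ĝ(k)) c(k) r^k` exists and equals `l`. -/
def HasPairingC (c : ℕ → ℝ) (f g : ℂ → ℂ) (l : ℂ) : Prop :=
  (∀ r ∈ Set.Ico (0:ℝ) 1, Summable (fun k : ℕ =>
    taylorCoeff f k * (starRingEnd ℂ) (taylorCoeff g k) * ((c k : ℝ) : ℂ) * ((r:ℂ)) ^ k)) ∧
  Filter.Tendsto (fun r : ℝ => ∑' k : ℕ,
    taylorCoeff f k * (starRingEnd ℂ) (taylorCoeff g k) * ((c k : ℝ) : ℂ) * ((r:ℂ)) ^ k)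
    (nhdsWithin 1 (Set.Iio 1)) (nhds l)

/-- `L` is linear on the functions satisfying `P`. -/
def IsLinearOn (P : (ℂ → ℂ) → Prop) (L : (ℂ → ℂ) → ℂ) : Prop :=
  (∀ f g : ℂ → ℂ, P f → P g → L (f + g) = L f + L g) ∧
  (∀ (c : ℂ) (f : ℂ → ℂ), P f → L (c • f) = c * L f)

/-- Dilation `f_r(z) = f(rz)`. -/
def dilateF (f : ℂ → ℂ) (r : ℝ) : ℂ → ℂ := fun z => f ((r:ℂ) * z)

/-- The BMOA norm `|f(0)| + sup_{a∈D} sup_{0<r<1} M₂(r, f∘φ_a - f(a))`. -/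
def BMOANormE (f : ℂ → ℂ) : ℝ≥0∞ :=
  ENNReal.ofReal ‖f 0‖ +
    ⨆ a ∈ Metric.ball (0:ℂ) 1, ⨆ r ∈ Set.Ioo (0:ℝ) 1,
      MpE 2 r (fun z => f ((a - z) / (1 - (starRingEnd ℂ) a * z)) - f a)

/-- The Bloch norm `|f(0)| + sup_{z∈D} (1-|z|²)|f'(z)|`. -/
def BlochNormE (f : ℂ → ℂ) : ℝ≥0∞ :=
  ENNReal.ofReal ‖f 0‖ +
    ⨆ z ∈ Metric.ball (0:ℂ) 1, ENNReal.ofReal ((1 - ‖z‖ ^ 2) * ‖deriv f z‖)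

/-- The norm of `X(q,ω)`: `(∫_0^1 ‖f_r‖_X^q ω(r) dr)^{1/q}`. -/
def XqNormE (Xnorm : (ℂ → ℂ) → ℝ≥0∞) (ω : ℝ → ℝ) (q : ℝ) (f : ℂ → ℂ) : ℝ≥0∞ :=
  (∫⁻ r in Set.Ioo (0:ℝ) 1, (Xnorm (dilateF f r)) ^ q * ENNReal.ofReal (ω r)) ^ (1 / q)

/-- The norm of `X(∞,ω)`: `sup_{0<r<1} ‖f_r‖_X ω̂(r)`. -/
def XInfNormE (Xnorm : (ℂ → ℂ) → ℝ≥0∞) (ω : ℝ → ℝ) (f : ℂ → ℂ) : ℝ≥0∞ :=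
  ⨆ r ∈ Set.Ioo (0:ℝ) 1, Xnorm (dilateF f r) * ENNReal.ofReal (omegaHat ω r)

/-- The standard radial weight `ν_β(r) = (β+1)(1-r²)^β`. -/
def nuWeight (β : ℝ) : ℝ → ℝ := fun r => (β + 1) * (1 - r ^ 2) ^ β

/-- The Bergman reproducing kernel `B^ω_a(z) = ∑ (z conj a)^n / (2 ω_{2n+1})`. -/
def bergmanKernel (ω : ℝ → ℝ) (a z : ℂ) : ℂ :=
  ∑' n : ℕ, (z * (starRingEnd ℂ) a) ^ n / (2 * ((momentW ω (2 * (n:ℝ) + 1) : ℝ) : ℂ))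

/-- The Bergman projection (`dA` is normalized area measure). -/
def PomegaProj (ω : ℝ → ℝ) (f : ℂ → ℂ) (z : ℂ) : ℂ :=
  (Real.pi)⁻¹ • ∫ ζ in Metric.ball (0:ℂ) 1,
    f ζ * (starRingEnd ℂ) (bergmanKernel ω z ζ) * ((ω ‖ζ‖ : ℝ) : ℂ)

/-- The maximal Bergman projection applied to `|f|`, with values in `[0,∞]`. -/
def PomegaPlusL (ω : ℝ → ℝ) (f : ℂ → ℂ) (z : ℂ) : ℝ≥0∞ :=
  ∫⁻ ζ in Metric.ball (0:ℂ) 1,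
    ENNReal.ofReal (‖f ζ‖ * ‖bergmanKernel ω z ζ‖ * ω ‖ζ‖ / Real.pi)

/-- The Hardy `H¹` norm. -/
def H1NormE (f : ℂ → ℂ) : ℝ≥0∞ := ⨆ r ∈ Set.Ioo (0:ℝ) 1, MpE 1 r f

/-- `r_n = inf{ r ∈ [0,1) : ω̂(r) = ω̂(0) K^{-n} }`. -/
def rSeq (ω : ℝ → ℝ) (K : ℝ) (n : ℕ) : ℝ :=
  sInf {r | r ∈ Set.Ico (0:ℝ) 1 ∧ omegaHat ω r = omegaHat ω 0 * K ^ (-(n:ℝ))}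

/-- `M_n = ⌊1/(1-r_n)⌋`. -/
def MSeq (ω : ℝ → ℝ) (K : ℝ) (n : ℕ) : ℕ := ⌊1 / (1 - rSeq ω K n)⌋₊

/-- Weighted Hadamard product of a polynomial with an analytic function:
`z ↦ ∑_j c(j) P̂(j) ĝ(j) z^j`. -/
def hadamardPolyC (c : ℕ → ℂ) (P : Polynomial ℂ) (g : ℂ → ℂ) : ℂ → ℂ :=
  fun z => ∑ j ∈ Finset.range (P.natDegree + 1), c j * P.coeff j * taylorCoeff g j * z ^ j

/-- An admissible Banach space of analytic functions on the unit disc, given by a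
carrier set and a norm function. -/
structure AdmissibleSpace where
  carrier : Set (ℂ → ℂ)
  nrm : (ℂ → ℂ) → ℝ
  mem_analytic : ∀ f ∈ carrier, DifferentiableOn ℂ f (Metric.ball 0 1)
  zero_mem : (0 : ℂ → ℂ) ∈ carrier
  add_mem : ∀ f g : ℂ → ℂ, f ∈ carrier → g ∈ carrier → f + g ∈ carrier
  smul_mem : ∀ (c : ℂ) (f : ℂ → ℂ), f ∈ carrier → c • f ∈ carrier
  nrm_nonneg : ∀ f ∈ carrier, 0 ≤ nrm f
  nrm_eq_zero : ∀ f ∈ carrier, nrm f = 0 → ∀ z ∈ Metric.ball (0:ℂ) 1, f z = 0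
  nrm_add : ∀ f g : ℂ → ℂ, f ∈ carrier → g ∈ carrier → nrm (f + g) ≤ nrm f + nrm g
  nrm_smul : ∀ (c : ℂ) (f : ℂ → ℂ), f ∈ carrier → nrm (c • f) = ‖c‖ * nrm f
  complete : ∀ u : ℕ → (ℂ → ℂ), (∀ n, u n ∈ carrier) →
    (∀ ε : ℝ, 0 < ε → ∃ N : ℕ, ∀ m ≥ N, ∀ n ≥ N, nrm (u m - u n) < ε) →
    ∃ f ∈ carrier, Filter.Tendsto (fun n => nrm (u n - f)) Filter.atTop (nhds 0)
  norm_conv_implies_ucc : ∀ (u : ℕ → (ℂ → ℂ)) (f : ℂ → ℂ),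
    (∀ n, u n ∈ carrier) → f ∈ carrier →
    Filter.Tendsto (fun n => nrm (u n - f)) Filter.atTop (nhds 0) →
    ∀ Kc : Set ℂ, Kc ⊆ Metric.ball 0 1 → IsCompact Kc →
      TendstoUniformlyOn (fun n => u n) f Filter.atTop Kc
  ucc_implies_norm_conv : ∀ R : ℝ, 1 < R → ∀ (u : ℕ → (ℂ → ℂ)) (f : ℂ → ℂ),
    (∀ n, u n ∈ carrier ∧ DifferentiableOn ℂ (u n) (Metric.ball 0 R)) →
    DifferentiableOn ℂ f (Metric.ball 0 R) →
    (∀ Kc : Set ℂ, Kc ⊆ Metric.ball (0:ℂ) R → IsCompact Kc →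
      TendstoUniformlyOn (fun n => u n) f Filter.atTop Kc) →
    f ∈ carrier ∧ Filter.Tendsto (fun n => nrm (u n - f)) Filter.atTop (nhds 0)
  dilation_bound : ∃ C > (0:ℝ), ∀ f ∈ carrier, ∀ ζ : ℂ, ‖ζ‖ ≤ 1 →
    (fun z => f (ζ * z)) ∈ carrier ∧ nrm (fun z => f (ζ * z)) ≤ C * nrm f

/-- The operator `T_p = I^{ν_{1/p-2}}`. -/
def TpOp (p : ℝ) (g : ℂ → ℂ) : ℂ → ℂ :=
  fun z => ∑' k : ℕ,
    taylorCoeff g k * ((momentW (nuWeight (1 / p - 2)) (2 * (k:ℝ) + 1) : ℝ) : ℂ) * z ^ k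

/-- Membership in the Bloch space. -/
def InBloch (g : ℂ → ℂ) : Prop :=
  DifferentiableOn ℂ g (Metric.ball 0 1) ∧ BlochNormE g < ⊤

open Classical in
/-- The norm of the space `X_p = T_p(B)`, normed so that `T_p` is an isometry. -/
def XpNormE (p : ℝ) (h : ℂ → ℂ) : ℝ≥0∞ :=
  if H : ∃ g : ℂ → ℂ, InBloch g ∧ Set.EqOn h (TpOp p g) (Metric.ball 0 1)
  then BlochNormE H.choose else ⊤

/-- The polynomial `V_n ∗ g` where `V_n(z) = ∑_{j=2^{n-1}}^{2^{n+1}-1} ψ(j/2^{n-1}) z^j`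
and `ψ(t) = Ψ(t/2) - Ψ(t)`. -/
def VnStar (Ψ : ℝ → ℝ) (n : ℕ) (g : ℂ → ℂ) : ℂ → ℂ :=
  fun z => ∑ j ∈ Finset.Icc (2 ^ (n - 1) : ℕ) (2 ^ (n + 1) - 1 : ℕ),
    (((Ψ ((j:ℝ) / 2 ^ n) - Ψ ((j:ℝ) / 2 ^ (n - 1))) : ℝ) : ℂ) * taylorCoeff g j * z ^ j

/-- `D^ω(V_n ∗ g)`, where `D^ω h(z) = ∑ ĥ(k) z^k/(2ω_{2k+1})`. -/
def DVnStar (Ψ : ℝ → ℝ) (ω : ℝ → ℝ) (n : ℕ) (g : ℂ → ℂ) : ℂ → ℂ :=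
  fun z => ∑ j ∈ Finset.Icc (2 ^ (n - 1) : ℕ) (2 ^ (n + 1) - 1 : ℕ),
    (((Ψ ((j:ℝ) / 2 ^ n) - Ψ ((j:ℝ) / 2 ^ (n - 1))) : ℝ) : ℂ) * taylorCoeff g j * z ^ j /
      (2 * ((momentW ω (2 * (j:ℝ) + 1) : ℝ) : ℂ))

/-- `J_ω(t) = ∫_0^t ds/(ω̂(s)(1-s))`. -/
def Jomega (ω : ℝ → ℝ) (t : ℝ) : ℝ := ∫ s in (0:ℝ)..t, 1 / (omegaHat ω s * (1 - s))

/-! ### The normalized arc length measure -/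

/-- Normalized Lebesgue measure on `(0, 2π)`. -/
def arcMeasure : Measure ℝ :=
  ENNReal.ofReal (1 / (2 * Real.pi)) • volume.restrict (Ioo (0:ℝ) (2 * Real.pi))

instance : IsProbabilityMeasure arcMeasure := by
  refine ⟨?_⟩
  have h : (0:ℝ) < 2 * Real.pi := by positivity
  simp only [arcMeasure, Measure.smul_apply, smul_eq_mul, Measure.restrict_apply_univ,
    Real.volume_Ioo, sub_zero]
  rw [← ENNReal.ofReal_mul (by positivity), one_div_mul_cancel h.ne', ENNReal.ofReal_one]

lemma circlePt_eq_circleMap (r θ : ℝ) : circlePt r θ = circleMap 0 r θ := by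
  simp [circlePt, circleMap]

lemma norm_circlePt {r : ℝ} (hr : 0 ≤ r) (θ : ℝ) : ‖circlePt r θ‖ = r := by
  rw [circlePt, norm_mul, Complex.norm_exp_ofReal_mul_I, mul_one, Complex.norm_of_nonneg hr]

@[fun_prop]
lemma continuous_circlePt : Continuous (fun x : ℝ × ℝ => circlePt x.1 x.2) := by
  unfold circlePt; fun_prop

lemma circlePt_mul (s r θ : ℝ) : (s:ℂ) * circlePt r θ = circlePt (s * r) θ := by
  simp [circlePt, mul_assoc]

lemma circlePt_eq_mul (r θ : ℝ) : circlePt r θ = r * circlePt 1 θ := by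
  simp [circlePt]

lemma MpE_eq (p r : ℝ) (f : ℂ → ℂ) :
    MpE p r f = (∫⁻ θ, ENNReal.ofReal (‖f (circlePt r θ)‖ ^ p) ∂arcMeasure) ^ (1 / p) := by
  rw [MpE, arcMeasure, lintegral_smul_measure, smul_eq_mul]

lemma integral_arcMeasure {E : Type*} [NormedAddCommGroup E] [NormedSpace ℝ E] (f : ℝ → E) :
    ∫ θ, f θ ∂arcMeasure = (2 * Real.pi)⁻¹ • ∫ θ in (0:ℝ)..2 * Real.pi, f θ := by
  rw [arcMeasure, integral_smul_measure, intervalIntegral.integral_of_le (by positivity),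
    integral_Ioc_eq_integral_Ioo, ENNReal.toReal_ofReal (by positivity), one_div]

lemma circleAverage_eq_integral_arcMeasure {E : Type*} [NormedAddCommGroup E] [NormedSpace ℝ E]
    (f : ℂ → E) (r : ℝ) : Real.circleAverage f 0 r = ∫ θ, f (circlePt r θ) ∂arcMeasure := by
  rw [integral_arcMeasure, Real.circleAverage]
  simp_rw [circlePt_eq_circleMap]

lemma Continuous.integrable_arcMeasure {E : Type*} [NormedAddCommGroup E] {f : ℝ → E}
    (hf : Continuous f) : Integrable f arcMeasure := by
  refine Integrable.smul_measure ?_ ENNReal.ofReal_ne_top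
  exact (hf.integrableOn_Icc (a := 0) (b := 2 * Real.pi)).mono_set Ioo_subset_Icc_self

/-! ### The Poisson kernel on the unit circle -/

/-- The Poisson kernel of the unit disc at `t e^{iφ}` and `e^{iθ}`. -/
def poissonArc (t φ θ : ℝ) : ℝ := (1 - t ^ 2) / ‖circlePt 1 θ - circlePt t φ‖ ^ 2

lemma poissonArc_eq {t : ℝ} (ht : 0 ≤ t) (φ θ : ℝ) :
    poissonArc t φ θ = poissonKernel 0 (circlePt t φ) (circlePt 1 θ) := by
  simp [poissonArc, poissonKernel, norm_circlePt ht, norm_circlePt zero_le_one]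

lemma poissonArc_symm (t φ θ : ℝ) : poissonArc t φ θ = poissonArc t θ φ := by
  unfold poissonArc
  congr 2
  rw [← Complex.norm_conj]
  have h : circlePt 1 φ - circlePt t θ =
      (circlePt 1 φ * circlePt 1 θ) * (starRingEnd ℂ) (circlePt 1 θ - circlePt t φ) := by
    have h1 : ∀ r x : ℝ, (starRingEnd ℂ) (circlePt r x) = r * Complex.exp (-(x * Complex.I)) := by
      intro r x
      simp [circlePt, ← Complex.exp_conj]
    rw [map_sub, h1, h1]
    simp only [circlePt, Complex.ofReal_one, one_mul]
    rw [Complex.exp_neg, Complex.exp_neg]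
    field_simp
  rw [h, norm_mul, norm_mul, norm_circlePt zero_le_one, norm_circlePt zero_le_one]
  simp

lemma one_sub_le_norm_sub {t : ℝ} (ht : 0 ≤ t) (φ θ : ℝ) :
    1 - t ≤ ‖circlePt 1 θ - circlePt t φ‖ := by
  have := norm_sub_norm_le (circlePt 1 θ) (circlePt t φ)
  rwa [norm_circlePt ht, norm_circlePt zero_le_one] at this

lemma poissonArc_nonneg {t : ℝ} (ht : 0 ≤ t) (ht1 : t < 1) (φ θ : ℝ) : 0 ≤ poissonArc t φ θ := by
  have : 0 ≤ 1 - t ^ 2 := by nlinarith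
  unfold poissonArc; positivity

lemma poissonArc_le {t : ℝ} (ht : 0 ≤ t) (ht1 : t < 1) (φ θ : ℝ) :
    poissonArc t φ θ ≤ 2 / (1 - t) := by
  have h := one_sub_le_norm_sub ht φ θ
  have h0 : 0 < 1 - t := by linarith
  unfold poissonArc
  rw [div_le_div_iff₀ (by nlinarith [norm_nonneg (circlePt 1 θ - circlePt t φ)]) h0]
  nlinarith [mul_self_le_mul_self h0.le h]

lemma continuousOn_poissonArc :
    ContinuousOn (fun x : ℝ × ℝ × ℝ => poissonArc x.1 x.2.1 x.2.2) (Ico 0 1 ×ˢ univ) := by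
  unfold poissonArc
  refine ContinuousOn.div (by fun_prop) ?_ ?_
  · exact (((continuous_circlePt.comp (continuous_const.prodMk continuous_snd.snd)).sub
      (continuous_circlePt.comp (continuous_fst.prodMk continuous_snd.fst))).norm.pow 2).continuousOn
  · rintro ⟨t, φ, θ⟩ ⟨h, -⟩
    have := one_sub_le_norm_sub h.1 φ θ
    have h1 : 0 < 1 - t := by linarith [h.2]
    have h2 := h1.trans_le this
    positivity

lemma continuous_poissonArc {t : ℝ} (ht : 0 ≤ t) (ht1 : t < 1) :
    Continuous (fun x : ℝ × ℝ => poissonArc t x.1 x.2) := by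
  have := continuousOn_poissonArc.comp_continuous (f := fun x : ℝ × ℝ => (t, x.1, x.2))
    (by fun_prop) (fun x => ⟨⟨ht, ht1⟩, mem_univ _⟩)
  exact this

lemma continuous_circlePt_right (r : ℝ) : Continuous (circlePt r) :=
  continuous_circlePt.comp (continuous_const.prodMk continuous_id)

lemma continuous_poissonArc_right {t : ℝ} (ht : 0 ≤ t) (ht1 : t < 1) (φ : ℝ) :
    Continuous (poissonArc t φ) :=
  Continuous.comp (g := fun x : ℝ × ℝ => poissonArc t x.1 x.2) (f := fun θ => (φ, θ))
    (continuous_poissonArc ht ht1) (by fun_prop)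

lemma circlePt_mem_ball {t : ℝ} (ht : 0 ≤ t) (ht1 : t < 1) (φ : ℝ) :
    circlePt t φ ∈ Metric.ball (0:ℂ) 1 := by
  rwa [mem_ball_zero_iff, norm_circlePt ht]

lemma DiffContOnCl.integral_poissonArc {F : ℂ → ℂ} (hF : DiffContOnCl ℂ F (Metric.ball 0 1))
    {t : ℝ} (ht : 0 ≤ t) (ht1 : t < 1) (φ : ℝ) :
    ∫ θ, poissonArc t φ θ • F (circlePt 1 θ) ∂arcMeasure = F (circlePt t φ) := by
  rw [← hF.circleAverage_poissonKernel_smul (circlePt_mem_ball ht ht1 φ),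
    circleAverage_eq_integral_arcMeasure]
  simp [poissonArc_eq ht]

lemma integral_poissonArc {t : ℝ} (ht : 0 ≤ t) (ht1 : t < 1) (φ : ℝ) :
    ∫ θ, poissonArc t φ θ ∂arcMeasure = 1 := by
  have := (diffContOnCl_const (𝕜 := ℂ) (s := Metric.ball (0:ℂ) 1)
    (c := (1:ℂ))).integral_poissonArc ht ht1 φ
  simp only [Complex.real_smul, mul_one] at this
  have h := integral_ofReal (𝕜 := ℂ) (μ := arcMeasure) (f := poissonArc t φ)
  apply Complex.ofReal_injective
  rw [Complex.ofReal_one, ← this]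
  exact h.symm

lemma lintegral_poissonArc {t : ℝ} (ht : 0 ≤ t) (ht1 : t < 1) (φ : ℝ) :
    ∫⁻ θ, ENNReal.ofReal (poissonArc t φ θ) ∂arcMeasure = 1 := by
  rw [← ofReal_integral_eq_lintegral_ofReal
    (continuous_poissonArc_right ht ht1 φ).integrable_arcMeasure
    (ae_of_all _ fun θ => poissonArc_nonneg ht ht1 φ θ), integral_poissonArc ht ht1,
    ENNReal.ofReal_one]

/-! ### Subharmonicity of `|F|^a` -/

/-- `|f|^a` has an analytic majorant on the unit disc which is sharp on the unit circle. -/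
def HasSharpMajorant (a : ℝ) (f : ℂ → ℂ) : Prop :=
  ∃ Φ : ℂ → ℂ, DiffContOnCl ℂ Φ (Metric.ball 0 1) ∧
    (∀ z, ‖z‖ ≤ 1 → ‖f z‖ ^ a ≤ ‖Φ z‖) ∧ ∀ z, ‖z‖ = 1 → ‖Φ z‖ = ‖f z‖ ^ a

lemma HasSharpMajorant.mul {a : ℝ} {f g : ℂ → ℂ} (hf : HasSharpMajorant a f)
    (hg : HasSharpMajorant a g) : HasSharpMajorant a (fun z => f z * g z) := by
  obtain ⟨Φ, h1, h2, h3⟩ := hf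
  obtain ⟨Ψ, k1, k2, k3⟩ := hg
  refine ⟨fun z => Φ z * Ψ z, ⟨h1.1.mul k1.1, h1.2.mul k1.2⟩, fun z hz => ?_, fun z hz => ?_⟩
  · rw [norm_mul, norm_mul, Real.mul_rpow (norm_nonneg _) (norm_nonneg _)]
    exact mul_le_mul (h2 z hz) (k2 z hz) (by positivity) (by positivity)
  · rw [norm_mul, norm_mul, Real.mul_rpow (norm_nonneg _) (norm_nonneg _), h3 z hz, k3 z hz]

lemma hasSharpMajorant_const (a : ℝ) (c : ℂ) : HasSharpMajorant a (fun _ => c) := by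
  refine ⟨fun _ => ((‖c‖ ^ a : ℝ) : ℂ), diffContOnCl_const, fun z _ => ?_, fun z _ => ?_⟩ <;>
  · rw [Complex.norm_of_nonneg (by positivity)]

lemma hasSharpMajorant_of_linear {a : ℝ} (ha : 0 < a) {b : ℂ} (hb : ‖b‖ ≤ 1) {f : ℂ → ℂ}
    (h1 : ∀ z, ‖z‖ ≤ 1 → ‖f z‖ ≤ ‖1 - b * z‖) (h2 : ∀ z, ‖z‖ = 1 → ‖f z‖ = ‖1 - b * z‖) :
    HasSharpMajorant a f := by
  have hre : ∀ z : ℂ, 1 - ‖z‖ ≤ (1 - b * z).re := by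
    intro z
    have : (b * z).re ≤ ‖z‖ := (Complex.re_le_norm _).trans (by
      rw [norm_mul]; nlinarith [norm_nonneg z])
    simp only [Complex.sub_re, Complex.one_re]; linarith
  refine ⟨fun z => (1 - b * z) ^ (a:ℂ), ⟨?_, ?_⟩, fun z hz => ?_, fun z hz => ?_⟩
  · refine DifferentiableOn.cpow_const (by fun_prop) fun z hz => Or.inl ?_
    rw [mem_ball_zero_iff] at hz
    linarith [hre z]
  · rw [closure_ball _ one_ne_zero]
    intro z hz
    rw [mem_closedBall_zero_iff] at hz
    have hc : ContinuousAt (fun z : ℂ => 1 - b * z) z := by fun_prop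
    have := Complex.continuousAt_cpow_const_of_re_pos (z := 1 - b * z) (w := (a:ℂ))
      (Or.inl (by linarith [hre z])) (by simpa using ha)
    exact (ContinuousAt.comp (f := fun z : ℂ => 1 - b * z) this hc).continuousWithinAt
  · rw [Complex.norm_cpow_real]
    exact Real.rpow_le_rpow (norm_nonneg _) (h1 z hz) ha.le
  · rw [Complex.norm_cpow_real, h2 z hz]

lemma hasSharpMajorant_sub_const {a : ℝ} (ha : 0 < a) (α : ℂ) :
    HasSharpMajorant a (fun z => z - α) := by
  rcases le_or_gt ‖α‖ 1 with h | h
  · have key : ∀ z : ℂ, ‖1 - (starRingEnd ℂ) α * z‖ ^ 2 - ‖z - α‖ ^ 2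
        = (1 - ‖z‖ ^ 2) * (1 - ‖α‖ ^ 2) := by
      intro z
      simp only [Complex.sq_norm, Complex.normSq_apply, Complex.sub_re, Complex.sub_im,
        Complex.mul_re, Complex.mul_im, Complex.conj_re, Complex.conj_im, Complex.one_re,
        Complex.one_im]
      ring
    refine hasSharpMajorant_of_linear ha (b := (starRingEnd ℂ) α) (by simpa using h) ?_ ?_
    · intro z hz
      have := key z
      refine abs_le_of_sq_le_sq' ?_ (norm_nonneg _) |>.2
      nlinarith [mul_nonneg (sub_nonneg.2 (pow_le_one₀ (norm_nonneg z) hz (n := 2)))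
        (sub_nonneg.2 (pow_le_one₀ (norm_nonneg α) h (n := 2)))]
    · intro z hz
      have := key z
      rw [hz] at this
      rw [← sq_eq_sq₀ (norm_nonneg _) (norm_nonneg _)]
      linarith
  · have hα : α ≠ 0 := by rintro rfl; simp at h; linarith
    have := (hasSharpMajorant_const a (-α)).mul
      (hasSharpMajorant_of_linear ha (b := α⁻¹) (f := fun z => 1 - α⁻¹ * z)
        (by rw [norm_inv]; exact inv_le_one_of_one_le₀ h.le) (fun _ _ => le_rfl) fun _ _ => rfl)
    convert this using 2 with z
    field_simp
    ring

lemma hasSharpMajorant_polynomial {a : ℝ} (ha : 0 < a) (P : Polynomial ℂ) :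
    HasSharpMajorant a (fun z => P.eval z) := by
  have h := (IsAlgClosed.splits P).eq_prod_roots
  have key : ∀ s : Multiset ℂ, HasSharpMajorant a
      (fun z => ((s.map fun x => Polynomial.X - Polynomial.C x).prod).eval z) := by
    intro s
    induction s using Multiset.induction_on with
    | empty => simpa using hasSharpMajorant_const a 1
    | cons x s ih => simpa using (hasSharpMajorant_sub_const ha x).mul ih
  rw [h]
  simpa using (hasSharpMajorant_const a P.leadingCoeff).mul (key P.roots)

lemma HasSharpMajorant.rpow_le {a : ℝ} {f : ℂ → ℂ} (hf : HasSharpMajorant a f)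
    {t : ℝ} (ht : 0 ≤ t) (ht1 : t < 1) (φ : ℝ) :
    ‖f (circlePt t φ)‖ ^ a ≤ ∫ θ, poissonArc t φ θ * ‖f (circlePt 1 θ)‖ ^ a ∂arcMeasure := by
  obtain ⟨Φ, h1, h2, h3⟩ := hf
  calc ‖f (circlePt t φ)‖ ^ a ≤ ‖Φ (circlePt t φ)‖ := h2 _ (by rw [norm_circlePt ht]; exact ht1.le)
    _ = ‖∫ θ, poissonArc t φ θ • Φ (circlePt 1 θ) ∂arcMeasure‖ := by
      rw [h1.integral_poissonArc ht ht1]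
    _ ≤ ∫ θ, ‖poissonArc t φ θ • Φ (circlePt 1 θ)‖ ∂arcMeasure := norm_integral_le_integral_norm _
    _ = _ := by
      congr 1; ext θ
      rw [norm_smul, Real.norm_of_nonneg (poissonArc_nonneg ht ht1 φ θ),
        h3 _ (norm_circlePt zero_le_one θ)]

/-! ### Taylor expansions -/

lemma hasSum_taylorCoeff {f : ℂ → ℂ} {R : ℝ} (hf : DifferentiableOn ℂ f (Metric.ball 0 R))
    {z : ℂ} (hz : ‖z‖ < R) : HasSum (fun n => taylorCoeff f n * z ^ n) (f z) := by
  have := Complex.hasSum_taylorSeries_on_ball hf (mem_ball_zero_iff.2 hz)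
  refine this.congr_fun fun n => ?_
  rw [taylorCoeff, sub_zero, smul_eq_mul, smul_eq_mul, div_eq_mul_inv]
  ring

lemma tendsto_poly_eval {f : ℂ → ℂ} {R : ℝ} (hR : 1 < R)
    (hf : DifferentiableOn ℂ f (Metric.ball 0 R)) :
    ∃ (P : ℕ → Polynomial ℂ) (K : ℝ), (∀ n z, ‖z‖ ≤ 1 → ‖(P n).eval z‖ ≤ K) ∧
      ∀ z, ‖z‖ ≤ 1 → Tendsto (fun n => (P n).eval z) atTop (nhds (f z)) := by
  have h1 := (hasSum_taylorCoeff hf (z := 1) (by simpa using hR)).summable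
  rw [← summable_norm_iff] at h1
  simp only [one_pow, mul_one] at h1
  refine ⟨fun n => ∑ k ∈ Finset.range n, Polynomial.C (taylorCoeff f k) * Polynomial.X ^ k,
    ∑' k, ‖taylorCoeff f k‖, fun n z hz => ?_, fun z hz => ?_⟩
  · simp only [Polynomial.eval_finsetSum, Polynomial.eval_mul, Polynomial.eval_C,
      Polynomial.eval_pow, Polynomial.eval_X]
    refine (norm_sum_le _ _).trans ((Finset.sum_le_sum fun k _ => ?_).trans
      (h1.sum_le_tsum _ fun _ _ => norm_nonneg _))
    rw [norm_mul, norm_pow]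
    exact mul_le_of_le_one_right (norm_nonneg _) (pow_le_one₀ (norm_nonneg _) hz)
  · simpa [Polynomial.eval_finsetSum] using
      (hasSum_taylorCoeff hf (hz.trans_lt hR)).tendsto_sum_nat

lemma rpow_norm_le_integral {a : ℝ} (ha : 0 < a) {f : ℂ → ℂ} {R : ℝ} (hR : 1 < R)
    (hf : DifferentiableOn ℂ f (Metric.ball 0 R)) {t : ℝ} (ht : 0 ≤ t) (ht1 : t < 1) (φ : ℝ) :
    ‖f (circlePt t φ)‖ ^ a ≤ ∫ θ, poissonArc t φ θ * ‖f (circlePt 1 θ)‖ ^ a ∂arcMeasure := by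
  obtain ⟨P, K, hK, hP⟩ := tendsto_poly_eval hR hf
  have hcont : ∀ x : ℝ, ContinuousAt (fun y : ℝ => y ^ a) x := fun x =>
    Real.continuousAt_rpow_const x a (Or.inr ha.le)
  have hl : Tendsto (fun n => ‖(P n).eval (circlePt t φ)‖ ^ a) atTop
      (nhds (‖f (circlePt t φ)‖ ^ a)) :=
    (hcont _).tendsto.comp (hP _ (by rw [norm_circlePt ht]; exact ht1.le)).norm
  refine le_of_tendsto_of_tendsto' hl (tendsto_integral_of_dominated_convergence
    (fun θ => 2 / (1 - t) * K ^ a) (fun n => ?_) (integrable_const _) (fun n => ?_) ?_)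
    fun n => (hasSharpMajorant_polynomial ha (P n)).rpow_le ht ht1 φ
  · refine ((continuous_poissonArc_right ht ht1 φ).mul ?_).aestronglyMeasurable
    refine Continuous.rpow_const ?_ fun _ => Or.inr ha.le
    exact ((P n).continuous.comp (continuous_circlePt_right 1)).norm
  · refine ae_of_all _ fun θ => ?_
    have h1 := hK n _ (norm_circlePt zero_le_one θ).le
    rw [norm_mul, Real.norm_of_nonneg (poissonArc_nonneg ht ht1 φ θ),
      Real.norm_of_nonneg (by positivity)]
    exact mul_le_mul (poissonArc_le ht ht1 φ θ) (Real.rpow_le_rpow (norm_nonneg _) h1 ha.le)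
      (by positivity) (div_nonneg zero_le_two (by linarith))
  · refine ae_of_all _ fun θ => Tendsto.const_mul _ ?_
    exact (hcont _).tendsto.comp (hP _ (norm_circlePt zero_le_one θ).le).norm

lemma continuous_comp_circlePt {f : ℂ → ℂ} {R : ℝ} (hf : DifferentiableOn ℂ f (Metric.ball 0 R))
    {r : ℝ} (hr : 0 ≤ r) (hrR : r < R) : Continuous (fun θ => f (circlePt r θ)) :=
  hf.continuousOn.comp_continuous (continuous_circlePt_right r) fun θ => by
    rwa [mem_ball_zero_iff, norm_circlePt hr]

lemma ofReal_rpow_norm_le_lintegral {a : ℝ} (ha : 0 < a) {f : ℂ → ℂ} {R : ℝ} (hR : 1 < R)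
    (hf : DifferentiableOn ℂ f (Metric.ball 0 R)) {t : ℝ} (ht : 0 ≤ t) (ht1 : t < 1) (φ : ℝ) :
    ENNReal.ofReal (‖f (circlePt t φ)‖ ^ a) ≤ ∫⁻ θ, ENNReal.ofReal (poissonArc t φ θ) *
      ENNReal.ofReal (‖f (circlePt 1 θ)‖ ^ a) ∂arcMeasure := by
  refine (ENNReal.ofReal_le_ofReal (rpow_norm_le_integral ha hR hf ht ht1 φ)).trans ?_
  rw [ofReal_integral_eq_lintegral_ofReal]
  · refine lintegral_mono fun θ => ?_
    rw [ENNReal.ofReal_mul (poissonArc_nonneg ht ht1 φ θ)]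
  · refine Continuous.integrable_arcMeasure ((continuous_poissonArc_right ht ht1 φ).mul ?_)
    exact (continuous_comp_circlePt hf zero_le_one hR).norm.rpow_const fun _ => Or.inr ha.le
  · exact ae_of_all _ fun θ => mul_nonneg (poissonArc_nonneg ht ht1 φ θ) (by positivity)

lemma differentiableOn_dilateF {f : ℂ → ℂ} {R : ℝ} (hf : DifferentiableOn ℂ f (Metric.ball 0 R))
    {s : ℝ} (hs : 0 < s) : DifferentiableOn ℂ (dilateF f s) (Metric.ball 0 (R / s)) := by
  refine hf.comp (by fun_prop) fun z hz => ?_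
  rw [mem_ball_zero_iff] at hz ⊢
  rw [norm_mul, Complex.norm_of_nonneg hs.le]
  rwa [lt_div_iff₀' hs] at hz

/-- Integral means of analytic functions are nondecreasing. -/
lemma lintegral_rpow_circle_mono {a : ℝ} (ha : 0 < a) {f : ℂ → ℂ}
    (hf : DifferentiableOn ℂ f (Metric.ball 0 1)) {r s : ℝ} (hr : 0 ≤ r) (hrs : r ≤ s)
    (hs : s < 1) :
    ∫⁻ θ, ENNReal.ofReal (‖f (circlePt r θ)‖ ^ a) ∂arcMeasure ≤
      ∫⁻ θ, ENNReal.ofReal (‖f (circlePt s θ)‖ ^ a) ∂arcMeasure := by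
  rcases hrs.eq_or_lt with rfl | hrs
  · exact le_rfl
  have hs0 : 0 < s := hr.trans_lt hrs
  set t := r / s
  have ht : 0 ≤ t := by positivity
  have ht1 : t < 1 := by rwa [div_lt_one hs0]
  have hd := differentiableOn_dilateF hf hs0
  have h1s : 1 < 1 / s := by rwa [one_lt_div hs0]
  have e1 : ∀ θ, dilateF f s (circlePt t θ) = f (circlePt r θ) := fun θ => by
    rw [dilateF, circlePt_mul, mul_div_cancel₀ _ hs0.ne']
  have e2 : ∀ θ, dilateF f s (circlePt 1 θ) = f (circlePt s θ) := fun θ => by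
    rw [dilateF, circlePt_mul, mul_one]
  have hm : Measurable fun θ => ENNReal.ofReal (‖f (circlePt s θ)‖ ^ a) :=
    ENNReal.measurable_ofReal.comp
      ((continuous_comp_circlePt hf hs0.le hs).norm.rpow_const fun _ => Or.inr ha.le).measurable
  have hP : Measurable fun x : ℝ × ℝ => ENNReal.ofReal (poissonArc t x.1 x.2) :=
    ENNReal.measurable_ofReal.comp (continuous_poissonArc ht ht1).measurable
  calc ∫⁻ θ, ENNReal.ofReal (‖f (circlePt r θ)‖ ^ a) ∂arcMeasure
      ≤ ∫⁻ φ, ∫⁻ θ, ENNReal.ofReal (poissonArc t φ θ) *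
        ENNReal.ofReal (‖f (circlePt s θ)‖ ^ a) ∂arcMeasure ∂arcMeasure := by
        refine lintegral_mono fun φ => ?_
        have := ofReal_rpow_norm_le_lintegral ha h1s hd ht ht1 φ
        simpa only [e1, e2] using this
    _ = ∫⁻ θ, ∫⁻ φ, ENNReal.ofReal (poissonArc t φ θ) *
        ENNReal.ofReal (‖f (circlePt s θ)‖ ^ a) ∂arcMeasure ∂arcMeasure :=
        lintegral_lintegral_swap (hP.mul (hm.comp measurable_snd)).aemeasurable
    _ = ∫⁻ θ, ENNReal.ofReal (‖f (circlePt s θ)‖ ^ a) ∂arcMeasure := by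
        refine lintegral_congr fun θ => ?_
        rw [lintegral_mul_const _ (show Measurable fun φ => ENNReal.ofReal (poissonArc t φ θ) from
          Measurable.comp (g := fun x : ℝ × ℝ => ENNReal.ofReal (poissonArc t x.1 x.2))
            (f := fun φ => (φ, θ)) hP (by fun_prop))]
        simp_rw [poissonArc_symm t _ θ, lintegral_poissonArc ht ht1, one_mul]

lemma MpE_mono {p : ℝ} (hp : 0 < p) {f : ℂ → ℂ} (hf : DifferentiableOn ℂ f (Metric.ball 0 1))
    {r s : ℝ} (hr : 0 ≤ r) (hrs : r ≤ s) (hs : s < 1) : MpE p r f ≤ MpE p s f := by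
  rw [MpE_eq, MpE_eq]
  exact ENNReal.rpow_le_rpow (lintegral_rpow_circle_mono hp hf hr hrs hs) (by positivity)

/-! ### The embedding of `H^p` into a weighted `A¹`, `p < 1` -/

lemma rpow_lintegral_le_lintegral_rpow {Ω : Type*} [MeasurableSpace Ω] {m : Measure Ω}
    [IsProbabilityMeasure m] {b : ℝ} (hb : 1 ≤ b) {f : Ω → ℝ≥0∞} (hf : AEMeasurable f m) :
    (∫⁻ x, f x ∂m) ^ b ≤ ∫⁻ x, f x ^ b ∂m := by
  rcases hb.eq_or_lt with rfl | hb
  · simp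
  have hb0 : 0 < b := by linarith
  have := ENNReal.lintegral_mul_le_Lp_mul_Lq m (Real.HolderConjugate.conjExponent hb) hf
    (aemeasurable_const (b := (1:ℝ≥0∞)))
  simp only [Pi.mul_apply, mul_one, ENNReal.one_rpow, lintegral_const, measure_univ] at this
  refine (ENNReal.rpow_le_rpow this hb0.le).trans ?_
  rw [← ENNReal.rpow_mul, one_div_mul_cancel hb0.ne', ENNReal.rpow_one]

/-- Splitting a submean inequality at height `ell`. -/
lemma le_lintegral_ite_of_rpow_le {Ω : Type*} [MeasurableSpace Ω] {m : Measure Ω}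
    [IsProbabilityMeasure m] {U : Ω → ℝ≥0∞} (hU : Measurable U) {a : ℝ} (ha : 0 < a)
    (ha1 : a ≤ 1) {v ell : ℝ≥0∞} (h1 : v ≤ ell) (h2 : v ^ a ≤ ∫⁻ x, U x ^ a ∂m) :
    v ≤ ∫⁻ x, (if U x ≤ ell then 2 ^ (1 / a) * U x else 2 * ell ^ (1 - a) * U x ^ a) ∂m := by
  set S : Set Ω := {x | U x ≤ ell}
  have hS : MeasurableSet S := measurableSet_le hU measurable_const
  have hsplit := lintegral_add_compl (μ := m) (fun x => U x ^ a) hS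
  have hsplit2 := lintegral_add_compl (μ := m)
    (fun x => if U x ≤ ell then 2 ^ (1 / a) * U x else 2 * ell ^ (1 - a) * U x ^ a) hS
  rw [setLIntegral_congr_fun (g := fun x => 2 ^ (1 / a) * U x) hS
      (fun x (hx : U x ≤ ell) => if_pos hx),
    setLIntegral_congr_fun (g := fun x => 2 * ell ^ (1 - a) * U x ^ a) hS.compl
      (fun x (hx : ¬ U x ≤ ell) => if_neg hx), lintegral_const_mul _ hU,
    lintegral_const_mul _ (hU.pow_const a)] at hsplit2
  rw [← hsplit2]
  rw [← hsplit] at h2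
  rcases le_total (∫⁻ x in Sᶜ, U x ^ a ∂m) (∫⁻ x in S, U x ^ a ∂m) with h | h
  · refine le_trans ?_ le_self_add
    have h3 : v ^ a ≤ 2 * ∫⁻ x in S, U x ^ a ∂m := by rw [two_mul]; exact h2.trans (by gcongr)
    have h4 : (∫⁻ x in S, U x ^ a ∂m) ^ (1 / a) ≤ ∫⁻ x in S, U x ∂m := by
      rw [← lintegral_indicator hS, ← lintegral_indicator hS]
      refine (rpow_lintegral_le_lintegral_rpow ((one_le_div ha).2 ha1)
        ((hU.pow_const a).indicator hS).aemeasurable).trans (lintegral_mono fun x => ?_)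
      by_cases hx : x ∈ S
      · simp only [indicator_of_mem hx]
        rw [← ENNReal.rpow_mul, mul_one_div_cancel ha.ne', ENNReal.rpow_one]
      · simp only [indicator_of_notMem hx]
        rw [ENNReal.zero_rpow_of_pos (by positivity)]
    calc v = (v ^ a) ^ (1 / a) := by
          rw [← ENNReal.rpow_mul, mul_one_div_cancel ha.ne', ENNReal.rpow_one]
      _ ≤ (2 * ∫⁻ x in S, U x ^ a ∂m) ^ (1 / a) := ENNReal.rpow_le_rpow h3 (by positivity)
      _ = 2 ^ (1 / a) * (∫⁻ x in S, U x ^ a ∂m) ^ (1 / a) :=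
          ENNReal.mul_rpow_of_nonneg _ _ (by positivity)
      _ ≤ _ := by gcongr
  · refine le_trans ?_ le_add_self
    have h3 : v ^ a ≤ 2 * ∫⁻ x in Sᶜ, U x ^ a ∂m := by rw [two_mul]; exact h2.trans (by gcongr)
    calc v = v ^ (1 - a) * v ^ a := by
          rw [← ENNReal.rpow_add_of_nonneg _ _ (by linarith) ha.le]; simp
      _ ≤ ell ^ (1 - a) * (2 * ∫⁻ x in Sᶜ, U x ^ a ∂m) := by
          gcongr
      _ = _ := by ring

lemma lintegral_Ioc_rpow {κ d : ℝ} (hκ : 0 < κ) (hd : 0 ≤ d) :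
    ∫⁻ x in Ioc 0 d, ENNReal.ofReal (x ^ (κ - 1)) = ENNReal.ofReal (d ^ κ / κ) := by
  rw [← ofReal_integral_eq_lintegral_ofReal]
  · rw [← intervalIntegral.integral_of_le hd, integral_rpow (Or.inl (by linarith))]
    simp [Real.zero_rpow hκ.ne']
  · exact (intervalIntegral.intervalIntegrable_rpow' (by linarith)).1
  · exact (ae_restrict_mem measurableSet_Ioc).mono fun x hx => Real.rpow_nonneg hx.1.le _

lemma lintegral_Ioi_rpow {b d : ℝ} (hb : b < -1) (hd : 0 < d) :
    ∫⁻ x in Ioi d, ENNReal.ofReal (x ^ b) = ENNReal.ofReal (-d ^ (b + 1) / (b + 1)) := by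
  rw [← ofReal_integral_eq_lintegral_ofReal (integrableOn_Ioi_rpow_of_lt hb hd)]
  · rw [integral_Ioi_rpow_of_lt hb hd]
  · exact (ae_restrict_mem measurableSet_Ioi).mono fun x hx =>
      Real.rpow_nonneg (hd.trans (mem_Ioi.1 hx)).le _

lemma lintegral_rpow_mul_ite_le {p : ℝ} (hp0 : 0 < p) (hp1 : p < 1) {I u : ℝ} (hI : 0 < I)
    (hu : 0 ≤ u) :
    ∫⁻ t in Ioo (0:ℝ) 1, ENNReal.ofReal ((1 - t) ^ (1 / p - 2)) *
      (if ENNReal.ofReal u ≤ ENNReal.ofReal ((2 * I / (1 - t)) ^ (1 / p)) then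
        2 ^ (1 / (p / 2)) * ENNReal.ofReal u
      else 2 * ENNReal.ofReal ((2 * I / (1 - t)) ^ (1 / p)) ^ (1 - p / 2) *
        ENNReal.ofReal u ^ (p / 2)) ≤
    ENNReal.ofReal ((2 ^ (1 / (p / 2)) / (1 / p - 1) + 4) * 2 ^ (1 / p - 1)) *
      ENNReal.ofReal (I ^ (1 / p - 1)) * ENNReal.ofReal (u ^ p) := by
  have hκ : 0 < 1 / p - 1 := by rw [sub_pos, one_lt_div hp0]; exact hp1
  rcases hu.eq_or_lt with rfl | hu
  · simp
  set d := 2 * I * u ^ (-p) with hd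
  have hd0 : 0 < d := by positivity
  set A : ℝ := 2 ^ (1 / (p / 2)) * u
  set B : ℝ := 2 * (2 * I) ^ (1 / p - 1 / 2) * u ^ (p / 2)
  have hA : 0 ≤ A := by positivity
  have hB : 0 ≤ B := by positivity
  set h : ℝ → ℝ≥0∞ := fun x =>
    ENNReal.ofReal A * (Ioc 0 d).indicator (fun x => ENNReal.ofReal (x ^ (1 / p - 1 - 1))) x +
    ENNReal.ofReal B * (Ioi d).indicator (fun x => ENNReal.ofReal (x ^ (-3 / 2 : ℝ))) x
  have key : ∀ x, 0 < x → (u ≤ (2 * I / x) ^ (1 / p) ↔ x ≤ d) := by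
    intro x hx
    rw [one_div, Real.le_rpow_inv_iff_of_pos hu.le (by positivity) hp0, hd, Real.rpow_neg hu.le,
      le_div_iff₀ hx, ← div_eq_mul_inv, le_div_iff₀ (by positivity), mul_comm]
  calc _ ≤ ∫⁻ t in Ioo (0:ℝ) 1, h (1 - t) := by
        refine setLIntegral_mono' measurableSet_Ioo fun t ht => ?_
        have hx : 0 < 1 - t := by linarith [ht.2]
        generalize 1 - t = x at hx
        have hiff : ENNReal.ofReal u ≤ ENNReal.ofReal ((2 * I / x) ^ (1 / p)) ↔ x ≤ d := by
          rw [ENNReal.ofReal_le_ofReal_iff (by positivity), key x hx]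
        by_cases hxd : x ≤ d
        · rw [if_pos (hiff.2 hxd)]
          refine le_trans (le_of_eq ?_) le_self_add
          rw [indicator_of_mem (show x ∈ Ioc 0 d from ⟨hx, hxd⟩),
            ENNReal.ofReal_mul (by positivity), mul_comm,
            ← ENNReal.ofReal_rpow_of_pos zero_lt_two, ENNReal.ofReal_ofNat]
          congr 2; ring_nf
        · rw [if_neg (hiff.not.2 hxd)]
          refine le_trans (le_of_eq ?_) le_add_self
          rw [indicator_of_mem (show x ∈ Ioi d from not_le.1 hxd),
            ENNReal.ofReal_rpow_of_pos (by positivity), ENNReal.ofReal_rpow_of_pos hu,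
            ← ENNReal.ofReal_ofNat, ← ENNReal.ofReal_mul zero_le_two,
            ← ENNReal.ofReal_mul (by positivity), ← ENNReal.ofReal_mul (by positivity),
            ← ENNReal.ofReal_mul hB]
          congr 1
          rw [← Real.rpow_mul (by positivity), Real.div_rpow (by positivity) hx.le]
          have e1 : 1 / p * (1 - p / 2) = 1 / p - 1 / 2 := by field_simp
          have e2 : x ^ (1 / p - 2) = x ^ (-3 / 2 : ℝ) * x ^ (1 / p - 1 / 2) := by
            rw [← Real.rpow_add hx]; congr 1; ring
          rw [e1, e2]
          have : x ^ (1 / p - 1 / 2) ≠ 0 := by positivity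
          simp only [B]
          generalize x ^ (1 / p - 1 / 2) = y at this
          generalize 1 / p - 1 / 2 = w
          field_simp
    _ ≤ ∫⁻ t, h (1 - t) := setLIntegral_le_lintegral _ _
    _ = ∫⁻ x, h x := lintegral_sub_left_eq_self h 1
    _ = ENNReal.ofReal A * ENNReal.ofReal (d ^ (1 / p - 1) / (1 / p - 1)) +
        ENNReal.ofReal B * ENNReal.ofReal (-d ^ (-3 / 2 + 1 : ℝ) / (-3 / 2 + 1)) := by
        rw [lintegral_add_left, lintegral_const_mul, lintegral_const_mul,
          lintegral_indicator measurableSet_Ioc, lintegral_indicator measurableSet_Ioi,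
          lintegral_Ioc_rpow hκ hd0.le, lintegral_Ioi_rpow (by norm_num) hd0]
        · exact Measurable.indicator (by fun_prop) measurableSet_Ioi
        · exact Measurable.indicator (by fun_prop) measurableSet_Ioc
        · exact Measurable.const_mul (Measurable.indicator (by fun_prop) measurableSet_Ioc) _
    _ ≤ _ := by
        rw [← ENNReal.ofReal_mul hA, ← ENNReal.ofReal_mul hB, ← ENNReal.ofReal_mul (by positivity),
          ← ENNReal.ofReal_mul (by positivity), ← ENNReal.ofReal_add (by positivity)]
        · refine ENNReal.ofReal_le_ofReal (le_of_eq ?_)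
          have e1 : d ^ (1 / p - 1) * u = (2 * I) ^ (1 / p - 1) * u ^ p := by
            rw [hd, Real.mul_rpow (by positivity) (by positivity), ← Real.rpow_mul hu.le, mul_assoc]
            nth_rw 2 [← Real.rpow_one u]
            rw [← Real.rpow_add hu]
            congr 2; field_simp; ring
          have e2 : (2 * I) ^ (1 / p - 1 / 2) * u ^ (p / 2) * d ^ (-1 / 2 : ℝ) =
              (2 * I) ^ (1 / p - 1) * u ^ p := by
            rw [hd, Real.mul_rpow (x := 2 * I) (y := u ^ (-p)) (by positivity) (by positivity),
              ← Real.rpow_mul hu.le]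
            have e3 : (2 * I) ^ (1 / p - 1) = (2 * I) ^ (1 / p - 1 / 2) * (2 * I) ^ (-1 / 2 : ℝ) := by
              rw [← Real.rpow_add (by positivity)]; congr 1; ring
            have e4 : u ^ p = u ^ (p / 2) * u ^ (-p * (-1 / 2)) := by
              rw [← Real.rpow_add hu]; congr 1; ring
            rw [e3, e4]; ring
          have e5 : (-3 / 2 + 1 : ℝ) = -1 / 2 := by norm_num
          have e6 : (2 * I) ^ (1 / p - 1) = 2 ^ (1 / p - 1) * I ^ (1 / p - 1) :=
            Real.mul_rpow zero_le_two hI.le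
          rw [e5]
          calc _ = 2 ^ (1 / (p / 2)) / (1 / p - 1) * (d ^ (1 / p - 1) * u) +
              4 * ((2 * I) ^ (1 / p - 1 / 2) * u ^ (p / 2) * d ^ (-1 / 2 : ℝ)) := by
                simp only [A, B]; ring
            _ = _ := by rw [e1, e2, e6]; ring
        · apply mul_nonneg hB
          rw [neg_div, ← div_neg]
          have : (0:ℝ) ≤ -(-3 / 2 + 1) := by norm_num
          positivity

lemma lintegral_circle_le_lintegral_ite {p : ℝ} (hp0 : 0 < p) (hp1 : p < 1) {F : ℂ → ℂ} {R : ℝ}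
    (hR : 1 < R) (hF : DifferentiableOn ℂ F (Metric.ball 0 R)) {I : ℝ}
    (hI : ENNReal.ofReal I = ∫⁻ θ, ENNReal.ofReal (‖F (circlePt 1 θ)‖ ^ p) ∂arcMeasure)
    (hI0 : 0 ≤ I) {t : ℝ} (ht : 0 ≤ t) (ht1 : t < 1) (φ : ℝ) :
    ENNReal.ofReal ‖F (circlePt t φ)‖ ≤ ∫⁻ θ, ENNReal.ofReal (poissonArc t φ θ) *
      (if ENNReal.ofReal ‖F (circlePt 1 θ)‖ ≤ ENNReal.ofReal ((2 * I / (1 - t)) ^ (1 / p)) then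
        2 ^ (1 / (p / 2)) * ENNReal.ofReal ‖F (circlePt 1 θ)‖
      else 2 * ENNReal.ofReal ((2 * I / (1 - t)) ^ (1 / p)) ^ (1 - p / 2) *
        ENNReal.ofReal ‖F (circlePt 1 θ)‖ ^ (p / 2)) ∂arcMeasure := by
  have h1t : 0 < 1 - t := by linarith
  have hP : Measurable fun θ => ENNReal.ofReal (poissonArc t φ θ) :=
    ENNReal.measurable_ofReal.comp (continuous_poissonArc_right ht ht1 φ).measurable
  have hU : Measurable fun θ => ENNReal.ofReal ‖F (circlePt 1 θ)‖ :=
    ENNReal.measurable_ofReal.comp (continuous_comp_circlePt hF zero_le_one hR).norm.measurable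
  set m := arcMeasure.withDensity fun θ => ENNReal.ofReal (poissonArc t φ θ)
  have hm : IsProbabilityMeasure m := ⟨by
    rw [withDensity_apply _ MeasurableSet.univ, Measure.restrict_univ,
      lintegral_poissonArc ht ht1]⟩
  have hmeas : Measurable fun θ : ℝ =>
      (if ENNReal.ofReal ‖F (circlePt 1 θ)‖ ≤ ENNReal.ofReal ((2 * I / (1 - t)) ^ (1 / p)) then
        2 ^ (1 / (p / 2)) * ENNReal.ofReal ‖F (circlePt 1 θ)‖
      else 2 * ENNReal.ofReal ((2 * I / (1 - t)) ^ (1 / p)) ^ (1 - p / 2) *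
        ENNReal.ofReal ‖F (circlePt 1 θ)‖ ^ (p / 2)) :=
    Measurable.ite (measurableSet_le hU measurable_const) (hU.const_mul _)
      ((hU.pow_const _).const_mul _)
  have hlow : ∀ {a : ℝ}, 0 < a → ENNReal.ofReal ‖F (circlePt t φ)‖ ^ a ≤
      ∫⁻ θ, ENNReal.ofReal (poissonArc t φ θ) *
        ENNReal.ofReal ‖F (circlePt 1 θ)‖ ^ a ∂arcMeasure := by
    intro a ha
    have := ofReal_rpow_norm_le_lintegral ha hR hF ht ht1 φ
    simpa only [ENNReal.ofReal_rpow_of_nonneg (norm_nonneg _) ha.le] using this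
  have h1 : ENNReal.ofReal ‖F (circlePt t φ)‖ ≤ ENNReal.ofReal ((2 * I / (1 - t)) ^ (1 / p)) := by
    rw [← ENNReal.ofReal_rpow_of_nonneg (by positivity) (by positivity), one_div,
      ENNReal.le_rpow_inv_iff hp0]
    refine (hlow hp0).trans ?_
    calc _ ≤ ∫⁻ θ, ENNReal.ofReal (2 / (1 - t)) *
        ENNReal.ofReal ‖F (circlePt 1 θ)‖ ^ p ∂arcMeasure := by
          refine lintegral_mono fun θ => ?_
          gcongr
          exact poissonArc_le ht ht1 φ θ
      _ = _ := by
          rw [lintegral_const_mul _ (hU.pow_const p)]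
          simp_rw [ENNReal.ofReal_rpow_of_nonneg (norm_nonneg _) hp0.le]
          rw [← hI, ← ENNReal.ofReal_mul (by positivity)]
          congr 1; ring
  have := le_lintegral_ite_of_rpow_le (m := m) hU (half_pos hp0) (by linarith) h1
    (v := ENNReal.ofReal ‖F (circlePt t φ)‖) ?_
  · rwa [lintegral_withDensity_eq_lintegral_mul _ hP hmeas] at this
  · rw [lintegral_withDensity_eq_lintegral_mul _ hP (hU.pow_const _)]
    exact hlow (half_pos hp0)

/-- The embedding constant of `lintegral_rpow_mul_circle_le`. -/
def embConst (p : ℝ) : ℝ := (2 ^ (1 / (p / 2)) / (1 / p - 1) + 4) * 2 ^ (1 / p - 1)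

lemma embConst_pos {p : ℝ} (hp0 : 0 < p) (hp1 : p < 1) : 0 < embConst p := by
  have hκ : 0 < 1 / p - 1 := by rw [sub_pos, one_lt_div hp0]; exact hp1
  unfold embConst; positivity

/-- A function in `H^p`, `p < 1`, belongs to the Bergman space `A¹` with weight
`(1 - t)^{1/p - 2}`. -/
lemma lintegral_rpow_mul_circle_le {p : ℝ} (hp0 : 0 < p) (hp1 : p < 1) {F : ℂ → ℂ} {R : ℝ}
    (hR : 1 < R) (hF : DifferentiableOn ℂ F (Metric.ball 0 R)) :
    ∫⁻ t in Ioo (0:ℝ) 1, ENNReal.ofReal ((1 - t) ^ (1 / p - 2)) *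
      ∫⁻ φ, ENNReal.ofReal ‖F (circlePt t φ)‖ ∂arcMeasure ≤
    ENNReal.ofReal (embConst p) * MpE p 1 F := by
  have hκ : 0 < 1 / p - 1 := by rw [sub_pos, one_lt_div hp0]; exact hp1
  have hc := continuous_comp_circlePt hF zero_le_one hR
  have hcp : Continuous fun θ => ‖F (circlePt 1 θ)‖ ^ p :=
    hc.norm.rpow_const fun _ => Or.inr hp0.le
  set I := ∫ θ, ‖F (circlePt 1 θ)‖ ^ p ∂arcMeasure with hIdef
  have hI : ENNReal.ofReal I = ∫⁻ θ, ENNReal.ofReal (‖F (circlePt 1 θ)‖ ^ p) ∂arcMeasure :=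
    ofReal_integral_eq_lintegral_ofReal hcp.integrable_arcMeasure
      (ae_of_all _ fun θ => by positivity)
  have hI0 : 0 ≤ I := integral_nonneg fun θ => by positivity
  have hU : Measurable fun θ => ENNReal.ofReal ‖F (circlePt 1 θ)‖ :=
    ENNReal.measurable_ofReal.comp hc.norm.measurable
  have hmeas : Measurable fun x : ℝ × ℝ =>
      (if ENNReal.ofReal ‖F (circlePt 1 x.2)‖ ≤
          ENNReal.ofReal ((2 * I / (1 - x.1)) ^ (1 / p)) then
        2 ^ (1 / (p / 2)) * ENNReal.ofReal ‖F (circlePt 1 x.2)‖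
      else 2 * ENNReal.ofReal ((2 * I / (1 - x.1)) ^ (1 / p)) ^ (1 - p / 2) *
        ENNReal.ofReal ‖F (circlePt 1 x.2)‖ ^ (p / 2)) := by
    have h2 : Measurable fun x : ℝ × ℝ => ENNReal.ofReal ‖F (circlePt 1 x.2)‖ :=
      hU.comp measurable_snd
    have h1 : Measurable fun x : ℝ × ℝ => ENNReal.ofReal ((2 * I / (1 - x.1)) ^ (1 / p)) := by
      fun_prop
    exact Measurable.ite (measurableSet_le h2 h1) (h2.const_mul _)
      (((h1.pow_const _).const_mul _).mul (h2.pow_const _))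
  set G : ℝ → ℝ → ℝ≥0∞ := fun t θ =>
      (if ENNReal.ofReal ‖F (circlePt 1 θ)‖ ≤ ENNReal.ofReal ((2 * I / (1 - t)) ^ (1 / p)) then
        2 ^ (1 / (p / 2)) * ENNReal.ofReal ‖F (circlePt 1 θ)‖
      else 2 * ENNReal.ofReal ((2 * I / (1 - t)) ^ (1 / p)) ^ (1 - p / 2) *
        ENNReal.ofReal ‖F (circlePt 1 θ)‖ ^ (p / 2)) with hG
  have hGm : Measurable (Function.uncurry G) := hmeas
  have hinner : ∀ t ∈ Ioo (0:ℝ) 1, ∫⁻ φ, ENNReal.ofReal ‖F (circlePt t φ)‖ ∂arcMeasure ≤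
      ∫⁻ θ, G t θ ∂arcMeasure := by
    intro t ht
    have hGt : Measurable (G t) := hGm.of_uncurry_left
    have hP : Measurable fun x : ℝ × ℝ => ENNReal.ofReal (poissonArc t x.1 x.2) :=
      ENNReal.measurable_ofReal.comp (continuous_poissonArc ht.1.le ht.2).measurable
    calc _ ≤ ∫⁻ φ, ∫⁻ θ, ENNReal.ofReal (poissonArc t φ θ) * G t θ ∂arcMeasure ∂arcMeasure :=
          lintegral_mono fun φ =>
            lintegral_circle_le_lintegral_ite hp0 hp1 hR hF hI hI0 ht.1.le ht.2 φ
      _ = ∫⁻ θ, ∫⁻ φ, ENNReal.ofReal (poissonArc t φ θ) * G t θ ∂arcMeasure ∂arcMeasure :=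
          lintegral_lintegral_swap (hP.mul (hGt.comp measurable_snd)).aemeasurable
      _ = _ := by
          refine lintegral_congr fun θ => ?_
          rw [lintegral_mul_const _ (show Measurable fun φ => ENNReal.ofReal (poissonArc t φ θ) from
            Measurable.comp (g := fun x : ℝ × ℝ => ENNReal.ofReal (poissonArc t x.1 x.2))
              (f := fun φ => (φ, θ)) hP (by fun_prop))]
          simp_rw [poissonArc_symm t _ θ, lintegral_poissonArc ht.1.le ht.2, one_mul]
  rcases hI0.eq_or_lt with h0 | hIpos
  · have hz : ∀ t ∈ Ioo (0:ℝ) 1, ∫⁻ φ, ENNReal.ofReal ‖F (circlePt t φ)‖ ∂arcMeasure = 0 := by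
      intro t ht
      refine le_antisymm ((hinner t ht).trans ?_) zero_le
      have h1p : 1 / p ≠ 0 := by positivity
      have h2p : 0 < 1 - p / 2 := by linarith
      simp only [hG, ← h0, mul_zero, zero_div, Real.zero_rpow h1p, ENNReal.ofReal_zero,
        ENNReal.zero_rpow_of_pos h2p, zero_mul]
      refine (lintegral_mono (g := fun _ => 0) fun θ => ?_).trans (by simp)
      simp only [nonpos_iff_eq_zero, ite_eq_right_iff]
      intro h; rw [h, mul_zero]
    rw [setLIntegral_congr_fun (g := fun _ => 0) measurableSet_Ioo fun t ht => by
      simp only [hz t ht, mul_zero]]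
    simp
  calc _ ≤ ∫⁻ t in Ioo (0:ℝ) 1, ENNReal.ofReal ((1 - t) ^ (1 / p - 2)) *
        ∫⁻ θ, G t θ ∂arcMeasure :=
        setLIntegral_mono' measurableSet_Ioo fun t ht => mul_le_mul_right (hinner t ht) _
    _ = ∫⁻ t in Ioo (0:ℝ) 1, ∫⁻ θ, ENNReal.ofReal ((1 - t) ^ (1 / p - 2)) * G t θ ∂arcMeasure :=
        lintegral_congr fun t => (lintegral_const_mul _ hGm.of_uncurry_left).symm
    _ = ∫⁻ θ, (∫⁻ t in Ioo (0:ℝ) 1,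
          ENNReal.ofReal ((1 - t) ^ (1 / p - 2)) * G t θ) ∂arcMeasure :=
        lintegral_lintegral_swap (Measurable.mul
          (by fun_prop : Measurable fun x : ℝ × ℝ => ENNReal.ofReal ((1 - x.1) ^ (1 / p - 2)))
          hGm).aemeasurable
    _ ≤ ∫⁻ θ, ENNReal.ofReal (embConst p) * ENNReal.ofReal (I ^ (1 / p - 1)) *
          ENNReal.ofReal (‖F (circlePt 1 θ)‖ ^ p) ∂arcMeasure :=
        lintegral_mono fun θ =>
          lintegral_rpow_mul_ite_le hp0 hp1 hIpos (norm_nonneg (F (circlePt 1 θ)))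
    _ = _ := by
        rw [lintegral_const_mul _ hcp.measurable.ennreal_ofReal, ← hI, MpE_eq,
          ← hI, mul_assoc, ← ENNReal.ofReal_mul (by positivity),
          ENNReal.ofReal_rpow_of_pos hIpos]
        congr 2
        nth_rw 2 [← Real.rpow_one I]
        rw [← Real.rpow_add hIpos]
        congr 1; ring

/-! ### Orthogonality relations on the circle -/

lemma integral_circlePt_pow_mul_conj (n m : ℕ) :
    ∫ θ, circlePt 1 θ ^ n * (starRingEnd ℂ) (circlePt 1 θ ^ m) ∂arcMeasure =
      if n = m then 1 else 0 := by
  have h : ∀ θ, circlePt 1 θ ^ n * (starRingEnd ℂ) (circlePt 1 θ ^ m) =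
      Complex.exp ((((n - m : ℤ) : ℂ) * Complex.I) * (θ:ℂ)) := by
    intro θ
    simp only [circlePt, Complex.ofReal_one, one_mul, map_pow, ← Complex.exp_conj, map_mul,
      Complex.conj_ofReal, Complex.conj_I]
    rw [← Complex.exp_nat_mul, ← Complex.exp_nat_mul, ← Complex.exp_add]
    congr 1; push_cast; ring
  simp_rw [h]
  split_ifs with hnm
  · simp [hnm]
  · have hc : (((n - m : ℤ) : ℂ) * Complex.I) ≠ 0 := by
      refine mul_ne_zero ?_ Complex.I_ne_zero
      rw [Int.cast_ne_zero]; omega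
    rw [integral_arcMeasure, integral_exp_mul_complex hc]
    have : Complex.exp ((((n - m : ℤ) : ℂ) * Complex.I) * ((2 * Real.pi : ℝ) : ℂ)) = 1 := by
      rw [← Complex.exp_int_mul_two_pi_mul_I (n - m : ℤ)]
      congr 1; push_cast; ring
    rw [this]; simp

lemma summable_mul_pow_of_norm {a : ℕ → ℂ} (ha : Summable fun n => ‖a n‖) {z : ℂ}
    (hz : ‖z‖ ≤ 1) : Summable fun n => ‖a n * z ^ n‖ := by
  refine ha.of_nonneg_of_le (fun _ => norm_nonneg _) fun n => ?_
  rw [norm_mul, norm_pow]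
  exact mul_le_of_le_one_right (norm_nonneg _) (pow_le_one₀ (norm_nonneg _) hz)

lemma integral_tsum_mul_conj_tsum {a b : ℕ → ℂ} (ha : Summable fun n => ‖a n‖)
    (hb : Summable fun n => ‖b n‖) :
    ∫ θ, (∑' n, a n * circlePt 1 θ ^ n) * (starRingEnd ℂ) (∑' n, b n * circlePt 1 θ ^ n)
      ∂arcMeasure = ∑' n, a n * (starRingEnd ℂ) (b n) := by
  have hz : ∀ θ, ‖circlePt 1 θ‖ ≤ 1 := fun θ => (norm_circlePt zero_le_one θ).le
  have hab : Summable fun x : ℕ × ℕ => ‖a x.1‖ * ‖b x.2‖ :=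
    ha.mul_of_nonneg hb (fun _ => norm_nonneg _) fun _ => norm_nonneg _
  have hcont : Continuous (circlePt 1) := continuous_circlePt_right 1
  set F : ℕ × ℕ → ℝ → ℂ := fun x θ => (a x.1 * circlePt 1 θ ^ x.1) *
    (starRingEnd ℂ) (b x.2 * circlePt 1 θ ^ x.2)
  have hFc : ∀ x, Continuous (F x) := fun x => by
    refine (continuous_const.mul (hcont.pow _)).mul ?_
    exact Complex.continuous_conj.comp (continuous_const.mul (hcont.pow _))
  have hFn : ∀ x θ, ‖F x θ‖ = ‖a x.1‖ * ‖b x.2‖ := fun x θ => by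
    simp only [F, norm_mul, RCLike.norm_conj, norm_pow, norm_circlePt zero_le_one θ, one_pow,
      mul_one]
  have h1 : ∀ θ, (∑' n, a n * circlePt 1 θ ^ n) *
      (starRingEnd ℂ) (∑' n, b n * circlePt 1 θ ^ n) = ∑' x, F x θ := by
    intro θ
    rw [Complex.conj_tsum, tsum_mul_tsum_of_summable_norm (summable_mul_pow_of_norm ha (hz θ))]
    simpa only [RCLike.norm_conj] using summable_mul_pow_of_norm hb (hz θ)
  have h2 := integral_tsum_of_summable_integral_norm (μ := arcMeasure) (F := F)
    (fun x => (hFc x).integrable_arcMeasure) (by simpa only [hFn, integral_const, measureReal_def,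
      measure_univ, ENNReal.toReal_one, one_smul] using hab)
  simp_rw [h1]
  rw [← h2]
  have h3 : ∀ x, ∫ θ, F x θ ∂arcMeasure =
      if x.1 = x.2 then a x.1 * (starRingEnd ℂ) (b x.2) else 0 := by
    intro x
    have : ∀ θ, F x θ = a x.1 * (starRingEnd ℂ) (b x.2) *
        (circlePt 1 θ ^ x.1 * (starRingEnd ℂ) (circlePt 1 θ ^ x.2)) := by
      intro θ; simp only [F, map_mul]; ring
    simp_rw [this]
    rw [integral_const_mul, integral_circlePt_pow_mul_conj]
    simp
  simp_rw [h3]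
  have hs : Summable fun x : ℕ × ℕ => if x.1 = x.2 then a x.1 * (starRingEnd ℂ) (b x.2) else 0 := by
    refine Summable.of_norm_bounded hab fun x => ?_
    split_ifs
    · rw [norm_mul, RCLike.norm_conj]
    · rw [norm_zero]; positivity
  rw [hs.tsum_prod]
  refine tsum_congr fun n => ?_
  rw [tsum_eq_single n]
  · simp
  · intro m hm; rw [if_neg (Ne.symm hm)]

lemma continuous_tsum_circlePt {a : ℕ → ℂ} (ha : Summable fun n => ‖a n‖) :
    Continuous fun θ => ∑' n, a n * circlePt 1 θ ^ n := by
  refine continuous_tsum (fun n => continuous_const.mul ((continuous_circlePt_right 1).pow n)) ha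
    fun n θ => ?_
  rw [norm_mul, norm_pow, norm_circlePt zero_le_one, one_pow, mul_one]

lemma integral_norm_sq_tsum {a : ℕ → ℂ} (ha : Summable fun n => ‖a n‖) :
    ∫ θ, ‖∑' n, a n * circlePt 1 θ ^ n‖ ^ 2 ∂arcMeasure = ∑' n, ‖a n‖ ^ 2 := by
  have := integral_tsum_mul_conj_tsum ha ha
  simp_rw [Complex.mul_conj'] at this
  apply Complex.ofReal_injective
  rw [Complex.ofReal_tsum]
  simp_rw [Complex.ofReal_pow]
  rw [← this, ← integral_complex_ofReal]
  simp_rw [Complex.ofReal_pow]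

/-! ### Moments of weights with doubling tails -/

lemma lintegral_pow_le_of_tail {m : Measure ℝ} [IsFiniteMeasure m] (hm : ∀ᵐ r ∂m, r ∈ Ioo (0:ℝ) 1)
    {K : ℝ≥0∞} (hK : 1 ≤ K) (hK' : K ≠ ⊤)
    (h : ∀ t ∈ Ioo (0:ℝ) 1, m (Ioi t) ≤ K * m (Ioi (√t))) (N : ℕ) :
    ∫⁻ r, ENNReal.ofReal (r ^ N) ∂m ≤ K * ∫⁻ r, ENNReal.ofReal (r ^ (2 * N)) ∂m := by
  rcases Nat.eq_zero_or_pos N with rfl | hN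
  · simp only [pow_zero, mul_zero]
    exact le_mul_of_one_le_left' hK
  have hint : ∀ x : ℝ, ∫ t in (0:ℝ)..x, (N:ℝ) * t ^ (N - 1) = x ^ N := by
    intro x
    rw [intervalIntegral.integral_const_mul, integral_pow]
    have : ((N - 1 : ℕ):ℝ) + 1 = N := by
      rw [← Nat.cast_add_one, Nat.sub_add_cancel hN]
    rw [Nat.sub_add_cancel hN, zero_pow hN.ne', this]
    field_simp
    ring
  have key : ∀ f : ℝ → ℝ, Measurable f → (∀ r ∈ Ioo (0:ℝ) 1, 0 ≤ f r) →
      ∫⁻ r, ENNReal.ofReal (f r ^ N) ∂m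
        = ∫⁻ t in Ioi 0, m {a | t < f a} * ENNReal.ofReal (N * t ^ (N - 1)) := by
    intro f hf hf0
    rw [← lintegral_comp_eq_lintegral_meas_lt_mul m (f := f) (g := fun t => N * t ^ (N - 1))
      (hm.mono fun r hr => hf0 r hr) hf.aemeasurable]
    · simp_rw [hint]
    · intro t _
      exact Continuous.intervalIntegrable (by fun_prop) _ _
    · filter_upwards [ae_restrict_mem measurableSet_Ioi] with t ht
      have : (0:ℝ) < t := ht
      positivity
  have h2 : ∀ r : ℝ, r ^ (2 * N) = (r ^ 2) ^ N := fun r => pow_mul r 2 N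
  simp_rw [h2]
  rw [key (fun r => r) measurable_id (fun r hr => hr.1.le), key (fun r => r ^ 2) (by fun_prop)
    (fun r _ => sq_nonneg r), ← lintegral_const_mul' _ _ ?_]
  · refine setLIntegral_mono' measurableSet_Ioi fun t ht => ?_
    rw [← mul_assoc]
    gcongr
    rcases lt_or_ge t 1 with h1 | h1
    · refine (h t ⟨ht, h1⟩).trans ?_
      gcongr
      intro a (ha : √t < a)
      exact (Real.sqrt_lt' ((Real.sqrt_nonneg t).trans_lt ha)).1 ha
    · have : m {a | t < a} = 0 := by
        rw [measure_eq_zero_iff_ae_notMem]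
        filter_upwards [hm] with r hr hr'
        exact absurd (lt_of_le_of_lt h1 hr') (not_lt.2 hr.2.le)
      rw [this]; exact zero_le
  · exact hK'

lemma add_one_mul_pow_mul_one_sub_le {r : ℝ} (h0 : 0 ≤ r) (h1 : r ≤ 1) (n : ℕ) :
    ((n:ℝ) + 1) * r ^ n * (1 - r) ≤ 1 := by
  have h : ((n:ℝ) + 1) * r ^ n ≤ ∑ k ∈ Finset.range (n + 1), r ^ k := by
    have := Finset.card_nsmul_le_sum (Finset.range (n + 1)) (fun k => r ^ k) (r ^ n)
      fun k hk => pow_le_pow_of_le_one h0 h1 (by simpa using Finset.mem_range_succ_iff.1 hk)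
    simpa using this
  have h2 := mul_neg_geom_sum r (n + 1)
  calc _ ≤ (∑ k ∈ Finset.range (n + 1), r ^ k) * (1 - r) := by gcongr
    _ = 1 - r ^ (n + 1) := by rw [mul_comm, h2]
    _ ≤ 1 := by linarith [pow_nonneg h0 (n + 1)]


lemma integrableOn_mul_weight {w : ℝ → ℝ} (hw : IntegrableOn w (Ioo 0 1)) {f : ℝ → ℝ}
    (hf : ContinuousOn f (Icc 0 1)) : IntegrableOn (fun r => f r * w r) (Ioo 0 1) :=
  hw.continuousOn_mul_of_subset hf isCompact_Icc measurableSet_Ioo Ioo_subset_Icc_self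

lemma ofReal_integral_mul_weight {w : ℝ → ℝ} (hw : IntegrableOn w (Ioo 0 1))
    (hw0 : ∀ r ∈ Ioo (0:ℝ) 1, 0 ≤ w r) {f : ℝ → ℝ} (hf : Continuous f)
    (hf0 : ∀ r ∈ Ioo (0:ℝ) 1, 0 ≤ f r) :
    ENNReal.ofReal (∫ r in (0:ℝ)..1, f r * w r) = ∫⁻ r, ENNReal.ofReal (f r)
      ∂((volume.restrict (Ioo (0:ℝ) 1)).withDensity fun r => ENNReal.ofReal (w r)) := by
  rw [intervalIntegral.integral_of_le zero_le_one, integral_Ioc_eq_integral_Ioo,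
    ofReal_integral_eq_lintegral_ofReal (integrableOn_mul_weight hw hf.continuousOn),
    lintegral_withDensity_eq_lintegral_mul₀ hw.aemeasurable.ennreal_ofReal
      (by fun_prop)]
  · refine setLIntegral_congr_fun measurableSet_Ioo fun r hr => ?_
    rw [mul_comm, ENNReal.ofReal_mul (hw0 r hr)]
    rfl
  · filter_upwards [ae_restrict_mem measurableSet_Ioo] with r hr
    exact mul_nonneg (hf0 r hr) (hw0 r hr)

lemma withDensity_weight_Ioi {w : ℝ → ℝ} (hw : IntegrableOn w (Ioo 0 1))
    (hw0 : ∀ r ∈ Ioo (0:ℝ) 1, 0 ≤ w r) {t : ℝ} (ht : t ∈ Ioo (0:ℝ) 1) :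
    ((volume.restrict (Ioo (0:ℝ) 1)).withDensity fun r => ENNReal.ofReal (w r)) (Ioi t)
      = ENNReal.ofReal (∫ r in t..1, w r) := by
  have hs : Ioi t ∩ Ioo 0 1 = Ioo t 1 := by
    ext x; simp only [mem_inter_iff, mem_Ioi, mem_Ioo]
    exact ⟨fun h => ⟨h.1, h.2.2⟩, fun h => ⟨h.1, ht.1.trans h.1, h.2⟩⟩
  rw [withDensity_apply _ measurableSet_Ioi, Measure.restrict_restrict measurableSet_Ioi, hs,
    intervalIntegral.integral_of_le ht.2.le, integral_Ioc_eq_integral_Ioo,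
    ofReal_integral_eq_lintegral_ofReal (hw.mono_set (Ioo_subset_Ioo_left ht.1.le))]
  filter_upwards [ae_restrict_mem measurableSet_Ioo] with r hr
  exact hw0 r ⟨ht.1.trans hr.1, hr.2⟩

lemma integral_pow_mul_weight_le_of_tail {w : ℝ → ℝ} (hw : IntegrableOn w (Ioo 0 1))
    (hw0 : ∀ r ∈ Ioo (0:ℝ) 1, 0 ≤ w r) {K : ℝ} (hK : 1 ≤ K)
    (h : ∀ t ∈ Ioo (0:ℝ) 1, ∫ r in t..1, w r ≤ K * ∫ r in √t..1, w r) (N : ℕ) :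
    ∫ r in (0:ℝ)..1, r ^ N * w r ≤ K * ∫ r in (0:ℝ)..1, r ^ (2 * N) * w r := by
  set m := (volume.restrict (Ioo (0:ℝ) 1)).withDensity fun r => ENNReal.ofReal (w r) with hm
  have hfin : IsFiniteMeasure m := by
    refine isFiniteMeasure_withDensity ?_
    have := hw.2
    rw [hasFiniteIntegral_iff_ofReal] at this
    · exact this.ne
    · filter_upwards [ae_restrict_mem measurableSet_Ioo] with r hr using hw0 r hr
  have hmem : ∀ᵐ r ∂m, r ∈ Ioo (0:ℝ) 1 :=
    (withDensity_absolutelyContinuous _ _).ae_le (ae_restrict_mem measurableSet_Ioo)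
  have key := lintegral_pow_le_of_tail hmem (K := ENNReal.ofReal K)
    (by simpa using hK) ENNReal.ofReal_ne_top (fun t ht => ?_) N
  · have hnn : 0 ≤ ∫ r in (0:ℝ)..1, r ^ (2 * N) * w r := by
      rw [intervalIntegral.integral_of_le zero_le_one, integral_Ioc_eq_integral_Ioo]
      exact setIntegral_nonneg measurableSet_Ioo fun r hr =>
        mul_nonneg (pow_nonneg hr.1.le _) (hw0 r hr)
    rw [← ofReal_integral_mul_weight hw hw0 (by fun_prop) fun r hr => pow_nonneg hr.1.le _,
      ← ofReal_integral_mul_weight hw hw0 (by fun_prop) fun r hr => pow_nonneg hr.1.le _,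
      ← ENNReal.ofReal_mul (by linarith)] at key
    exact (ENNReal.ofReal_le_ofReal_iff (by positivity)).1 key
  · have hst : √t ∈ Ioo (0:ℝ) 1 := ⟨Real.sqrt_pos.2 ht.1, by
      rw [Real.sqrt_lt' one_pos]; simpa using ht.2⟩
    rw [hm, withDensity_weight_Ioi hw hw0 ht, withDensity_weight_Ioi hw hw0 hst,
      ← ENNReal.ofReal_mul (by linarith)]
    exact ENNReal.ofReal_le_ofReal (h t ht)

lemma intervalIntegrable_mul_weight {w : ℝ → ℝ} (hw : IntegrableOn w (Ioo 0 1)) {f : ℝ → ℝ}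
    (hf : ContinuousOn f (Icc 0 1)) : IntervalIntegrable (fun r => f r * w r) volume 0 1 := by
  rw [intervalIntegrable_iff_integrableOn_Ioo_of_le zero_le_one]
  exact integrableOn_mul_weight hw hf

/-- Moments of a weight with doubling tails decrease slowly. -/
lemma moment_sub_le_of_tail {w : ℝ → ℝ} (hw : IntegrableOn w (Ioo 0 1))
    (hw0 : ∀ r ∈ Ioo (0:ℝ) 1, 0 ≤ w r) {K : ℝ} (hK : 1 ≤ K)
    (h : ∀ t ∈ Ioo (0:ℝ) 1, ∫ r in t..1, w r ≤ K * ∫ r in √t..1, w r) (n j : ℕ) :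
    ((n:ℝ) + 1) * ((∫ r in (0:ℝ)..1, r ^ (2 * n + j) * w r) -
      ∫ r in (0:ℝ)..1, r ^ (2 * (n + 1) + j) * w r) ≤
      2 * K * ∫ r in (0:ℝ)..1, r ^ (2 * n + j) * w r := by
  have hii : ∀ N : ℕ, IntervalIntegrable (fun r => r ^ N * w r) volume 0 1 := fun N =>
    intervalIntegrable_mul_weight hw (by fun_prop)
  calc ((n:ℝ) + 1) * ((∫ r in (0:ℝ)..1, r ^ (2 * n + j) * w r) -
        ∫ r in (0:ℝ)..1, r ^ (2 * (n + 1) + j) * w r)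
      = ∫ r in (0:ℝ)..1, ((n:ℝ) + 1) * (r ^ (2 * n + j) * w r - r ^ (2 * (n + 1) + j) * w r) := by
        rw [intervalIntegral.integral_const_mul, intervalIntegral.integral_sub (hii _) (hii _)]
    _ ≤ ∫ r in (0:ℝ)..1, 2 * (r ^ (n + j) * w r) := by
        refine intervalIntegral.integral_mono_on_of_le_Ioo zero_le_one
          (((hii _).sub (hii _)).const_mul _) ((hii _).const_mul _) fun r hr => ?_
        have h1 := add_one_mul_pow_mul_one_sub_le hr.1.le hr.2.le n
        have h3 : 0 ≤ r ^ (n + j) * w r := mul_nonneg (pow_nonneg hr.1.le _) (hw0 r hr)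
        have h2 : ((n:ℝ) + 1) * (r ^ (2 * n + j) * w r - r ^ (2 * (n + 1) + j) * w r)
            = (((n:ℝ) + 1) * r ^ n * (1 - r)) * (1 + r) * (r ^ (n + j) * w r) := by ring
        rw [h2]
        gcongr
        have : 0 ≤ ((n:ℝ) + 1) * r ^ n * (1 - r) :=
          mul_nonneg (mul_nonneg (by positivity) (pow_nonneg hr.1.le _)) (by linarith [hr.2])
        nlinarith [hr.1, hr.2]
    _ = 2 * ∫ r in (0:ℝ)..1, r ^ (n + j) * w r := intervalIntegral.integral_const_mul _ _
    _ ≤ 2 * (K * ∫ r in (0:ℝ)..1, r ^ (2 * (n + j)) * w r) := by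
        gcongr; exact integral_pow_mul_weight_le_of_tail hw hw0 hK h _
    _ ≤ 2 * (K * ∫ r in (0:ℝ)..1, r ^ (2 * n + j) * w r) := by
        gcongr
        refine intervalIntegral.integral_mono_on_of_le_Ioo zero_le_one (hii _) (hii _)
          fun r hr => ?_
        gcongr ?_ * _
        · exact hw0 r hr
        · exact pow_le_pow_of_le_one hr.1.le hr.2.le (by omega)
    _ = _ := by ring

/-! ### The tail function of a radial weight -/

lemma IsRadialWeight.integrableOn_Ioo {ω : ℝ → ℝ} (hω : IsRadialWeight ω) :
    IntegrableOn ω (Ioo 0 1) := hω.2.mono_set Ioo_subset_Ico_self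

lemma IsRadialWeight.nonneg_Ioo {ω : ℝ → ℝ} (hω : IsRadialWeight ω) :
    ∀ r ∈ Ioo (0:ℝ) 1, 0 ≤ ω r := fun r hr => hω.1 r ⟨hr.1.le, hr.2⟩

lemma IsRadialWeight.intervalIntegrable {ω : ℝ → ℝ} (hω : IsRadialWeight ω) {a b : ℝ}
    (ha : a ∈ Icc (0:ℝ) 1) (hb : b ∈ Icc (0:ℝ) 1) : IntervalIntegrable ω volume a b := by
  have h : IntervalIntegrable ω volume 0 1 := by
    rw [intervalIntegrable_iff_integrableOn_Ioo_of_le zero_le_one]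
    exact hω.integrableOn_Ioo
  refine h.mono_set ?_
  rw [uIcc_of_le (zero_le_one' ℝ)]
  exact uIcc_subset_Icc ha hb

lemma omegaHat_one (ω : ℝ → ℝ) : omegaHat ω 1 = 0 := intervalIntegral.integral_same

lemma continuousOn_omegaHat {ω : ℝ → ℝ} (hω : IsRadialWeight ω) :
    ContinuousOn (omegaHat ω) (Icc 0 1) := by
  have := intervalIntegral.continuousOn_primitive_interval_left (f := ω) (μ := volume)
    (a := 0) (b := 1) (by
      rw [uIcc_of_le (zero_le_one' ℝ), integrableOn_Icc_iff_integrableOn_Ioo]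
      exact hω.integrableOn_Ioo)
  rwa [uIcc_of_le (zero_le_one' ℝ)] at this

lemma omegaHat_sub {ω : ℝ → ℝ} (hω : IsRadialWeight ω) {a b : ℝ}
    (ha : a ∈ Icc (0:ℝ) 1) (hb : b ∈ Icc (0:ℝ) 1) :
    omegaHat ω a - omegaHat ω b = ∫ r in a..b, ω r := by
  have h1 : (1:ℝ) ∈ Icc (0:ℝ) 1 := ⟨zero_le_one, le_rfl⟩
  rw [omegaHat, omegaHat, ← intervalIntegral.integral_add_adjacent_intervals
    (hω.intervalIntegrable ha hb) (hω.intervalIntegrable hb h1)]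
  ring

lemma omegaHat_anti {ω : ℝ → ℝ} (hω : IsRadialWeight ω) {a b : ℝ}
    (ha : 0 ≤ a) (hab : a ≤ b) (hb : b ≤ 1) : omegaHat ω b ≤ omegaHat ω a := by
  have h := omegaHat_sub hω ⟨ha, hab.trans hb⟩ ⟨ha.trans hab, hb⟩
  have : 0 ≤ ∫ r in a..b, ω r := by
    rw [intervalIntegral.integral_of_le hab, integral_Ioc_eq_integral_Ioo]
    exact setIntegral_nonneg measurableSet_Ioo fun r hr =>
      hω.1 r ⟨ha.trans hr.1.le, hr.2.trans_le hb⟩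
  linarith

lemma omegaHat_nonneg {ω : ℝ → ℝ} (hω : IsRadialWeight ω) {a : ℝ}
    (ha : a ∈ Icc (0:ℝ) 1) : 0 ≤ omegaHat ω a := by
  have := omegaHat_anti hω ha.1 ha.2 le_rfl
  rwa [omegaHat_one] at this

section Mu

variable {ω : ℝ → ℝ} {a : ℝ}

lemma integrableOn_mul_omegaHat_rpow (hω : IsRadialWeight ω) (ha : 0 ≤ a) :
    IntegrableOn (fun r => ω r * omegaHat ω r ^ a) (Ioo 0 1) := by
  have := integrableOn_mul_weight hω.integrableOn_Ioo (f := fun r => omegaHat ω r ^ a)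
    ((continuousOn_omegaHat hω).rpow_const fun _ _ => Or.inr ha)
  simpa only [mul_comm] using this

lemma mul_omegaHat_rpow_nonneg (hω : IsRadialWeight ω) :
    ∀ r ∈ Ioo (0:ℝ) 1, 0 ≤ ω r * omegaHat ω r ^ a := fun r hr =>
  mul_nonneg (hω.nonneg_Ioo r hr)
    (Real.rpow_nonneg (omegaHat_nonneg hω ⟨hr.1.le, hr.2.le⟩) _)

lemma intervalIntegrable_mul_omegaHat_rpow (hω : IsRadialWeight ω) (ha : 0 ≤ a) {x y : ℝ}
    (hx : x ∈ Icc (0:ℝ) 1) (hy : y ∈ Icc (0:ℝ) 1) :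
    IntervalIntegrable (fun r => ω r * omegaHat ω r ^ a) volume x y := by
  have h : IntervalIntegrable (fun r => ω r * omegaHat ω r ^ a) volume 0 1 := by
    rw [intervalIntegrable_iff_integrableOn_Ioo_of_le zero_le_one]
    exact integrableOn_mul_omegaHat_rpow hω ha
  refine h.mono_set ?_
  rw [uIcc_of_le (zero_le_one' ℝ)]
  exact uIcc_subset_Icc hx hy

lemma integral_mul_omegaHat_rpow_le (hω : IsRadialWeight ω) (ha : 0 ≤ a) {x : ℝ}
    (hx : x ∈ Ico (0:ℝ) 1) (hpos : 0 < omegaHat ω x) :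
    ∫ r in x..1, ω r * omegaHat ω r ^ a ≤ omegaHat ω x ^ (1 + a) := by
  have h1 : (1:ℝ) ∈ Icc (0:ℝ) 1 := ⟨zero_le_one, le_rfl⟩
  have hx' : x ∈ Icc (0:ℝ) 1 := ⟨hx.1, hx.2.le⟩
  calc ∫ r in x..1, ω r * omegaHat ω r ^ a ≤ ∫ r in x..1, ω r * omegaHat ω x ^ a := by
        refine intervalIntegral.integral_mono_on_of_le_Ioo hx.2.le
          (intervalIntegrable_mul_omegaHat_rpow hω ha hx' h1)
          ((hω.intervalIntegrable hx' h1).mul_const _) fun r hr => ?_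
        have hr0 : 0 ≤ r := hx.1.trans hr.1.le
        gcongr
        · exact hω.1 r ⟨hr0, hr.2⟩
        · exact omegaHat_nonneg hω ⟨hr0, hr.2.le⟩
        · exact omegaHat_anti hω hx.1 hr.1.le hr.2.le
    _ = omegaHat ω x * omegaHat ω x ^ a := intervalIntegral.integral_mul_const _ _
    _ = omegaHat ω x ^ (1 + a) := by rw [Real.rpow_add hpos, Real.rpow_one]

lemma le_integral_mul_omegaHat_rpow (hω : IsRadialWeight ω) (ha : 0 ≤ a) {x : ℝ}
    (hx : x ∈ Ico (0:ℝ) 1) (hpos : 0 < omegaHat ω x) :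
    (omegaHat ω x / 2) ^ (1 + a) ≤ ∫ r in x..1, ω r * omegaHat ω r ^ a := by
  have h1 : (1:ℝ) ∈ Icc (0:ℝ) 1 := ⟨zero_le_one, le_rfl⟩
  have hx' : x ∈ Icc (0:ℝ) 1 := ⟨hx.1, hx.2.le⟩
  obtain ⟨y, hy, hy2⟩ : omegaHat ω x / 2 ∈ omegaHat ω '' Icc x 1 := by
    refine intermediate_value_Icc' hx.2.le ((continuousOn_omegaHat hω).mono
      (Icc_subset_Icc_left hx.1)) ?_
    rw [omegaHat_one]
    constructor <;> linarith
  have hy' : y ∈ Icc (0:ℝ) 1 := ⟨hx.1.trans hy.1, hy.2⟩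
  have hsub := omegaHat_sub hω hx' hy'
  have hsplit := intervalIntegral.integral_add_adjacent_intervals
    (intervalIntegrable_mul_omegaHat_rpow hω ha hx' hy')
    (intervalIntegrable_mul_omegaHat_rpow hω ha hy' h1)
  have h2 : 0 ≤ ∫ r in y..1, ω r * omegaHat ω r ^ a := by
    rw [intervalIntegral.integral_of_le hy.2, integral_Ioc_eq_integral_Ioo]
    exact setIntegral_nonneg measurableSet_Ioo fun r hr =>
      mul_omegaHat_rpow_nonneg hω r ⟨hy'.1.trans_lt hr.1, hr.2⟩
  calc (omegaHat ω x / 2) ^ (1 + a) = (omegaHat ω x / 2) * (omegaHat ω x / 2) ^ a := by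
        rw [Real.rpow_add (by linarith), Real.rpow_one]
    _ = (∫ r in x..y, ω r) * (omegaHat ω y) ^ a := by
        rw [← hsub, hy2]; ring
    _ = ∫ r in x..y, ω r * omegaHat ω y ^ a := (intervalIntegral.integral_mul_const _ _).symm
    _ ≤ ∫ r in x..y, ω r * omegaHat ω r ^ a := by
        refine intervalIntegral.integral_mono_on_of_le_Ioo hy.1
          ((hω.intervalIntegrable hx' hy').mul_const _)
          (intervalIntegrable_mul_omegaHat_rpow hω ha hx' hy') fun r hr => ?_
        have hr0 : 0 ≤ r := hx.1.trans hr.1.le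
        gcongr
        · exact hω.1 r ⟨hr0, hr.2.trans_le hy.2⟩
        · exact omegaHat_nonneg hω hy'
        · exact omegaHat_anti hω hr0 hr.2.le hy.2
    _ ≤ ∫ r in x..1, ω r * omegaHat ω r ^ a := by linarith

lemma one_le_doubling_const (hω : IsRadialWeight ω) (hpos : ∀ r ∈ Ico (0:ℝ) 1, 0 < omegaHat ω r)
    {C : ℝ} (hC : ∀ r ∈ Ico (0:ℝ) 1, omegaHat ω r ≤ C * omegaHat ω ((1 + r) / 2)) : 1 ≤ C := by
  have h := hC 0 ⟨le_rfl, one_pos⟩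
  have h1 := hpos ((1 + 0) / 2) (by norm_num)
  have h2 := omegaHat_anti hω (a := 0) (b := (1 + 0) / 2) le_rfl (by norm_num) (by norm_num)
  by_contra! hlt
  nlinarith

lemma tail_mul_omegaHat_rpow (hω : IsRadialWeight ω) (ha : 0 ≤ a)
    (hpos : ∀ r ∈ Ico (0:ℝ) 1, 0 < omegaHat ω r)
    {C : ℝ} (hC : ∀ r ∈ Ico (0:ℝ) 1, omegaHat ω r ≤ C * omegaHat ω ((1 + r) / 2)) :
    ∀ t ∈ Ioo (0:ℝ) 1, ∫ r in t..1, ω r * omegaHat ω r ^ a ≤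
      (2 * C) ^ (1 + a) * ∫ r in √t..1, ω r * omegaHat ω r ^ a := by
  intro t ht
  have hC1 := one_le_doubling_const hω hpos hC
  have ht' : t ∈ Ico (0:ℝ) 1 := ⟨ht.1.le, ht.2⟩
  have hst : √t ∈ Ico (0:ℝ) 1 := ⟨Real.sqrt_nonneg t, by
    rw [Real.sqrt_lt' one_pos]; simpa using ht.2⟩
  have hle : √t ≤ (1 + t) / 2 := by nlinarith [Real.sq_sqrt ht.1.le, sq_nonneg (√t - 1)]
  have hW : omegaHat ω t ≤ (2 * C) * (omegaHat ω (√t) / 2) := by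
    refine (hC t ht').trans ?_
    have := omegaHat_anti hω (Real.sqrt_nonneg t) hle (by linarith [ht.2])
    nlinarith
  calc _ ≤ omegaHat ω t ^ (1 + a) := integral_mul_omegaHat_rpow_le hω ha ht' (hpos t ht')
    _ ≤ ((2 * C) * (omegaHat ω (√t) / 2)) ^ (1 + a) :=
        Real.rpow_le_rpow (hpos t ht').le hW (by linarith)
    _ = (2 * C) ^ (1 + a) * (omegaHat ω (√t) / 2) ^ (1 + a) :=
        Real.mul_rpow (by linarith) (by linarith [hpos _ hst])
    _ ≤ _ := by
        gcongr; exact le_integral_mul_omegaHat_rpow hω ha hst (hpos _ hst)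

lemma momentCoeff_eq (μ : ℝ → ℝ) (n : ℕ) :
    momentCoeff μ n = ∫ r in (0:ℝ)..1, r ^ (2 * n + 1) * μ r := by
  rw [momentCoeff, momentW]
  refine intervalIntegral.integral_congr fun r _ => ?_
  rw [← Real.rpow_natCast]
  push_cast
  rfl

lemma momentCoeff_mul_omegaHat_sub_le (hω : IsRadialWeight ω) (ha : 0 ≤ a)
    (hpos : ∀ r ∈ Ico (0:ℝ) 1, 0 < omegaHat ω r)
    {C : ℝ} (hC : ∀ r ∈ Ico (0:ℝ) 1, omegaHat ω r ≤ C * omegaHat ω ((1 + r) / 2)) (n : ℕ) :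
    ((n:ℝ) + 1) * (momentCoeff (fun r => ω r * omegaHat ω r ^ a) n
      - momentCoeff (fun r => ω r * omegaHat ω r ^ a) (n + 1))
      ≤ 2 * (2 * C) ^ (1 + a) * momentCoeff (fun r => ω r * omegaHat ω r ^ a) n := by
  have hC1 := one_le_doubling_const hω hpos hC
  rw [momentCoeff_eq, momentCoeff_eq]
  exact moment_sub_le_of_tail (integrableOn_mul_omegaHat_rpow hω ha)
    (mul_omegaHat_rpow_nonneg hω) (Real.one_le_rpow (by linarith) (by linarith))
    (tail_mul_omegaHat_rpow hω ha hpos hC) n 1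

lemma le_momentCoeff_mul_omegaHat (hω : IsRadialWeight ω) (ha : 0 ≤ a) {x : ℝ}
    (hx : x ∈ Ico (0:ℝ) 1) (hpos : 0 < omegaHat ω x) (n : ℕ) :
    x ^ (2 * n + 1) * (omegaHat ω x / 2) ^ (1 + a) ≤
      momentCoeff (fun r => ω r * omegaHat ω r ^ a) n := by
  have h1 : (1:ℝ) ∈ Icc (0:ℝ) 1 := ⟨zero_le_one, le_rfl⟩
  have hx' : x ∈ Icc (0:ℝ) 1 := ⟨hx.1, hx.2.le⟩
  rw [momentCoeff_eq]
  have hi : IntervalIntegrable (fun r => r ^ (2 * n + 1) * (ω r * omegaHat ω r ^ a))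
      volume 0 1 := intervalIntegrable_mul_weight (integrableOn_mul_omegaHat_rpow hω ha)
        (by fun_prop)
  have hi0 : IntervalIntegrable (fun r => r ^ (2 * n + 1) * (ω r * omegaHat ω r ^ a))
      volume 0 x := hi.mono_set (by
        rw [uIcc_of_le zero_le_one, uIcc_of_le hx.1]; exact Icc_subset_Icc_right hx.2.le)
  have hi1 : IntervalIntegrable (fun r => r ^ (2 * n + 1) * (ω r * omegaHat ω r ^ a))
      volume x 1 := hi.mono_set (by
        rw [uIcc_of_le zero_le_one, uIcc_of_le hx.2.le]; exact Icc_subset_Icc_left hx.1)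
  rw [← intervalIntegral.integral_add_adjacent_intervals hi0 hi1]
  have h0 : 0 ≤ ∫ r in (0:ℝ)..x, r ^ (2 * n + 1) * (ω r * omegaHat ω r ^ a) := by
    rw [intervalIntegral.integral_of_le hx.1, integral_Ioc_eq_integral_Ioo]
    exact setIntegral_nonneg measurableSet_Ioo fun r hr =>
      mul_nonneg (pow_nonneg hr.1.le _) (mul_omegaHat_rpow_nonneg hω r ⟨hr.1, hr.2.trans hx.2⟩)
  calc x ^ (2 * n + 1) * (omegaHat ω x / 2) ^ (1 + a)
      ≤ x ^ (2 * n + 1) * ∫ r in x..1, ω r * omegaHat ω r ^ a := by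
        have := hx.1
        gcongr; exact le_integral_mul_omegaHat_rpow hω ha hx hpos
    _ = ∫ r in x..1, x ^ (2 * n + 1) * (ω r * omegaHat ω r ^ a) :=
        (intervalIntegral.integral_const_mul _ _).symm
    _ ≤ ∫ r in x..1, r ^ (2 * n + 1) * (ω r * omegaHat ω r ^ a) := by
        refine intervalIntegral.integral_mono_on_of_le_Ioo hx.2.le
          ((intervalIntegrable_mul_omegaHat_rpow hω ha hx' h1).const_mul _) hi1 fun r hr => ?_
        gcongr ?_ * _
        · exact mul_omegaHat_rpow_nonneg hω r ⟨hx.1.trans_lt hr.1, hr.2⟩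
        · exact pow_le_pow_left₀ hx.1 hr.1.le _
    _ ≤ _ := by linarith

lemma momentCoeff_succ_le {μ : ℝ → ℝ} (hμ : IntegrableOn μ (Ioo 0 1))
    (hμ0 : ∀ r ∈ Ioo (0:ℝ) 1, 0 ≤ μ r) (n : ℕ) : momentCoeff μ (n + 1) ≤ momentCoeff μ n := by
  rw [momentCoeff_eq, momentCoeff_eq]
  refine intervalIntegral.integral_mono_on_of_le_Ioo zero_le_one
    (intervalIntegrable_mul_weight hμ (by fun_prop))
    (intervalIntegrable_mul_weight hμ (by fun_prop)) fun r hr => ?_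
  gcongr ?_ * _
  · exact hμ0 r hr
  · exact pow_le_pow_of_le_one hr.1.le hr.2.le (by omega)

end Mu

/-! ### Moments of the standard weights -/

lemma hasDerivAt_one_sub_sq_rpow (κ : ℝ) {r : ℝ} (hr : r ∈ Ioo (0:ℝ) 1) :
    HasDerivAt (fun r : ℝ => -((1 - r ^ 2) ^ κ / 2)) (r * nuWeight (κ - 1) r) r := by
  have h1 : 1 - r ^ 2 ≠ 0 := by nlinarith [hr.1, hr.2]
  have h := (((hasDerivAt_pow 2 r).const_sub 1).rpow_const (p := κ) (Or.inl h1)).div_const 2 |>.neg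
  refine HasDerivAt.congr_deriv h ?_
  simp only [nuWeight]
  push_cast
  ring

lemma continuousOn_one_sub_sq_rpow {κ : ℝ} (hκ : 0 < κ) :
    Continuous (fun r : ℝ => (1 - r ^ 2) ^ κ) :=
  Continuous.rpow_const (by fun_prop) fun _ => Or.inr hκ.le

lemma mul_nuWeight_nonneg {κ : ℝ} (hκ : 0 < κ) : ∀ r ∈ Ioo (0:ℝ) 1, 0 ≤ r * nuWeight (κ - 1) r := by
  intro r hr
  have h1 : 0 ≤ 1 - r ^ 2 := by nlinarith [hr.1, hr.2]
  have := hr.1.le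
  have h2 : 0 ≤ κ - 1 + 1 := by linarith
  simp only [nuWeight]
  positivity

lemma integrableOn_mul_nuWeight {κ : ℝ} (hκ : 0 < κ) :
    IntegrableOn (fun r => r * nuWeight (κ - 1) r) (Ioo 0 1) := by
  have := intervalIntegral.integrableOn_deriv_of_nonneg (a := 0) (b := 1)
    (g := fun r : ℝ => -((1 - r ^ 2) ^ κ / 2)) (g' := fun r => r * nuWeight (κ - 1) r)
    ((continuousOn_one_sub_sq_rpow hκ).div_const 2).neg.continuousOn
    (fun r hr => hasDerivAt_one_sub_sq_rpow κ hr) (mul_nuWeight_nonneg hκ)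
  exact this.mono_set Ioo_subset_Ioc_self

lemma integral_mul_nuWeight {κ : ℝ} (hκ : 0 < κ) {t : ℝ} (ht : t ∈ Ico (0:ℝ) 1) :
    ∫ r in t..1, r * nuWeight (κ - 1) r = (1 - t ^ 2) ^ κ / 2 := by
  rw [intervalIntegral.integral_eq_sub_of_hasDerivAt_of_le (f := fun r : ℝ => -((1 - r ^ 2) ^ κ / 2))
    ht.2.le ((continuousOn_one_sub_sq_rpow hκ).div_const 2).neg.continuousOn
    (fun r hr => hasDerivAt_one_sub_sq_rpow κ ⟨ht.1.trans_lt hr.1, hr.2⟩)]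
  · simp [Real.zero_rpow hκ.ne']
  · rw [intervalIntegrable_iff_integrableOn_Ioo_of_le ht.2.le]
    exact (integrableOn_mul_nuWeight hκ).mono_set (Ioo_subset_Ioo_left ht.1)

lemma momentCoeff_nuWeight_eq (κ : ℝ) (n : ℕ) : momentCoeff (nuWeight (κ - 1)) n
    = ∫ r in (0:ℝ)..1, r ^ (2 * n) * (r * nuWeight (κ - 1) r) := by
  rw [momentCoeff_eq]
  congr 1
  ext r
  ring

lemma momentCoeff_nuWeight_sub_le {κ : ℝ} (hκ : 0 < κ) (n : ℕ) :
    ((n:ℝ) + 1) * (momentCoeff (nuWeight (κ - 1)) n - momentCoeff (nuWeight (κ - 1)) (n + 1))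
      ≤ 2 * 2 ^ κ * momentCoeff (nuWeight (κ - 1)) n := by
  rw [momentCoeff_nuWeight_eq, momentCoeff_nuWeight_eq]
  refine moment_sub_le_of_tail (integrableOn_mul_nuWeight hκ) (mul_nuWeight_nonneg hκ)
    (Real.one_le_rpow (by norm_num) hκ.le) (fun t ht => ?_) n 0
  have hst : √t ∈ Ico (0:ℝ) 1 := ⟨Real.sqrt_nonneg t, by
    rw [Real.sqrt_lt' one_pos]; simpa using ht.2⟩
  rw [integral_mul_nuWeight hκ ⟨ht.1.le, ht.2⟩, integral_mul_nuWeight hκ hst,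
    Real.sq_sqrt ht.1.le, ← mul_div_assoc, ← Real.mul_rpow (by norm_num) (by linarith [ht.2])]
  gcongr
  · nlinarith [ht.1, ht.2]
  · nlinarith [ht.1, ht.2]

lemma momentCoeff_nuWeight_succ_le {κ : ℝ} (hκ : 0 < κ) (n : ℕ) :
    momentCoeff (nuWeight (κ - 1)) (n + 1) ≤ momentCoeff (nuWeight (κ - 1)) n := by
  rw [momentCoeff_nuWeight_eq, momentCoeff_nuWeight_eq]
  refine intervalIntegral.integral_mono_on_of_le_Ioo zero_le_one
    (intervalIntegrable_mul_weight (integrableOn_mul_nuWeight hκ) (by fun_prop))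
    (intervalIntegrable_mul_weight (integrableOn_mul_nuWeight hκ) (by fun_prop)) fun r hr => ?_
  gcongr ?_ * _
  · exact mul_nuWeight_nonneg hκ r hr
  · exact pow_le_pow_of_le_one hr.1.le hr.2.le (by omega)

/-- The moments of `ν` through an integral without singularity. -/
lemma momentCoeff_nuWeight_eq_integral {κ : ℝ} (hκ : 0 < κ) (n : ℕ) :
    momentCoeff (nuWeight (κ - 1)) n
      = ((n:ℝ) + 1 + κ) * ∫ r in (0:ℝ)..1, r ^ (2 * n + 1) * (1 - r ^ 2) ^ κ := by
  have hc := continuousOn_one_sub_sq_rpow hκ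
  have hi : ∀ m, IntervalIntegrable (fun r : ℝ => r ^ m * (1 - r ^ 2) ^ κ) volume 0 1 := fun m =>
    ((continuous_pow m).mul hc).intervalIntegrable _ _
  have hj : ∀ m, IntervalIntegrable (fun r : ℝ => r ^ m * (r * nuWeight (κ - 1) r)) volume 0 1 :=
    fun m => intervalIntegrable_mul_weight (integrableOn_mul_nuWeight hκ) (by fun_prop)
  have hd : ∀ r ∈ Ioo (0:ℝ) 1, HasDerivAt (fun r : ℝ => r ^ (2 * n + 2) * ((1 - r ^ 2) ^ κ / 2))
      (((n:ℝ) + 1) * (r ^ (2 * n + 1) * (1 - r ^ 2) ^ κ)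
        - r ^ (2 * n + 2) * (r * nuWeight (κ - 1) r)) r := by
    intro r hr
    have h := (hasDerivAt_pow (2 * n + 2) r).mul (hasDerivAt_one_sub_sq_rpow κ hr).neg
    refine HasDerivAt.congr_deriv (h.congr_of_eventuallyEq (.of_forall fun x => ?_)) ?_
    · simp
    · simp only [Pi.neg_apply, neg_neg, Nat.cast_add, Nat.cast_mul, Nat.cast_ofNat]
      rw [show 2 * n + 2 - 1 = 2 * n + 1 by omega]
      ring
  have hF := intervalIntegral.integral_eq_sub_of_hasDerivAt_of_le zero_le_one
    (f := fun r : ℝ => r ^ (2 * n + 2) * ((1 - r ^ 2) ^ κ / 2))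
    (by fun_prop) hd (((hi _).const_mul _).sub (hj _))
  rw [intervalIntegral.integral_sub ((hi _).const_mul _) (hj _),
    intervalIntegral.integral_const_mul] at hF
  have hsplit : ∫ r in (0:ℝ)..1, r ^ (2 * n + 2) * (r * nuWeight (κ - 1) r)
      = momentCoeff (nuWeight (κ - 1)) n
        - κ * ∫ r in (0:ℝ)..1, r ^ (2 * n + 1) * (1 - r ^ 2) ^ κ := by
    rw [momentCoeff_nuWeight_eq, ← intervalIntegral.integral_const_mul,
      ← intervalIntegral.integral_sub (hj _) ((hi _).const_mul _)]
    rw [intervalIntegral.integral_of_le zero_le_one, integral_Ioc_eq_integral_Ioo,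
      intervalIntegral.integral_of_le zero_le_one, integral_Ioc_eq_integral_Ioo]
    refine setIntegral_congr_fun measurableSet_Ioo fun r hr => ?_
    have h1 : 0 < 1 - r ^ 2 := by nlinarith [hr.1, hr.2]
    have h2 : (1 - r ^ 2) ^ κ = (1 - r ^ 2) ^ (κ - 1) * (1 - r ^ 2) := by
      rw [← Real.rpow_add_one h1.ne']; congr 1; ring
    simp only [nuWeight, h2]
    ring
  rw [hsplit] at hF
  simp [Real.zero_rpow hκ.ne'] at hF
  linarith

lemma le_momentCoeff_nuWeight {κ : ℝ} (hκ : 0 < κ) {y : ℝ} (hy : y ∈ Ico (0:ℝ) 1) (n : ℕ) :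
    y ^ (2 * n) * ((1 - y) ^ κ / 2) ≤ momentCoeff (nuWeight (κ - 1)) n := by
  have hi : IntegrableOn (fun r => r ^ (2 * n) * (r * nuWeight (κ - 1) r)) (Ioo 0 1) :=
    integrableOn_mul_weight (integrableOn_mul_nuWeight hκ) (by fun_prop)
  rw [momentCoeff_nuWeight_eq, intervalIntegral.integral_of_le zero_le_one,
    integral_Ioc_eq_integral_Ioo]
  calc y ^ (2 * n) * ((1 - y) ^ κ / 2) ≤ y ^ (2 * n) * ((1 - y ^ 2) ^ κ / 2) := by
        have := hy.1
        gcongr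
        · linarith [hy.2]
        · nlinarith [hy.2]
    _ = ∫ r in Ioo y 1, y ^ (2 * n) * (r * nuWeight (κ - 1) r) := by
        rw [← integral_mul_nuWeight hκ hy, intervalIntegral.integral_of_le hy.2.le,
          integral_Ioc_eq_integral_Ioo, integral_const_mul]
    _ ≤ ∫ r in Ioo y 1, r ^ (2 * n) * (r * nuWeight (κ - 1) r) := by
        have hsub : Ioo y 1 ⊆ Ioo 0 1 := Ioo_subset_Ioo_left hy.1
        refine setIntegral_mono_on (((integrableOn_mul_nuWeight hκ).mono_set hsub).const_mul _)
          (hi.mono_set hsub) measurableSet_Ioo fun r hr => ?_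
        gcongr ?_ * _
        · exact mul_nuWeight_nonneg hκ r (hsub hr)
        · exact pow_le_pow_left₀ hy.1 hr.1.le _
    _ ≤ _ := by
        refine setIntegral_mono_set hi ?_ (Ioo_subset_Ioo_left hy.1).eventuallyLE
        filter_upwards [ae_restrict_mem measurableSet_Ioo] with r hr
        exact mul_nonneg (pow_nonneg hr.1.le _) (mul_nuWeight_nonneg hκ r hr)

/-- The coefficients of the pairing are positive, decrease slowly and are not too small. -/
lemma exists_pairingCoeff_bounds {ω : ℝ → ℝ} (hω : IsRadialWeight ω)
    (hpos : ∀ r ∈ Ico (0:ℝ) 1, 0 < omegaHat ω r) (hD : InDhat ω) {a κ : ℝ} (ha : 0 ≤ a)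
    (hκ : 0 < κ) {c : ℕ → ℝ} (hc : ∀ n, c n =
      momentCoeff (fun r => ω r * omegaHat ω r ^ a) n * momentCoeff (nuWeight (κ - 1)) n) :
    ∃ K > 0, ∃ c₀ > 0, (∀ n, 0 < c n) ∧ (∀ n, c (n + 1) ≤ c n) ∧
      (∀ n : ℕ, n * (c n - c (n + 1)) ≤ K * c n) ∧
      ∀ x ∈ Ico (0:ℝ) 1, ∀ n : ℕ,
        c₀ * (x ^ (4 * n + 1) * (omegaHat ω x ^ (1 + a) * (1 - x) ^ κ)) ≤ c n := by
  obtain ⟨C, hC0, hC⟩ := hD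
  set m := momentCoeff (fun r => ω r * omegaHat ω r ^ a) with hm
  set v := momentCoeff (nuWeight (κ - 1)) with hv
  have hhalf : (1/2:ℝ) ∈ Ico (0:ℝ) 1 := by norm_num
  have hm0 : ∀ n, 0 < m n := fun n => by
    refine lt_of_lt_of_le ?_ (le_momentCoeff_mul_omegaHat hω ha hhalf (hpos _ hhalf) n)
    have := hpos _ hhalf
    positivity
  have hv0 : ∀ n, 0 < v n := fun n => by
    refine lt_of_lt_of_le ?_ (le_momentCoeff_nuWeight hκ hhalf n)
    have : (0:ℝ) < 1 - 1/2 := by norm_num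
    positivity
  have hm1 : ∀ n, m (n + 1) ≤ m n :=
    momentCoeff_succ_le (integrableOn_mul_omegaHat_rpow hω ha) (mul_omegaHat_rpow_nonneg hω)
  have hv1 : ∀ n, v (n + 1) ≤ v n := momentCoeff_nuWeight_succ_le hκ
  have hm2 := momentCoeff_mul_omegaHat_sub_le hω ha hpos hC
  have hv2 := momentCoeff_nuWeight_sub_le hκ
  rw [← hm] at hm2
  rw [← hv] at hv2
  refine ⟨2 * (2 * C) ^ (1 + a) + 2 * 2 ^ κ, by positivity, (1/2) ^ (1 + a) / 2, by positivity,
    fun n => ?_, fun n => ?_, fun n => ?_, fun x hx n => ?_⟩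
  · rw [hc]; exact mul_pos (hm0 n) (hv0 n)
  · rw [hc, hc]; exact mul_le_mul (hm1 n) (hv1 n) (hv0 _).le (hm0 n).le
  · rw [hc, hc]
    have e1 := hm2 n
    have e2 := hv2 n
    have e3 : (n:ℝ) * (m n - m (n + 1)) ≤ 2 * (2 * C) ^ (1 + a) * m n := by
      nlinarith [hm1 n]
    have e4 : (n:ℝ) * (v n - v (n + 1)) ≤ 2 * 2 ^ κ * v n := by
      nlinarith [hv1 n]
    calc (n:ℝ) * (m n * v n - m (n + 1) * v (n + 1))
        = (n * (m n - m (n + 1))) * v n + m (n + 1) * (n * (v n - v (n + 1))) := by ring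
      _ ≤ (2 * (2 * C) ^ (1 + a) * m n) * v n + m n * (2 * 2 ^ κ * v n) := by
          have := hv0 n
          have := hm0 n
          have := hm0 (n + 1)
          have := hv1 n
          have h0 : 0 ≤ v n - v (n + 1) := by linarith
          gcongr
          exact hm1 n
      _ = _ := by ring
  · rw [hc]
    have h0 := hx.1
    have h1 : 0 ≤ 1 - x := by linarith [hx.2]
    have h2 := hpos x hx
    calc (1/2) ^ (1 + a) / 2 * (x ^ (4 * n + 1) * (omegaHat ω x ^ (1 + a) * (1 - x) ^ κ))
        = (x ^ (2 * n + 1) * (omegaHat ω x / 2) ^ (1 + a)) * (x ^ (2 * n) * ((1 - x) ^ κ / 2)) := by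
          rw [div_eq_mul_one_div (omegaHat ω x) 2, Real.mul_rpow h2.le (by norm_num)]
          ring
      _ ≤ m n * v n := by
          have := le_momentCoeff_mul_omegaHat hω ha hx h2 n
          have := le_momentCoeff_nuWeight hκ hx n
          gcongr
          exact (hm0 n).le

lemma intervalIntegrable_mul_one_sub_rpow {ω : ℝ → ℝ} (hω : IsRadialWeight ω) {b x y l : ℝ}
    (hb0 : 0 ≤ b) (hx : 0 ≤ x) (hxy : x ≤ y) (hy1 : y ≤ 1) (hy : b * y < 1) :
    IntervalIntegrable (fun r => (1 - b * r) ^ l * ω r) volume x y := by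
  refine IntervalIntegrable.continuousOn_mul
    (hω.intervalIntegrable ⟨hx, hxy.trans hy1⟩ ⟨hx.trans hxy, hy1⟩) ?_
  refine ContinuousOn.rpow_const (by fun_prop) fun r hr => Or.inl ?_
  rw [uIcc_of_le hxy] at hr
  have : b * r ≤ b * y := mul_le_mul_of_nonneg_left hr.2 hb0
  linarith

lemma integral_one_sub_rpow_mul_le {ω : ℝ → ℝ} (hω : IsRadialWeight ω) {b x y l : ℝ}
    (hb0 : 0 ≤ b) (hx : 0 ≤ x) (hxy : x ≤ y) (hy1 : y ≤ 1) (hy : b * y < 1)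
    (hl : 0 ≤ l) {A : ℝ} (hA : 0 < A) (h : ∀ r ∈ Ioo x y, A ≤ 1 - b * r) :
    ∫ r in x..y, (1 - b * r) ^ (-l) * ω r ≤ A ^ (-l) * omegaHat ω x := by
  have hi := hω.intervalIntegrable (a := x) (b := y) ⟨hx, hxy.trans hy1⟩ ⟨hx.trans hxy, hy1⟩
  calc _ ≤ ∫ r in x..y, A ^ (-l) * ω r := by
        refine intervalIntegral.integral_mono_on_of_le_Ioo hxy
          (intervalIntegrable_mul_one_sub_rpow hω hb0 hx hxy hy1 hy) (hi.const_mul _)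
          fun r hr => ?_
        gcongr ?_ * _
        · exact hω.1 r ⟨hx.trans hr.1.le, hr.2.trans_le hy1⟩
        · exact Real.rpow_le_rpow_of_nonpos hA (h r hr) (by linarith)
    _ = A ^ (-l) * (omegaHat ω x - omegaHat ω y) := by
        rw [intervalIntegral.integral_const_mul, omegaHat_sub hω ⟨hx, hxy.trans hy1⟩
          ⟨hx.trans hxy, hy1⟩]
    _ ≤ _ := by
        gcongr
        linarith [omegaHat_nonneg hω (a := y) ⟨hx.trans hxy, hy1⟩]

lemma integral_one_sub_rpow_mul_le_of_lt {ω : ℝ → ℝ} (hω : IsRadialWeight ω)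
    {C : ℝ} (hC1 : 1 ≤ C) (hC : ∀ r ∈ Ico (0:ℝ) 1, omegaHat ω r ≤ C * omegaHat ω ((1 + r) / 2))
    {l : ℝ} (hl0 : 0 ≤ l) (hl : 2 ^ (-l) * C ≤ 1 / 2) (k : ℕ) :
    ∀ ρ : ℝ, 0 ≤ ρ → ρ < 1 - (1/2) ^ k →
      ∫ r in (0:ℝ)..ρ, (1 - 1 * r) ^ (-l) * ω r ≤ 2 * C * ((1 - ρ) ^ (-l) * omegaHat ω ρ) := by
  induction k with
  | zero => intro ρ h0 h1; norm_num at h1; linarith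
  | succ k ih =>
    intro ρ h0 h1
    have hρ1 : ρ < 1 := h1.trans (by simp)
    have hW := omegaHat_nonneg hω (a := ρ) ⟨h0, hρ1.le⟩
    have hp : 0 < (1 - ρ) ^ (-l) := Real.rpow_pos_of_pos (by linarith) _
    rcases lt_or_ge ρ (1/2) with h2 | h2
    · have e1 := integral_one_sub_rpow_mul_le hω zero_le_one le_rfl h0 hρ1.le (by linarith)
        hl0 (A := 1 - ρ) (by linarith) (fun r hr => by linarith [hr.2])
      have e2 := hC 0 ⟨le_rfl, one_pos⟩
      have e3 := omegaHat_anti hω h0 (b := (1 + 0) / 2) (by linarith) (by norm_num)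
      calc _ ≤ (1 - ρ) ^ (-l) * omegaHat ω 0 := e1
        _ ≤ (1 - ρ) ^ (-l) * (2 * C * omegaHat ω ρ) := by gcongr; nlinarith
        _ = _ := by ring
    · have h0' : 0 ≤ 2 * ρ - 1 := by linarith
      have e1 := ih (2 * ρ - 1) h0' (by rw [pow_succ] at h1; linarith)
      have e2 := integral_one_sub_rpow_mul_le hω zero_le_one h0'
        (show 2 * ρ - 1 ≤ ρ by linarith) hρ1.le (by linarith)
        hl0 (A := 1 - ρ) (by linarith) (fun r hr => by linarith [hr.2])
      have e3 := hC (2 * ρ - 1) ⟨h0', by linarith⟩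
      rw [show (1 + (2 * ρ - 1)) / 2 = ρ by ring] at e3
      rw [← intervalIntegral.integral_add_adjacent_intervals
        (intervalIntegrable_mul_one_sub_rpow hω zero_le_one le_rfl h0' (by linarith)
          (by linarith))
        (intervalIntegrable_mul_one_sub_rpow hω zero_le_one h0' (by linarith) hρ1.le
          (by linarith))]
      have e4 : (1 - (2 * ρ - 1)) ^ (-l) = 2 ^ (-l) * (1 - ρ) ^ (-l) := by
        rw [← Real.mul_rpow (by norm_num) (by linarith)]; congr 1; ring
      rw [e4] at e1
      have h2l : (0:ℝ) < 2 ^ (-l) := by positivity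
      calc _ ≤ 2 * C * (2 ^ (-l) * (1 - ρ) ^ (-l) * omegaHat ω (2 * ρ - 1)) +
            (1 - ρ) ^ (-l) * omegaHat ω (2 * ρ - 1) := add_le_add e1 e2
        _ = (2 * (2 ^ (-l) * C) + 1) * (1 - ρ) ^ (-l) * omegaHat ω (2 * ρ - 1) := by ring
        _ ≤ (2 * (1 / 2) + 1) * (1 - ρ) ^ (-l) * (C * omegaHat ω ρ) := by
            gcongr; exact omegaHat_nonneg hω ⟨h0', by linarith⟩
        _ = _ := by ring

/-- The integral estimate characterizing `D̂`. -/
lemma integral_one_sub_mul_rpow_le {ω : ℝ → ℝ} (hω : IsRadialWeight ω)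
    {C : ℝ} (hC1 : 1 ≤ C) (hC : ∀ r ∈ Ico (0:ℝ) 1, omegaHat ω r ≤ C * omegaHat ω ((1 + r) / 2))
    {l : ℝ} (hl0 : 0 ≤ l) (hl : 2 ^ (-l) * C ≤ 1 / 2) {ρ : ℝ} (h0 : 0 ≤ ρ) (h1 : ρ < 1) :
    ∫ r in (0:ℝ)..1, (1 - ρ * r) ^ (-l) * ω r
      ≤ 3 * C * ((1 - ρ) ^ (-l) * omegaHat ω ρ) := by
  obtain ⟨k, hk⟩ := exists_pow_lt_of_lt_one (show (0:ℝ) < 1 - ρ by linarith)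
    (show (1/2:ℝ) < 1 by norm_num)
  have e1 := integral_one_sub_rpow_mul_le_of_lt hω hC1 hC hl0 hl k ρ h0 (by linarith)
  have e2 := integral_one_sub_rpow_mul_le hω h0 h0 h1.le le_rfl (by linarith)
    hl0 (A := 1 - ρ) (by linarith) (fun r hr => by nlinarith [hr.2])
  have hW := omegaHat_nonneg hω (a := ρ) ⟨h0, h1.le⟩
  have hp : 0 < (1 - ρ) ^ (-l) := Real.rpow_pos_of_pos (by linarith) _
  have hi := intervalIntegrable_mul_one_sub_rpow hω (l := -l) h0 le_rfl h0 h1.le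
    (by nlinarith)
  rw [← intervalIntegral.integral_add_adjacent_intervals hi
    (intervalIntegrable_mul_one_sub_rpow hω h0 h0 h1.le le_rfl (by linarith))]
  have e3 : ∫ r in (0:ℝ)..ρ, (1 - ρ * r) ^ (-l) * ω r
      ≤ ∫ r in (0:ℝ)..ρ, (1 - 1 * r) ^ (-l) * ω r := by
    refine intervalIntegral.integral_mono_on_of_le_Ioo h0 hi
      (intervalIntegrable_mul_one_sub_rpow hω zero_le_one le_rfl h0 h1.le (by linarith))
      fun r hr => ?_
    gcongr ?_ * _
    · exact hω.1 r ⟨hr.1.le, hr.2.trans h1⟩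
    · exact Real.rpow_le_rpow_of_nonpos (by linarith [hr.2]) (by nlinarith [hr.1]) (by linarith)
  nlinarith [mul_nonneg hp.le hW]

/-! ### The pairing on a fixed radius -/

lemma circlePt_pow (t θ : ℝ) (n : ℕ) : circlePt t θ ^ n = (t:ℂ) ^ n * circlePt 1 θ ^ n := by
  rw [circlePt_eq_mul, mul_pow]

lemma integral_mul_conj_circlePt {F H : ℂ → ℂ} {a b : ℕ → ℂ} {R : ℝ}
    (ha : ∀ z : ℂ, ‖z‖ < R → HasSum (fun n => a n * z ^ n) (F z))
    (hb : ∀ z : ℂ, ‖z‖ < R → HasSum (fun n => b n * z ^ n) (H z))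
    {t : ℝ} (ht : 0 ≤ t) (htR : t < R) :
    ∫ θ, F (circlePt t θ) * (starRingEnd ℂ) (H (circlePt t θ)) ∂arcMeasure
      = ∑' n, a n * (starRingEnd ℂ) (b n) * (t:ℂ) ^ (2 * n) := by
  have hn : ‖(t:ℂ)‖ < R := by rwa [Complex.norm_of_nonneg ht]
  have hs : ∀ {F : ℂ → ℂ} {a : ℕ → ℂ}, (∀ z : ℂ, ‖z‖ < R → HasSum (fun n => a n * z ^ n) (F z)) →
      ∀ θ, F (circlePt t θ) = ∑' n, (a n * (t:ℂ) ^ n) * circlePt 1 θ ^ n := by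
    intro F a h θ
    rw [← (h _ (by rwa [norm_circlePt ht])).tsum_eq]
    exact tsum_congr fun n => by rw [circlePt_pow]; ring
  simp_rw [hs ha, hs hb]
  rw [integral_tsum_mul_conj_tsum (ha _ hn).summable.norm (hb _ hn).summable.norm]
  refine tsum_congr fun n => ?_
  rw [map_mul, map_pow, Complex.conj_ofReal, pow_mul']
  ring

lemma enorm_integral_mul_conj_circlePt_le {F H : ℂ → ℂ} {t B : ℝ} (ht : 0 ≤ t)
    (hH : ∀ z : ℂ, ‖z‖ = t → ‖H z‖ ≤ B) :
    ‖∫ θ, F (circlePt t θ) * (starRingEnd ℂ) (H (circlePt t θ)) ∂arcMeasure‖ₑ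
      ≤ ENNReal.ofReal B * ∫⁻ θ, ENNReal.ofReal ‖F (circlePt t θ)‖ ∂arcMeasure := by
  refine (enorm_integral_le_lintegral_enorm _).trans ?_
  rw [← lintegral_const_mul' _ _ ENNReal.ofReal_ne_top]
  refine lintegral_mono fun θ => ?_
  have h := hH _ (norm_circlePt ht θ)
  rw [← ofReal_norm, norm_mul, RCLike.norm_conj,
    ← ENNReal.ofReal_mul ((norm_nonneg _).trans h), mul_comm]
  exact ENNReal.ofReal_le_ofReal (by gcongr)

/-- The pairing with coefficients `ν_{2n+1}` of a function in `H^p` and a Bloch function. -/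
lemma norm_tsum_mul_conj_mul_momentCoeff_le {p : ℝ} (hp0 : 0 < p) (hp1 : p < 1) {F H : ℂ → ℂ}
    {a b : ℕ → ℂ} {R B : ℝ} (hR : 1 < R) (hF : DifferentiableOn ℂ F (Metric.ball 0 R))
    (ha : ∀ z : ℂ, ‖z‖ < R → HasSum (fun n => a n * z ^ n) (F z))
    (hb : ∀ z : ℂ, ‖z‖ < R → HasSum (fun n : ℕ => (((n:ℝ) + 1 / p : ℝ) * b n) * z ^ n) (H z))
    (hH : ∀ z : ℂ, ‖z‖ < 1 → ‖H z‖ ≤ B / (1 - ‖z‖)) :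
    ENNReal.ofReal ‖∑' n, a n * (starRingEnd ℂ) (b n) *
      (momentCoeff (nuWeight (1 / p - 2)) n : ℂ)‖ ≤
      ENNReal.ofReal (2 ^ (1 / p - 1) * B * embConst p) * MpE p 1 F := by
  set κ := 1 / p - 1 with hκd
  have hκ : 0 < κ := by rw [hκd, sub_pos, lt_div_iff₀ hp0]; linarith
  have hB : 0 ≤ B := by simpa using (norm_nonneg _).trans (hH 0 (by simp))
  have h1R : ‖(1:ℂ)‖ < R := by simpa using hR
  have hsa : Summable fun n => ‖a n‖ := by simpa using (ha 1 h1R).summable.norm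
  have hsb : Summable fun n : ℕ => ‖(((n:ℝ) + 1 / p : ℝ) : ℂ) * b n‖ := by
    simpa only [one_pow, mul_one] using (hb 1 h1R).summable.norm
  have hprod : Summable fun n => ‖a n * (starRingEnd ℂ) ((((n:ℝ) + 1 / p : ℝ) : ℂ) * b n)‖ := by
    obtain ⟨K, hK⟩ := hsa.tendsto_atTop_zero.bddAbove_range
    refine Summable.of_nonneg_of_le (fun _ => norm_nonneg _) (fun n => ?_) (hsb.mul_left K)
    rw [norm_mul, RCLike.norm_conj]
    gcongr
    exact hK ⟨n, rfl⟩
  set φ : ℕ → ℝ → ℂ := fun n t => a n * (starRingEnd ℂ) ((((n:ℝ) + 1 / p : ℝ) : ℂ) * b n) *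
    ((t ^ (2 * n + 1) * (1 - t ^ 2) ^ κ : ℝ) : ℂ) with hφ
  have hcont : ∀ m : ℕ, Continuous fun t : ℝ => t ^ m * (1 - t ^ 2) ^ κ := fun m =>
    (continuous_pow m).mul (continuousOn_one_sub_sq_rpow hκ)
  have hφint : ∀ n, Integrable (φ n) (volume.restrict (Ioo 0 1)) := fun n => by
    refine Integrable.const_mul ?_ _
    have h : Continuous fun t : ℝ => ((t ^ (2 * n + 1) * (1 - t ^ 2) ^ κ : ℝ) : ℂ) :=
      Complex.continuous_ofReal.comp (hcont _)
    exact (h.integrableOn_Icc (a := 0) (b := 1)).mono_set Ioo_subset_Icc_self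
  have hφle : ∀ n, ∫ t in Ioo (0:ℝ) 1, ‖φ n t‖ ≤
      ‖a n * (starRingEnd ℂ) ((((n:ℝ) + 1 / p : ℝ) : ℂ) * b n)‖ := fun n => by
    have : ∫ t in Ioo (0:ℝ) 1, ‖φ n t‖ ≤ ∫ t in Ioo (0:ℝ) 1,
        ‖a n * (starRingEnd ℂ) ((((n:ℝ) + 1 / p : ℝ) : ℂ) * b n)‖ := by
      refine setIntegral_mono_on (hφint n).norm (integrable_const _) measurableSet_Ioo fun t ht => ?_
      have h0 : 0 ≤ 1 - t ^ 2 := by nlinarith [ht.1, ht.2]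
      have h1 : 0 ≤ t := ht.1.le
      rw [hφ, norm_mul, Complex.norm_of_nonneg (by positivity)]
      refine mul_le_of_le_one_right (norm_nonneg _) (mul_le_one₀ (pow_le_one₀ h1 ht.2.le)
        (by positivity) (Real.rpow_le_one h0 (by nlinarith) hκ.le))
    simpa using this
  have hsum := hasSum_integral_of_summable_integral_norm hφint
    (Summable.of_nonneg_of_le (fun n => integral_nonneg fun _ => norm_nonneg _) hφle hprod)
  have hterm : ∀ n, ∫ t in Ioo (0:ℝ) 1, φ n t = a n * (starRingEnd ℂ) (b n) *
      (momentCoeff (nuWeight (1 / p - 2)) n : ℂ) := fun n => by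
    rw [show 1 / p - 2 = κ - 1 by rw [hκd]; ring, momentCoeff_nuWeight_eq_integral hκ,
      intervalIntegral.integral_of_le zero_le_one, integral_Ioc_eq_integral_Ioo,
      integral_const_mul, integral_complex_ofReal, map_mul, Complex.conj_ofReal, hκd]
    push_cast
    ring
  simp_rw [hterm] at hsum
  rw [hsum.tsum_eq, ofReal_norm]
  refine (enorm_integral_le_lintegral_enorm _).trans ?_
  have hb' : ENNReal.ofReal (2 ^ (1 / p - 1) * B * embConst p) * MpE p 1 F
      = ENNReal.ofReal (2 ^ κ * B) * (ENNReal.ofReal (embConst p) * MpE p 1 F) := by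
    rw [← mul_assoc, ← ENNReal.ofReal_mul (by positivity)]
  rw [hb']
  refine le_trans ?_ (mul_le_mul_right (lintegral_rpow_mul_circle_le hp0 hp1 hR hF) _)
  rw [← lintegral_const_mul' _ _ ENNReal.ofReal_ne_top]
  refine setLIntegral_mono' measurableSet_Ioo fun t ht => ?_
  have ht1 : 0 < 1 - t := by linarith [ht.2]
  have htt : ∑' n, φ n t = ((t * (1 - t ^ 2) ^ κ : ℝ) : ℂ) *
      ∫ θ, F (circlePt t θ) * (starRingEnd ℂ) (H (circlePt t θ)) ∂arcMeasure := by
    rw [integral_mul_conj_circlePt ha hb ht.1.le (ht.2.trans hR), ← tsum_mul_left]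
    refine tsum_congr fun n => ?_
    simp only [hφ]
    push_cast
    ring
  rw [htt, enorm_mul]
  refine (mul_le_mul_right (enorm_integral_mul_conj_circlePt_le ht.1.le
    (B := B / (1 - t)) fun z hz => ?_) _).trans ?_
  · have := hH z (by rw [hz]; exact ht.2)
    rwa [hz] at this
  · rw [← mul_assoc, ← mul_assoc]
    gcongr ?_ * _
    have h0 : 0 ≤ 1 - t ^ 2 := by nlinarith [ht.1, ht.2]
    have h1 : 0 ≤ t := ht.1.le
    rw [← ofReal_norm, Complex.norm_of_nonneg (by positivity),
      ← ENNReal.ofReal_mul (by positivity), ← ENNReal.ofReal_mul (by positivity)]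
    refine ENNReal.ofReal_le_ofReal ?_
    have e1 : (1 - t ^ 2) ^ κ ≤ 2 ^ κ * (1 - t) ^ κ := by
      rw [← Real.mul_rpow (by norm_num) ht1.le]
      exact Real.rpow_le_rpow h0 (by nlinarith [ht.2]) hκ.le
    have e2 : (1 - t) ^ (1 / p - 2) = (1 - t) ^ κ / (1 - t) := by
      rw [← Real.rpow_sub_one ht1.ne']; congr 1; rw [hκd]; ring
    calc t * (1 - t ^ 2) ^ κ * (B / (1 - t)) ≤ 1 * (2 ^ κ * (1 - t) ^ κ) * (B / (1 - t)) := by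
          gcongr; exact ht.2.le
      _ = _ := by rw [e2]; ring

/-! ### Integrability of `M_p` on `A^{p,q}_ω` -/

lemma MpE_lt_top {p : ℝ} (hp : 0 < p) {f : ℂ → ℂ} {R : ℝ}
    (hf : DifferentiableOn ℂ f (Metric.ball 0 R)) {r : ℝ} (hr : 0 ≤ r) (hrR : r < R) :
    MpE p r f < ⊤ := by
  rw [MpE_eq]
  refine ENNReal.rpow_lt_top_of_nonneg (by positivity) (ne_of_lt ?_)
  have h : Continuous fun θ => ‖f (circlePt r θ)‖ ^ p :=
    (continuous_comp_circlePt hf hr hrR).norm.rpow_const fun _ => Or.inr hp.le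
  have := h.integrable_arcMeasure.2
  rwa [hasFiniteIntegral_iff_ofReal (ae_of_all _ fun θ => by positivity)] at this

lemma lintegral_mul_weight_ge {ω : ℝ → ℝ} (hω : IsRadialWeight ω) {s : ℝ} (hs : 1 / 2 ≤ s)
    (hs1 : s < 1) :
    ENNReal.ofReal (omegaHat ω s) ≤ 2 * ∫⁻ r in Ioo s 1, ENNReal.ofReal (r * ω r) := by
  have h0 : 0 ≤ s := by linarith
  rw [omegaHat, intervalIntegral.integral_of_le hs1.le, integral_Ioc_eq_integral_Ioo,
    ofReal_integral_eq_lintegral_ofReal (hω.integrableOn_Ioo.mono_set (Ioo_subset_Ioo_left h0)),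
    ← lintegral_const_mul' _ _ (by simp)]
  · refine setLIntegral_mono' measurableSet_Ioo fun r hr => ?_
    have : 0 ≤ ω r := hω.1 r ⟨h0.trans hr.1.le, hr.2⟩
    rw [show (2:ℝ≥0∞) = ENNReal.ofReal 2 by simp, ← ENNReal.ofReal_mul (by norm_num)]
    refine ENNReal.ofReal_le_ofReal ?_
    nlinarith [hr.1]
  · filter_upwards [ae_restrict_mem measurableSet_Ioo] with r hr
    exact hω.1 r ⟨h0.trans hr.1.le, hr.2⟩

lemma MpE_rpow_mul_omegaHat_le_of_half_le {ω : ℝ → ℝ} (hω : IsRadialWeight ω) {p q : ℝ}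
    (hp : 0 < p) (hq : 0 < q) {f : ℂ → ℂ} (hf : DifferentiableOn ℂ f (Metric.ball 0 1)) {s : ℝ}
    (hs : 1 / 2 ≤ s) (hs1 : s < 1) :
    MpE p s f ^ q * ENNReal.ofReal (omegaHat ω s) ≤
      2 * ∫⁻ r in Ioo (0:ℝ) 1, (MpE p r f) ^ q * ENNReal.ofReal (r * ω r) := by
  have h0 : 0 ≤ s := by linarith
  calc MpE p s f ^ q * ENNReal.ofReal (omegaHat ω s)
      ≤ MpE p s f ^ q * (2 * ∫⁻ r in Ioo s 1, ENNReal.ofReal (r * ω r)) := by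
        gcongr; exact lintegral_mul_weight_ge hω hs hs1
    _ = 2 * ∫⁻ r in Ioo s 1, MpE p s f ^ q * ENNReal.ofReal (r * ω r) := by
        rw [lintegral_const_mul' _ _ (ENNReal.rpow_lt_top_of_nonneg hq.le
          (MpE_lt_top hp hf h0 hs1).ne).ne]
        ring
    _ ≤ 2 * ∫⁻ r in Ioo s 1, MpE p r f ^ q * ENNReal.ofReal (r * ω r) := by
        gcongr 2 * ?_
        refine setLIntegral_mono' measurableSet_Ioo fun r hr => ?_
        gcongr
        exact MpE_mono hp hf h0 hr.1.le hr.2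
    _ ≤ _ := by
        gcongr 2 * ?_
        exact lintegral_mono_set (Ioo_subset_Ioo_left h0)

lemma MpE_rpow_mul_omegaHat_le {ω : ℝ → ℝ} (hω : IsRadialWeight ω)
    (hpos : ∀ r ∈ Ico (0:ℝ) 1, 0 < omegaHat ω r) {C : ℝ}
    (hC : ∀ r ∈ Ico (0:ℝ) 1, omegaHat ω r ≤ C * omegaHat ω ((1 + r) / 2)) {p q : ℝ}
    (hp : 0 < p) (hq : 0 < q) {f : ℂ → ℂ} (hf : DifferentiableOn ℂ f (Metric.ball 0 1)) {s : ℝ}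
    (hs : 0 < s) (hs1 : s < 1) :
    MpE p s f ^ q * ENNReal.ofReal (omegaHat ω s) ≤
      ENNReal.ofReal (2 * C) *
        ∫⁻ r in Ioo (0:ℝ) 1, (MpE p r f) ^ q * ENNReal.ofReal (r * ω r) := by
  have hC1 := one_le_doubling_const hω hpos hC
  rw [ENNReal.ofReal_mul (by norm_num), ENNReal.ofReal_ofNat]
  rcases le_or_gt (1/2) s with h | h
  · refine (MpE_rpow_mul_omegaHat_le_of_half_le hω hp hq hf h hs1).trans ?_
    gcongr
    refine le_mul_of_one_le_right' ?_
    simpa using hC1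
  · have e0 := hC 0 ⟨le_rfl, one_pos⟩
    rw [show (1 + (0:ℝ)) / 2 = 1 / 2 by norm_num] at e0
    have e1 := omegaHat_anti hω le_rfl hs.le hs1.le
    calc MpE p s f ^ q * ENNReal.ofReal (omegaHat ω s)
        ≤ MpE p (1/2) f ^ q * ENNReal.ofReal (C * omegaHat ω (1/2)) := by
          gcongr
          · exact MpE_mono hp hf hs.le h.le (by norm_num)
          · exact e1.trans e0
      _ = ENNReal.ofReal C * (MpE p (1/2) f ^ q * ENNReal.ofReal (omegaHat ω (1/2))) := by
          rw [ENNReal.ofReal_mul (by linarith)]; ring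
      _ ≤ ENNReal.ofReal C * (2 * ∫⁻ r in Ioo (0:ℝ) 1,
            (MpE p r f) ^ q * ENNReal.ofReal (r * ω r)) := by
          gcongr ENNReal.ofReal C * ?_
          exact MpE_rpow_mul_omegaHat_le_of_half_le hω hp hq hf le_rfl (by norm_num)
      _ = _ := by ring

lemma lintegral_mul_MpE_le {ω : ℝ → ℝ} (hω : IsRadialWeight ω)
    (hpos : ∀ r ∈ Ico (0:ℝ) 1, 0 < omegaHat ω r) {C : ℝ}
    (hC : ∀ r ∈ Ico (0:ℝ) 1, omegaHat ω r ≤ C * omegaHat ω ((1 + r) / 2)) {p q : ℝ}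
    (hp : 0 < p) (hq : 0 < q) (hq1 : q ≤ 1) {f : ℂ → ℂ} (hf : InApq ω p q f) :
    ∫⁻ s in Ioo (0:ℝ) 1, ENNReal.ofReal (s * (ω s * omegaHat ω s ^ (1 / q - 1))) * MpE p s f ≤
      ENNReal.ofReal ((2 * C) ^ ((1 - q) / q)) * LpqNormE ω p q f := by
  have hC1 := one_le_doubling_const hω hpos hC
  set Q := ∫⁻ r in Ioo (0:ℝ) 1, (MpE p r f) ^ q * ENNReal.ofReal (r * ω r) with hQ
  have hN : LpqNormE ω p q f = Q ^ (1 / q) := rfl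
  have hQt : Q ≠ ⊤ := by
    intro h
    have := hf.2
    rw [hN, h, ENNReal.top_rpow_of_pos (by positivity)] at this
    exact this.ne rfl
  have he : 0 ≤ (1 - q) / q := div_nonneg (by linarith) hq.le
  have hq' : (1 - q) / q = 1 / q - 1 := by field_simp
  calc ∫⁻ s in Ioo (0:ℝ) 1, ENNReal.ofReal (s * (ω s * omegaHat ω s ^ (1 / q - 1))) * MpE p s f
      ≤ ∫⁻ s in Ioo (0:ℝ) 1, (ENNReal.ofReal (2 * C) * Q) ^ ((1 - q) / q) *
          ((MpE p s f) ^ q * ENNReal.ofReal (s * ω s)) := by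
        refine setLIntegral_mono' measurableSet_Ioo fun s hs => ?_
        have hM := (MpE_lt_top hp hf.1 hs.1.le hs.2).ne
        have hW := hpos s ⟨hs.1.le, hs.2⟩
        have hω0 := hω.nonneg_Ioo s hs
        have key := ENNReal.rpow_le_rpow
          (MpE_rpow_mul_omegaHat_le hω hpos hC hp hq hf.1 hs.1 hs.2) he
        rw [ENNReal.mul_rpow_of_nonneg _ _ he, ← ENNReal.rpow_mul,
          ENNReal.ofReal_rpow_of_pos hW, hq'] at key
        rw [← mul_assoc s, ENNReal.ofReal_mul (mul_nonneg hs.1.le hω0), hq']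
        have hsplit : MpE p s f = MpE p s f ^ (q * (1 / q - 1)) * MpE p s f ^ q := by
          have e1 : q * (1 / q - 1) = 1 - q := by field_simp
          rw [← ENNReal.rpow_add_of_nonneg _ _ (by rw [e1]; linarith) hq.le, e1, sub_add_cancel,
            ENNReal.rpow_one]
        calc ENNReal.ofReal (s * ω s) * ENNReal.ofReal (omegaHat ω s ^ (1 / q - 1)) * MpE p s f
            = (MpE p s f ^ (q * (1 / q - 1)) * ENNReal.ofReal (omegaHat ω s ^ (1 / q - 1))) *
              (MpE p s f ^ q * ENNReal.ofReal (s * ω s)) := by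
              conv_lhs => rw [hsplit]
              ring
          _ ≤ _ := by gcongr
    _ = (ENNReal.ofReal (2 * C) * Q) ^ ((1 - q) / q) * Q := by
        rw [lintegral_const_mul' _ _ (ENNReal.rpow_lt_top_of_nonneg he
          (ENNReal.mul_ne_top ENNReal.ofReal_ne_top hQt)).ne]
    _ = _ := by
        rw [ENNReal.mul_rpow_of_nonneg _ _ he, ENNReal.ofReal_rpow_of_pos (by linarith), hN,
          mul_assoc]
        congr 1
        nth_rewrite 2 [← ENNReal.rpow_one Q]
        rw [← ENNReal.rpow_add_of_nonneg _ _ he zero_le_one, hq', sub_add_cancel]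

/-! ### Taylor coefficients and the Bloch norm -/

lemma taylorCoeff_eq_of_hasSum {F : ℂ → ℂ} {a : ℕ → ℂ} {R : ℝ} (hR : 0 < R)
    (h : ∀ z : ℂ, ‖z‖ < R → HasSum (fun n => a n * z ^ n) (F z)) (n : ℕ) :
    taylorCoeff F n = a n := by
  have hps : HasFPowerSeriesAt F (FormalMultilinearSeries.ofScalars ℂ a) 0 := by
    rw [hasFPowerSeriesAt_iff]
    filter_upwards [Metric.ball_mem_nhds (0:ℂ) hR] with z hz
    simpa [FormalMultilinearSeries.coeff_ofScalars, mul_comm] using h z (by simpa using hz)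
  have h2 := hps.eq_formalMultilinearSeries hps.analyticAt.hasFPowerSeriesAt
  have := congrArg (fun q => FormalMultilinearSeries.coeff q n) h2
  simp only [FormalMultilinearSeries.coeff_ofScalars] at this
  rw [this, taylorCoeff]

lemma taylorCoeff_dilateF {g : ℂ → ℂ} (hg : DifferentiableOn ℂ g (Metric.ball 0 1)) {s : ℝ}
    (hs : 0 < s) (n : ℕ) : taylorCoeff (dilateF g s) n = taylorCoeff g n * (s:ℂ) ^ n := by
  refine taylorCoeff_eq_of_hasSum (a := fun n => taylorCoeff g n * (s:ℂ) ^ n) (R := 1 / s)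
    (by positivity) (fun z hz => ?_) n
  have : ‖(s:ℂ) * z‖ < 1 := by
    rw [norm_mul, Complex.norm_of_nonneg hs.le]
    rwa [lt_div_iff₀' hs] at hz
  rw [show dilateF g s z = g (s * z) from rfl]
  convert hasSum_taylorCoeff hg this using 2
  rw [mul_pow]; ring

lemma taylorCoeff_deriv (G : ℂ → ℂ) (n : ℕ) :
    taylorCoeff (deriv G) n = ((n:ℂ) + 1) * taylorCoeff G (n + 1) := by
  rw [taylorCoeff, taylorCoeff, iteratedDeriv_succ', Nat.factorial_succ]
  have : (n.factorial : ℂ) ≠ 0 := by exact_mod_cast n.factorial_ne_zero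
  have h2 : (n:ℂ) + 1 ≠ 0 := by exact_mod_cast n.succ_ne_zero
  push_cast
  field_simp

lemma hasSum_mul_deriv_add {G : ℂ → ℂ} {R : ℝ} (hG : DifferentiableOn ℂ G (Metric.ball 0 R))
    (c : ℝ) {z : ℂ} (hz : ‖z‖ < R) :
    HasSum (fun n : ℕ => (((n:ℝ) + c : ℝ) * taylorCoeff G n) * z ^ n)
      (z * deriv G z + c * G z) := by
  have h1 := (hasSum_taylorCoeff (hG.deriv Metric.isOpen_ball) hz).mul_left z
  have h2 : HasSum (fun n : ℕ => (n:ℂ) * taylorCoeff G n * z ^ n) (z * deriv G z) := by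
    rw [← hasSum_nat_add_iff' 1]
    simp only [Finset.range_one, Finset.sum_singleton, Nat.cast_zero, zero_mul, sub_zero]
    refine h1.congr_fun fun n => ?_
    rw [taylorCoeff_deriv]
    push_cast
    ring
  convert h2.add ((hasSum_taylorCoeff hG hz).mul_left (c:ℂ)) using 2
  push_cast
  ring

lemma norm_mul_deriv_add_le {G : ℂ → ℂ} {B c : ℝ} (hc : 0 ≤ c)
    (hG : ∀ z : ℂ, ‖z‖ < 1 → DifferentiableAt ℂ G z)
    (hB : ∀ z : ℂ, ‖z‖ < 1 → ‖G 0‖ + (1 - ‖z‖ ^ 2) * ‖deriv G z‖ ≤ B) {z : ℂ} (hz : ‖z‖ < 1) :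
    ‖z * deriv G z + c * G z‖ ≤ (1 + c) * B / (1 - ‖z‖) := by
  have h1 : 0 < 1 - ‖z‖ := by linarith
  have hd : ∀ w : ℂ, ‖w‖ ≤ ‖z‖ → ‖deriv G w‖ ≤ (B - ‖G 0‖) / (1 - ‖z‖) := by
    intro w hw
    rw [le_div_iff₀' h1]
    have := hB w (hw.trans_lt hz)
    have h2 : (1 - ‖z‖) * ‖deriv G w‖ ≤ (1 - ‖w‖ ^ 2) * ‖deriv G w‖ := by
      gcongr
      nlinarith [norm_nonneg w]
    linarith
  have hmv : ‖G z - G 0‖ ≤ (B - ‖G 0‖) / (1 - ‖z‖) * ‖z - 0‖ :=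
    (convex_closedBall (0:ℂ) ‖z‖).norm_image_sub_le_of_norm_deriv_le
      (fun w hw => hG w ((by simpa using hw : ‖w‖ ≤ ‖z‖).trans_lt hz))
      (fun w hw => hd w (by simpa using hw)) (by simp) (by simp)
  rw [sub_zero] at hmv
  have hB0 : ‖G 0‖ ≤ B := by
    have := hB 0 (by simp)
    rw [norm_zero] at this
    linarith [norm_nonneg (deriv G 0)]
  have hGz : ‖G z‖ ≤ B / (1 - ‖z‖) := by
    have : ‖G z‖ ≤ ‖G 0‖ + ‖G z - G 0‖ := by
      simpa using norm_add_le (G 0) (G z - G 0)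
    refine this.trans ((add_le_add_right hmv _).trans ?_)
    rw [div_mul_eq_mul_div, ← sub_nonneg]
    have : B / (1 - ‖z‖) - (‖G 0‖ + (B - ‖G 0‖) * ‖z‖ / (1 - ‖z‖)) =
        B - ‖G 0‖ + ‖G 0‖ * ‖z‖ / (1 - ‖z‖) := by
      field_simp; ring
    rw [this]
    have : 0 ≤ ‖G 0‖ * ‖z‖ / (1 - ‖z‖) := by positivity
    linarith
  calc ‖z * deriv G z + c * G z‖ ≤ ‖z‖ * ‖deriv G z‖ + c * ‖G z‖ := by
        refine (norm_add_le _ _).trans ?_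
        rw [norm_mul, norm_mul, Complex.norm_of_nonneg hc]
    _ ≤ 1 * (B / (1 - ‖z‖)) + c * (B / (1 - ‖z‖)) := by
        gcongr
        exact (hd z le_rfl).trans (by gcongr; linarith [norm_nonneg (G 0)])
    _ = _ := by ring

/-- The coefficients `f̂(n) conj(ĝ(n)) ν_{2n+1}` of the pairing of `f_s` and `g_{ρ s}`. -/
lemma norm_tsum_dilate_le {p : ℝ} (hp0 : 0 < p) (hp1 : p < 1) {f g : ℂ → ℂ}
    (hf : DifferentiableOn ℂ f (Metric.ball 0 1)) (hg : DifferentiableOn ℂ g (Metric.ball 0 1))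
    {s ρ B : ℝ} (hs : 0 < s) (hs1 : s < 1) (hρ : 0 ≤ ρ) (hρ1 : ρ ≤ 1)
    (hB : ∀ z : ℂ, ‖z‖ < 1 →
      ‖dilateF g s 0‖ + (1 - ‖z‖ ^ 2) * ‖deriv (dilateF g s) z‖ ≤ B) :
    ENNReal.ofReal ‖∑' n, taylorCoeff f n * (starRingEnd ℂ) (taylorCoeff g n) *
      (momentCoeff (nuWeight (1 / p - 2)) n : ℂ) * ((s ^ (2 * n) * ρ ^ n : ℝ) : ℂ)‖ ≤
      ENNReal.ofReal (2 ^ (1 / p - 1) * ((1 + 1 / p) * B) * embConst p) * MpE p s f := by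
  have hR : 1 < 1 / s := by rw [lt_div_iff₀ hs]; linarith
  have hdf := differentiableOn_dilateF hf hs
  have hdg := differentiableOn_dilateF hg hs
  have hM : MpE p 1 (dilateF f s) = MpE p s f := by
    simp only [MpE, dilateF, circlePt_mul, mul_one]
  have hnz : ∀ z : ℂ, ‖(ρ:ℂ) * z‖ ≤ ‖z‖ := fun z => by
    rw [norm_mul, Complex.norm_of_nonneg hρ]
    exact mul_le_of_le_one_left (norm_nonneg _) hρ1
  have hB0 : 0 ≤ B := by
    have := hB 0 (by simp)
    refine le_trans ?_ this
    simp only [norm_zero]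
    positivity
  have hp' : 0 ≤ 1 / p := by positivity
  have key := norm_tsum_mul_conj_mul_momentCoeff_le (F := dilateF f s)
    (H := fun z => (fun z => z * deriv (dilateF g s) z + (1 / p : ℝ) * dilateF g s z) (ρ * z))
    (a := fun n => taylorCoeff (dilateF f s) n)
    (b := fun n => taylorCoeff (dilateF g s) n * (ρ:ℂ) ^ n) (R := 1 / s)
    (B := (1 + 1 / p) * B) hp0 hp1 hR hdf
    (fun z hz => hasSum_taylorCoeff hdf hz)
    (fun z hz => by
      convert hasSum_mul_deriv_add hdg (1 / p) ((hnz z).trans_lt hz) using 2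
      rw [mul_pow]; ring)
    (fun z hz => by
      refine (norm_mul_deriv_add_le hp' (fun w hw => hdg.differentiableAt
        (Metric.isOpen_ball.mem_nhds (by simpa using hw.trans hR))) hB
        ((hnz z).trans_lt hz)).trans ?_
      have h1 : 0 < 1 - ‖z‖ := by linarith
      have h2 := hnz z
      gcongr)
  rw [hM] at key
  refine le_trans (le_of_eq ?_) key
  congr 2
  refine tsum_congr fun n => ?_
  rw [taylorCoeff_dilateF hf hs, taylorCoeff_dilateF hg hs, map_mul, map_mul, map_pow, map_pow,
    Complex.conj_ofReal, Complex.conj_ofReal, pow_mul']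
  push_cast
  ring

/-! ### Boundedness of the pairing -/

lemma bloch_dilateF_le {ω : ℝ → ℝ} (hpos : ∀ r ∈ Ico (0:ℝ) 1, 0 < omegaHat ω r) {g : ℂ → ℂ}
    (hX : XInfNormE BlochNormE ω g < ⊤) {s : ℝ} (hs : s ∈ Ioo (0:ℝ) 1) {z : ℂ} (hz : ‖z‖ < 1) :
    ‖dilateF g s 0‖ + (1 - ‖z‖ ^ 2) * ‖deriv (dilateF g s) z‖ ≤
      (XInfNormE BlochNormE ω g).toReal / omegaHat ω s := by
  have hW := hpos s ⟨hs.1.le, hs.2⟩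
  rw [le_div_iff₀ hW]
  have h0 : 0 ≤ 1 - ‖z‖ ^ 2 := by nlinarith [norm_nonneg z]
  have h1 : BlochNormE (dilateF g s) * ENNReal.ofReal (omegaHat ω s) ≤ XInfNormE BlochNormE ω g :=
    le_iSup₂ (f := fun r (_ : r ∈ Ioo (0:ℝ) 1) =>
      BlochNormE (dilateF g r) * ENNReal.ofReal (omegaHat ω r)) s hs
  have h2 : ENNReal.ofReal (‖dilateF g s 0‖ + (1 - ‖z‖ ^ 2) * ‖deriv (dilateF g s) z‖) ≤
      BlochNormE (dilateF g s) := by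
    rw [ENNReal.ofReal_add (norm_nonneg _) (by positivity), BlochNormE]
    gcongr
    exact le_iSup₂ (f := fun z (_ : z ∈ Metric.ball (0:ℂ) 1) =>
      ENNReal.ofReal ((1 - ‖z‖ ^ 2) * ‖deriv (dilateF g s) z‖)) z (by simpa using hz)
  have h3 := (mul_le_mul_left h2 (ENNReal.ofReal (omegaHat ω s))).trans h1
  rw [← ENNReal.ofReal_mul (by positivity)] at h3
  exact (ENNReal.ofReal_le_iff_le_toReal hX.ne).1 h3

lemma abs_momentCoeff_nuWeight_le {κ : ℝ} (hκ : 0 < κ) (n : ℕ) :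
    |momentCoeff (nuWeight (κ - 1)) n| ≤ momentCoeff (nuWeight (κ - 1)) 0 := by
  rw [abs_of_nonneg]
  · exact antitone_nat_of_succ_le (momentCoeff_nuWeight_succ_le hκ) n.zero_le
  · refine le_trans ?_ (le_momentCoeff_nuWeight hκ (y := 0) (by simp) n)
    rw [sub_zero, Real.one_rpow]
    positivity

lemma summable_norm_taylorCoeff_mul {f g : ℂ → ℂ}
    (hf : DifferentiableOn ℂ f (Metric.ball 0 1)) (hg : DifferentiableOn ℂ g (Metric.ball 0 1))
    {ρ : ℝ} (hρ : 0 ≤ ρ) (hρ1 : ρ < 1) :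
    Summable fun n => ‖taylorCoeff f n * (starRingEnd ℂ) (taylorCoeff g n)‖ * ρ ^ n := by
  have hy : ‖((√ρ : ℝ) : ℂ)‖ < 1 := by
    rw [Complex.norm_of_nonneg (Real.sqrt_nonneg _)]
    rw [Real.sqrt_lt' one_pos]; simpa using hρ1
  have hsf := (hasSum_taylorCoeff hf hy).summable.norm
  have hsg := (hasSum_taylorCoeff hg hy).summable.norm
  obtain ⟨K, hK⟩ := hsg.tendsto_atTop_zero.bddAbove_range
  refine Summable.of_nonneg_of_le (fun _ => by positivity) (fun n => ?_) (hsf.mul_right K)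
  have hKn := hK ⟨n, rfl⟩
  calc ‖taylorCoeff f n * (starRingEnd ℂ) (taylorCoeff g n)‖ * ρ ^ n
      = ‖taylorCoeff f n * ((√ρ : ℝ) : ℂ) ^ n‖ * ‖taylorCoeff g n * ((√ρ : ℝ) : ℂ) ^ n‖ := by
        simp only [norm_mul, RCLike.norm_conj, norm_pow,
          Complex.norm_of_nonneg (Real.sqrt_nonneg ρ)]
        conv_lhs => rw [← Real.mul_self_sqrt hρ, mul_pow]
        ring
    _ ≤ _ := by gcongr

/-- The integrand in the representation of the pairing as an integral over `(0, 1)`. -/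
def pairingSlice (p : ℝ) (f g : ℂ → ℂ) (s ρ : ℝ) : ℂ :=
  ∑' n, taylorCoeff f n * (starRingEnd ℂ) (taylorCoeff g n) *
    (momentCoeff (nuWeight (1 / p - 2)) n : ℂ) * ((s ^ (2 * n) * ρ ^ n : ℝ) : ℂ)

section Pairing

variable {p : ℝ} {f g : ℂ → ℂ}

lemma norm_pairing_coeff_le (hp0 : 0 < p) (hp1 : p < 1) (n : ℕ) :
    ‖taylorCoeff f n * (starRingEnd ℂ) (taylorCoeff g n) *
      (momentCoeff (nuWeight (1 / p - 2)) n : ℂ)‖ ≤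
      momentCoeff (nuWeight (1 / p - 2)) 0 *
        ‖taylorCoeff f n * (starRingEnd ℂ) (taylorCoeff g n)‖ := by
  have hκ : 0 < 1 / p - 1 := by rw [sub_pos, lt_div_iff₀ hp0]; linarith
  have := abs_momentCoeff_nuWeight_le hκ n
  rw [show 1 / p - 1 - 1 = 1 / p - 2 by ring] at this
  rw [norm_mul, Complex.norm_real, Real.norm_eq_abs, mul_comm]
  gcongr

lemma summable_pairing_coeff (hp0 : 0 < p) (hp1 : p < 1)
    (hf : DifferentiableOn ℂ f (Metric.ball 0 1)) (hg : DifferentiableOn ℂ g (Metric.ball 0 1))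
    {ρ : ℝ} (hρ : 0 ≤ ρ) (hρ1 : ρ < 1) :
    Summable fun n => ‖taylorCoeff f n * (starRingEnd ℂ) (taylorCoeff g n) *
      (momentCoeff (nuWeight (1 / p - 2)) n : ℂ)‖ * ρ ^ n := by
  refine Summable.of_nonneg_of_le (fun _ => by positivity) (fun n => ?_)
    ((summable_norm_taylorCoeff_mul hf hg hρ hρ1).mul_left
      (momentCoeff (nuWeight (1 / p - 2)) 0))
  rw [← mul_assoc]
  gcongr
  exact norm_pairing_coeff_le hp0 hp1 n

lemma tendsto_pairingSlice (hp0 : 0 < p) (hp1 : p < 1)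
    (hf : DifferentiableOn ℂ f (Metric.ball 0 1)) (hg : DifferentiableOn ℂ g (Metric.ball 0 1))
    {s : ℝ} (hs : s ∈ Ioo (0:ℝ) 1) :
    Tendsto (pairingSlice p f g s) (nhdsWithin 1 (Iio 1)) (nhds (pairingSlice p f g s 1)) := by
  have hs2 : s ^ 2 < 1 := by nlinarith [hs.1, hs.2]
  refine tendsto_tsum_of_dominated_convergence
    (summable_pairing_coeff hp0 hp1 hf hg (sq_nonneg s) hs2) (fun n => ?_) ?_
  · refine Tendsto.const_mul _ ?_
    have : Continuous fun ρ : ℝ => ((s ^ (2 * n) * ρ ^ n : ℝ) : ℂ) := by fun_prop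
    exact (this.tendsto 1).mono_left nhdsWithin_le_nhds
  · filter_upwards [Ioo_mem_nhdsLT (zero_lt_one (α := ℝ))] with ρ hρ n
    have h0 := hs.1.le
    have h1 := hρ.1.le
    rw [norm_mul, Complex.norm_of_nonneg (r := _ * _) (by positivity), pow_mul]
    gcongr
    exact mul_le_of_le_one_right (by positivity) (pow_le_one₀ h1 hρ.2.le)

lemma continuousOn_pairingSlice (hp0 : 0 < p) (hp1 : p < 1)
    (hf : DifferentiableOn ℂ f (Metric.ball 0 1)) (hg : DifferentiableOn ℂ g (Metric.ball 0 1))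
    {ρ : ℝ} (hρ : 0 ≤ ρ) (hρ1 : ρ < 1) :
    ContinuousOn (fun s => pairingSlice p f g s ρ) (Ioo 0 1) := by
  refine continuousOn_tsum (fun n => by fun_prop)
    (summable_pairing_coeff hp0 hp1 hf hg hρ hρ1) fun n s hs => ?_
  have h0 := hs.1.le
  rw [norm_mul, Complex.norm_of_nonneg (by positivity)]
  gcongr
  exact mul_le_of_le_one_left (by positivity) (pow_le_one₀ h0 hs.2.le)

lemma hasSum_pairing (hp0 : 0 < p) (hp1 : p < 1)
    (hf : DifferentiableOn ℂ f (Metric.ball 0 1)) (hg : DifferentiableOn ℂ g (Metric.ball 0 1))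
    {μ : ℝ → ℝ} (hμ : IntegrableOn μ (Ioo 0 1)) {ρ : ℝ} (hρ : 0 ≤ ρ) (hρ1 : ρ < 1) :
    HasSum (fun n => taylorCoeff f n * (starRingEnd ℂ) (taylorCoeff g n) *
      ((momentCoeff μ n * momentCoeff (nuWeight (1 / p - 2)) n : ℝ) : ℂ) * (ρ:ℂ) ^ n)
      (∫ s in Ioo (0:ℝ) 1, ((s * μ s : ℝ) : ℂ) * pairingSlice p f g s ρ) := by
  set a : ℕ → ℂ := fun n => taylorCoeff f n * (starRingEnd ℂ) (taylorCoeff g n) *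
      (momentCoeff (nuWeight (1 / p - 2)) n : ℂ) with ha
  have hint : ∀ n : ℕ, IntegrableOn (fun s => s ^ (2 * n + 1) * μ s) (Ioo 0 1) := fun n =>
    integrableOn_mul_weight hμ (by fun_prop)
  have hφ : ∀ n : ℕ, Integrable (fun s : ℝ => ((s ^ (2 * n + 1) * μ s : ℝ) : ℂ) *
      (a n * (ρ:ℂ) ^ n)) (volume.restrict (Ioo 0 1)) := fun n =>
    ((hint n).ofReal).mul_const _
  have hbd : ∀ n : ℕ, ∫ s in Ioo (0:ℝ) 1, ‖((s ^ (2 * n + 1) * μ s : ℝ) : ℂ) *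
      (a n * (ρ:ℂ) ^ n)‖ ≤ (∫ s in Ioo (0:ℝ) 1, |μ s|) * (‖a n‖ * ρ ^ n) := fun n => by
    rw [← integral_mul_const]
    refine setIntegral_mono_on (hφ n).norm (hμ.abs.mul_const _) measurableSet_Ioo fun s hs => ?_
    have h0 := hs.1.le
    rw [norm_mul, norm_mul, norm_pow, Complex.norm_of_nonneg hρ, Complex.norm_real,
      Real.norm_eq_abs, abs_mul, abs_of_nonneg (by positivity : 0 ≤ s ^ (2 * n + 1))]
    gcongr
    exact mul_le_of_le_one_left (abs_nonneg _) (pow_le_one₀ h0 hs.2.le)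
  have hsum := hasSum_integral_of_summable_integral_norm hφ
    (Summable.of_nonneg_of_le (fun n => integral_nonneg fun _ => norm_nonneg _) hbd
      ((summable_pairing_coeff hp0 hp1 hf hg hρ hρ1).mul_left _))
  have e : ∫ s in Ioo (0:ℝ) 1, ((s * μ s : ℝ) : ℂ) * pairingSlice p f g s ρ =
      ∫ s in Ioo (0:ℝ) 1, ∑' n : ℕ, ((s ^ (2 * n + 1) * μ s : ℝ) : ℂ) * (a n * (ρ:ℂ) ^ n) := by
    congr 1
    funext s
    rw [pairingSlice, ← tsum_mul_left]
    refine tsum_congr fun n => ?_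
    simp only [ha]
    push_cast
    ring
  rw [e]
  refine hsum.congr_fun fun n => ?_
  rw [integral_mul_const, integral_complex_ofReal, momentCoeff_eq,
    intervalIntegral.integral_of_le zero_le_one, integral_Ioc_eq_integral_Ioo]
  simp only [ha]
  push_cast
  ring

end Pairing

lemma exists_hasPairingC_of_bloch {ω : ℝ → ℝ} (hω : IsRadialWeight ω)
    (hpos : ∀ r ∈ Ico (0:ℝ) 1, 0 < omegaHat ω r) (hD : InDhat ω) {p q : ℝ} (hp0 : 0 < p)
    (hp1 : p < 1) (hq0 : 0 < q) (hq1 : q ≤ 1) :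
    ∃ C₂ > (0:ℝ), ∀ g : ℂ → ℂ, DifferentiableOn ℂ g (Metric.ball 0 1) →
        XInfNormE BlochNormE ω g < ⊤ →
        ∀ f : ℂ → ℂ, InApq ω p q f →
          ∃ l : ℂ, HasPairingC
              (fun k => momentCoeff (fun r => ω r * omegaHat ω r ^ (1 / q)) k *
                momentCoeff (nuWeight (1 / p - 2)) k) f g l ∧
            ‖l‖ ≤ C₂ * (XInfNormE BlochNormE ω g).toReal * (LpqNormE ω p q f).toReal := by
  obtain ⟨C, hC0, hC⟩ := hD
  have hE := embConst_pos hp0 hp1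
  set K := 2 ^ (1 / p - 1) * (1 + 1 / p) * embConst p with hK
  have hKpos : 0 < K := by positivity
  refine ⟨K * (2 * C) ^ ((1 - q) / q), by positivity, fun g hg hX f hf => ?_⟩
  set X := (XInfNormE BlochNormE ω g).toReal with hXd
  have hX0 : 0 ≤ X := ENNReal.toReal_nonneg
  set μ : ℝ → ℝ := fun r => ω r * omegaHat ω r ^ (1 / q) with hμd
  have hμ : IntegrableOn μ (Ioo 0 1) := integrableOn_mul_omegaHat_rpow hω (by positivity)
  have hμ0 : ∀ s ∈ Ioo (0:ℝ) 1, 0 ≤ s * μ s := fun s hs =>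
    mul_nonneg hs.1.le (mul_omegaHat_rpow_nonneg hω s hs)
  have hq1' : 0 ≤ 1 / q - 1 := by rw [sub_nonneg, le_div_iff₀ hq0]; linarith
  have hv0 : ∀ s ∈ Ioo (0:ℝ) 1, 0 ≤ s * (ω s * omegaHat ω s ^ (1 / q - 1)) := fun s hs =>
    mul_nonneg hs.1.le (mul_omegaHat_rpow_nonneg hω s hs)
  have hslice : ∀ s ∈ Ioo (0:ℝ) 1, ∀ ρ ∈ Icc (0:ℝ) 1,
      ‖((s * μ s : ℝ) : ℂ) * pairingSlice p f g s ρ‖ₑ ≤ ENNReal.ofReal (K * X) *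
        (ENNReal.ofReal (s * (ω s * omegaHat ω s ^ (1 / q - 1))) * MpE p s f) := by
    intro s hs ρ hρ
    have hW := hpos s ⟨hs.1.le, hs.2⟩
    have h := norm_tsum_dilate_le hp0 hp1 hf.1 hg hs.1 hs.2 hρ.1 hρ.2
      fun z hz => bloch_dilateF_le hpos hX hs hz
    rw [enorm_mul, ← ofReal_norm, ← ofReal_norm, Complex.norm_of_nonneg (hμ0 s hs)]
    refine (mul_le_mul_right h _).trans (le_of_eq ?_)
    rw [← mul_assoc (ENNReal.ofReal _) (ENNReal.ofReal _) (MpE p s f),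
      ← mul_assoc (ENNReal.ofReal _) (ENNReal.ofReal _) (MpE p s f),
      ← ENNReal.ofReal_mul (hμ0 s hs),
      ← ENNReal.ofReal_mul (by positivity)]
    congr 2
    rw [Real.rpow_sub_one hW.ne']
    simp only [hμd, hK]
    ring
  set bound : ℝ → ℝ := fun s => (K * X) *
    (s * (ω s * omegaHat ω s ^ (1 / q - 1)) * (MpE p s f).toReal) with hbound
  have hMt : ∀ s ∈ Ioo (0:ℝ) 1, MpE p s f ≠ ⊤ := fun s hs =>
    (MpE_lt_top hp0 hf.1 hs.1.le hs.2).ne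
  have hbe : ∀ s ∈ Ioo (0:ℝ) 1, ENNReal.ofReal (bound s) = ENNReal.ofReal (K * X) *
        (ENNReal.ofReal (s * (ω s * omegaHat ω s ^ (1 / q - 1))) * MpE p s f) := fun s hs => by
    rw [hbound, ENNReal.ofReal_mul (by positivity), ENNReal.ofReal_mul (hv0 s hs),
      ENNReal.ofReal_toReal (hMt s hs)]
  have hb0 : ∀ s ∈ Ioo (0:ℝ) 1, 0 ≤ bound s := fun s hs =>
    mul_nonneg (by positivity) (mul_nonneg (hv0 s hs) ENNReal.toReal_nonneg)
  have hlint : ∫⁻ s in Ioo (0:ℝ) 1, ENNReal.ofReal (bound s) ≤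
      ENNReal.ofReal (K * X) * (ENNReal.ofReal ((2 * C) ^ ((1 - q) / q)) * LpqNormE ω p q f) := by
    rw [setLIntegral_congr_fun measurableSet_Ioo hbe,
      lintegral_const_mul' _ _ ENNReal.ofReal_ne_top]
    gcongr
    exact lintegral_mul_MpE_le hω hpos hC hp0 hq0 hq1 hf
  have hfin : ENNReal.ofReal (K * X) *
      (ENNReal.ofReal ((2 * C) ^ ((1 - q) / q)) * LpqNormE ω p q f) ≠ ⊤ :=
    ENNReal.mul_ne_top ENNReal.ofReal_ne_top (ENNReal.mul_ne_top ENNReal.ofReal_ne_top hf.2.ne)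
  have hbint : Integrable bound (volume.restrict (Ioo 0 1)) := by
    refine ⟨?_, ?_⟩
    · have hm : AEMeasurable (fun s => (MpE p s f).toReal) (volume.restrict (Ioo 0 1)) := by
        refine aemeasurable_restrict_of_monotoneOn measurableSet_Ioo fun s hs t ht hst => ?_
        exact ENNReal.toReal_mono (hMt t ht) (MpE_mono hp0 hf.1 hs.1.le hst ht.2)
      exact (((measurable_id.aemeasurable.mul
        (integrableOn_mul_omegaHat_rpow hω hq1').aestronglyMeasurable.aemeasurable).mul
          hm).const_mul _).aestronglyMeasurable
    · rw [HasFiniteIntegral]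
      refine lt_of_le_of_lt ?_ (lt_top_iff_ne_top.2 hfin)
      refine le_trans (le_of_eq ?_) hlint
      refine setLIntegral_congr_fun measurableSet_Ioo fun s hs => ?_
      rw [← ofReal_norm, Real.norm_of_nonneg (hb0 s hs)]
  refine ⟨∫ s in Ioo (0:ℝ) 1, ((s * μ s : ℝ) : ℂ) * pairingSlice p f g s 1, ⟨?_, ?_⟩, ?_⟩
  · intro r hr
    exact (hasSum_pairing hp0 hp1 hf.1 hg hμ hr.1 hr.2).summable
  · have hev : ∀ᶠ ρ : ℝ in nhdsWithin 1 (Iio 1), ρ ∈ Ioo (0:ℝ) 1 :=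
      Ioo_mem_nhdsLT zero_lt_one
    refine Tendsto.congr' (f₁ := fun ρ => ∫ s in Ioo (0:ℝ) 1,
      ((s * μ s : ℝ) : ℂ) * pairingSlice p f g s ρ) ?_ ?_
    · filter_upwards [hev] with ρ hρ
      exact (hasSum_pairing hp0 hp1 hf.1 hg hμ hρ.1.le hρ.2).tsum_eq.symm
    · refine tendsto_integral_filter_of_dominated_convergence bound ?_ ?_ hbint ?_
      · filter_upwards [hev] with ρ hρ
        refine AEStronglyMeasurable.mul ?_
          ((continuousOn_pairingSlice hp0 hp1 hf.1 hg hρ.1.le hρ.2).aestronglyMeasurable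
            measurableSet_Ioo)
        exact (integrableOn_mul_weight hμ (f := fun s => s) (by fun_prop)).ofReal.aestronglyMeasurable
      · filter_upwards [hev] with ρ hρ
        filter_upwards [ae_restrict_mem measurableSet_Ioo] with s hs
        have := hslice s hs ρ ⟨hρ.1.le, hρ.2.le⟩
        rw [← hbe s hs, ← ofReal_norm] at this
        exact (ENNReal.ofReal_le_ofReal_iff (hb0 s hs)).1 this
      · filter_upwards [ae_restrict_mem measurableSet_Ioo] with s hs
        exact (tendsto_pairingSlice hp0 hp1 hf.1 hg hs).const_mul _
  · have h1 : ‖∫ s in Ioo (0:ℝ) 1, ((s * μ s : ℝ) : ℂ) * pairingSlice p f g s 1‖ₑ ≤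
        ENNReal.ofReal (K * X) * (ENNReal.ofReal ((2 * C) ^ ((1 - q) / q)) * LpqNormE ω p q f) := by
      refine (enorm_integral_le_lintegral_enorm _).trans (le_trans ?_ hlint)
      refine setLIntegral_mono' measurableSet_Ioo fun s hs => ?_
      rw [hbe s hs]
      exact hslice s hs 1 ⟨zero_le_one, le_rfl⟩
    rw [← ofReal_norm, ENNReal.ofReal_le_iff_le_toReal hfin, ENNReal.toReal_mul,
      ENNReal.toReal_mul, ENNReal.toReal_ofReal (by positivity),
      ENNReal.toReal_ofReal (by positivity)] at h1
    refine h1.trans (le_of_eq ?_)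
    ring

/-! ### Dilations and power series in the mixed norm space -/

lemma MpE_le_of_norm_le {p : ℝ} (hp : 0 < p) {r K : ℝ} {f : ℂ → ℂ}
    (h : ∀ θ, ‖f (circlePt r θ)‖ ≤ K) : MpE p r f ≤ ENNReal.ofReal K := by
  have hK : 0 ≤ K := (norm_nonneg _).trans (h 0)
  rw [MpE_eq]
  calc (∫⁻ θ, ENNReal.ofReal (‖f (circlePt r θ)‖ ^ p) ∂arcMeasure) ^ (1 / p)
      ≤ (∫⁻ _, ENNReal.ofReal (K ^ p) ∂arcMeasure) ^ (1 / p) := by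
        gcongr with θ
        exact h θ
    _ = ENNReal.ofReal K := by
        rw [lintegral_const, measure_univ, mul_one, ← ENNReal.ofReal_rpow_of_nonneg hK hp.le,
          ← ENNReal.rpow_mul, mul_one_div_cancel hp.ne', ENNReal.rpow_one]

lemma aemeasurable_MpE {p : ℝ} (hp : 0 < p) {f : ℂ → ℂ}
    (hf : DifferentiableOn ℂ f (Metric.ball 0 1)) :
    AEMeasurable (fun s => MpE p s f) (volume.restrict (Ioo 0 1)) :=
  aemeasurable_restrict_of_monotoneOn measurableSet_Ioo fun _ hs _ ht hst =>
    MpE_mono hp hf hs.1.le hst ht.2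

lemma MpE_sub_rpow_le {p : ℝ} (hp : 0 < p) (hp1 : p ≤ 1) {r : ℝ} {f g : ℂ → ℂ}
    (hf : Continuous fun θ => f (circlePt r θ)) :
    MpE p r (f - g) ^ p ≤ MpE p r f ^ p + MpE p r g ^ p := by
  simp only [MpE_eq]
  rw [← ENNReal.rpow_mul, ← ENNReal.rpow_mul, ← ENNReal.rpow_mul, one_div_mul_cancel hp.ne',
    ENNReal.rpow_one, ENNReal.rpow_one, ENNReal.rpow_one, ← lintegral_add_left]
  · refine lintegral_mono fun θ => ?_
    rw [← ENNReal.ofReal_add (by positivity) (by positivity)]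
    refine ENNReal.ofReal_le_ofReal ?_
    refine (Real.rpow_le_rpow (norm_nonneg _) (norm_sub_le _ _) hp.le).trans ?_
    exact Real.rpow_add_le_add_rpow (norm_nonneg _) (norm_nonneg _) hp.le hp1
  · exact ((hf.norm.rpow_const fun _ => Or.inr hp.le)).measurable.ennreal_ofReal

lemma differentiableOn_dilateF_ball {f : ℂ → ℂ} (hf : DifferentiableOn ℂ f (Metric.ball 0 1))
    {ρ : ℝ} (hρ : ρ ∈ Ioo (0:ℝ) 1) : DifferentiableOn ℂ (dilateF f ρ) (Metric.ball 0 1) := by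
  refine (differentiableOn_dilateF hf hρ.1).mono (Metric.ball_subset_ball ?_)
  rw [le_div_iff₀ hρ.1]
  linarith [hρ.2]

lemma MpE_sub_dilateF_le {p : ℝ} (hp : 0 < p) (hp1 : p ≤ 1) {f : ℂ → ℂ}
    (hf : DifferentiableOn ℂ f (Metric.ball 0 1)) {s ρ : ℝ} (hs : s ∈ Ioo (0:ℝ) 1)
    (hρ : ρ ∈ Ioo (0:ℝ) 1) : MpE p s (f - dilateF f ρ) ≤ 2 ^ (1 / p) * MpE p s f := by
  have h1 : MpE p s (dilateF f ρ) ≤ MpE p s f := by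
    have : MpE p s (dilateF f ρ) = MpE p (ρ * s) f := by
      simp only [MpE, dilateF, circlePt_mul]
    rw [this]
    exact MpE_mono hp hf (mul_nonneg hρ.1.le hs.1.le)
      (mul_le_of_le_one_left hs.1.le hρ.2.le) hs.2
  have h2 : MpE p s (f - dilateF f ρ) ^ p ≤ 2 * MpE p s f ^ p := by
    refine (MpE_sub_rpow_le hp hp1 (continuous_comp_circlePt hf hs.1.le hs.2)).trans ?_
    rw [two_mul]
    gcongr
  have h3 := ENNReal.rpow_le_rpow h2 (by positivity : 0 ≤ 1 / p)
  rwa [← ENNReal.rpow_mul, mul_one_div_cancel hp.ne', ENNReal.rpow_one,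
    ENNReal.mul_rpow_of_nonneg _ _ (by positivity), ← ENNReal.rpow_mul,
    mul_one_div_cancel hp.ne', ENNReal.rpow_one] at h3

lemma tendsto_MpE_sub_dilateF {p : ℝ} (hp : 0 < p) {f : ℂ → ℂ}
    (hf : DifferentiableOn ℂ f (Metric.ball 0 1)) {s : ℝ} (hs : s ∈ Ioo (0:ℝ) 1) :
    Tendsto (fun ρ => MpE p s (f - dilateF f ρ)) (nhdsWithin 1 (Iio 1)) (nhds 0) := by
  have huc : UniformContinuousOn f (Metric.closedBall 0 s) :=
    (isCompact_closedBall 0 s).uniformContinuousOn_of_continuous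
      (hf.continuousOn.mono (Metric.closedBall_subset_ball hs.2))
  rw [Metric.uniformContinuousOn_iff] at huc
  rw [ENNReal.tendsto_nhds_zero]
  intro ε hε
  obtain ⟨ε', h0, hle⟩ : ∃ ε' : ℝ, 0 < ε' ∧ ENNReal.ofReal ε' ≤ ε := by
    rcases eq_or_ne ε ⊤ with rfl | h
    · exact ⟨1, one_pos, le_top⟩
    · exact ⟨ε.toReal, ENNReal.toReal_pos hε.ne' h, ENNReal.ofReal_toReal_le⟩
  obtain ⟨δ, hδ, hd⟩ := huc ε' h0
  have e1 : ∀ᶠ ρ : ℝ in nhdsWithin 1 (Iio 1), ρ ∈ Ioo (max 0 (1 - δ)) 1 :=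
    Ioo_mem_nhdsLT (max_lt one_pos (by linarith))
  filter_upwards [e1] with ρ hρ
  obtain ⟨h1, h2⟩ := max_lt_iff.1 hρ.1
  refine (MpE_le_of_norm_le hp fun θ => ?_).trans hle
  have hz := norm_circlePt hs.1.le θ
  have := hd (circlePt s θ) (by simp [hz]) (ρ * circlePt s θ) (by
    rw [mem_closedBall_zero_iff, norm_mul, Complex.norm_of_nonneg h1.le, hz]
    exact mul_le_of_le_one_left hs.1.le hρ.2.le) (by
    rw [dist_eq_norm, ← one_sub_mul, norm_mul, hz, ← Complex.ofReal_one, ← Complex.ofReal_sub,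
      Complex.norm_of_nonneg (by linarith [hρ.2])]
    nlinarith [hs.1, hs.2, hρ.2])
  rw [dist_eq_norm] at this
  exact this.le

lemma tendsto_LpqNormE_sub_dilateF {ω : ℝ → ℝ} (hω : IsRadialWeight ω) {p q : ℝ} (hp : 0 < p)
    (hp1 : p ≤ 1) (hq : 0 < q) {f : ℂ → ℂ} (hf : InApq ω p q f) :
    Tendsto (fun ρ => LpqNormE ω p q (f - dilateF f ρ)) (nhdsWithin 1 (Iio 1)) (nhds 0) := by
  have hint : ∫⁻ r in Ioo (0:ℝ) 1, (MpE p r f) ^ q * ENNReal.ofReal (r * ω r) ≠ ⊤ := by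
    intro h
    have := hf.2
    rw [LpqNormE, h, ENNReal.top_rpow_of_pos (by positivity)] at this
    exact this.ne rfl
  have hev : ∀ᶠ ρ : ℝ in nhdsWithin 1 (Iio 1), ρ ∈ Ioo (0:ℝ) 1 :=
    Ioo_mem_nhdsLT zero_lt_one
  have hm : AEMeasurable (fun r => ENNReal.ofReal (r * ω r)) (volume.restrict (Ioo (0:ℝ) 1)) :=
    (integrableOn_mul_weight hω.integrableOn_Ioo
      (f := fun r => r) (by fun_prop)).aestronglyMeasurable.aemeasurable.ennreal_ofReal
  have key := tendsto_lintegral_filter_of_dominated_convergence'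
    (μ := volume.restrict (Ioo (0:ℝ) 1)) (l := nhdsWithin (1:ℝ) (Iio 1))
    (F := fun ρ r => MpE p r (f - dilateF f ρ) ^ q * ENNReal.ofReal (r * ω r)) (f := fun _ => 0)
    (fun r => (2 ^ (1 / p)) ^ q * (MpE p r f ^ q * ENNReal.ofReal (r * ω r)))
    (by
      filter_upwards [hev] with ρ hρ
      exact ((aemeasurable_MpE hp
        (hf.1.sub (differentiableOn_dilateF_ball hf.1 hρ))).pow_const q).mul hm)
    (by
      filter_upwards [hev] with ρ hρ
      filter_upwards [ae_restrict_mem measurableSet_Ioo] with s hs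
      rw [← mul_assoc, ← ENNReal.mul_rpow_of_nonneg _ _ hq.le]
      gcongr
      exact MpE_sub_dilateF_le hp hp1 hf.1 hs hρ)
    (by
      rw [lintegral_const_mul' _ _ (by finiteness)]
      exact ENNReal.mul_ne_top (by finiteness) hint)
    (by
      filter_upwards [ae_restrict_mem measurableSet_Ioo] with s hs
      have h1 := (tendsto_MpE_sub_dilateF hp hf.1 hs).ennrpow_const q
      rw [ENNReal.zero_rpow_of_pos hq] at h1
      simpa using ENNReal.Tendsto.mul_const h1 (Or.inr ENNReal.ofReal_ne_top))
  rw [lintegral_zero] at key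
  have h2 := key.ennrpow_const (1 / q)
  rwa [ENNReal.zero_rpow_of_pos (by positivity)] at h2

lemma lintegral_mul_weight_lt_top {ω : ℝ → ℝ} (hω : IsRadialWeight ω) :
    ∫⁻ r in Ioo (0:ℝ) 1, ENNReal.ofReal (r * ω r) < ⊤ :=
  (integrableOn_mul_weight hω.integrableOn_Ioo (f := fun r => r) (by fun_prop)).lintegral_lt_top

/-- The norm of the constant function `1`. -/
def normOne (ω : ℝ → ℝ) (q : ℝ) : ℝ :=
  ((∫⁻ r in Ioo (0:ℝ) 1, ENNReal.ofReal (r * ω r)) ^ (1 / q)).toReal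

lemma LpqNormE_le_of_norm_le {ω : ℝ → ℝ} (hω : IsRadialWeight ω) {p q : ℝ} (hp : 0 < p)
    (hq : 0 < q) {f : ℂ → ℂ} {K : ℝ} (hK : ∀ z : ℂ, ‖z‖ < 1 → ‖f z‖ ≤ K) :
    LpqNormE ω p q f ≤ ENNReal.ofReal (K * normOne ω q) := by
  have hK0 : 0 ≤ K := (norm_nonneg _).trans (hK 0 (by simp))
  have hfin : (∫⁻ r in Ioo (0:ℝ) 1, ENNReal.ofReal (r * ω r)) ^ (1 / q) ≠ ⊤ :=
    ENNReal.rpow_ne_top_of_nonneg (by positivity) (lintegral_mul_weight_lt_top hω).ne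
  rw [normOne, ENNReal.ofReal_mul hK0, ENNReal.ofReal_toReal hfin, LpqNormE]
  calc (∫⁻ r in Ioo (0:ℝ) 1, (MpE p r f) ^ q * ENNReal.ofReal (r * ω r)) ^ (1 / q)
      ≤ (∫⁻ r in Ioo (0:ℝ) 1, ENNReal.ofReal K ^ q * ENNReal.ofReal (r * ω r)) ^ (1 / q) := by
        refine ENNReal.rpow_le_rpow ?_ (by positivity)
        refine setLIntegral_mono' measurableSet_Ioo fun r hr => ?_
        gcongr
        exact MpE_le_of_norm_le hp fun θ => hK _ (by rw [norm_circlePt hr.1.le]; exact hr.2)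
    _ = _ := by
        rw [lintegral_const_mul' _ _ (by finiteness),
          ENNReal.mul_rpow_of_nonneg _ _ (by positivity), ← ENNReal.rpow_mul,
          mul_one_div_cancel hq.ne', ENNReal.rpow_one]

section Functional

variable {ω : ℝ → ℝ} {p q M : ℝ} {L : (ℂ → ℂ) → ℂ}

lemma norm_functional_le_of_norm_le (hω : IsRadialWeight ω) (hp : 0 < p) (hq : 0 < q)
    (hM0 : 0 ≤ M) (hM : ∀ f : ℂ → ℂ, InApq ω p q f → ‖L f‖ ≤ M * (LpqNormE ω p q f).toReal)
    {f : ℂ → ℂ} (hf : DifferentiableOn ℂ f (Metric.ball 0 1)) {K : ℝ}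
    (hK : ∀ z : ℂ, ‖z‖ < 1 → ‖f z‖ ≤ K) :
    InApq ω p q f ∧ ‖L f‖ ≤ M * (K * normOne ω q) := by
  have hK0 : 0 ≤ K := (norm_nonneg _).trans (hK 0 (by simp))
  have h := LpqNormE_le_of_norm_le hω hp hq hK
  have hf' : InApq ω p q f := ⟨hf, h.trans_lt ENNReal.ofReal_lt_top⟩
  refine ⟨hf', (hM f hf').trans ?_⟩
  gcongr
  exact ENNReal.toReal_le_of_le_ofReal (mul_nonneg hK0 ENNReal.toReal_nonneg) h

lemma functional_sub (hL : IsLinearOn (InApq ω p q) L) {f g : ℂ → ℂ} (hg : InApq ω p q g)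
    (hfg : InApq ω p q (f - g)) : L (f - g) = L f - L g := by
  have := hL.1 (f - g) g hfg hg
  rw [sub_add_cancel] at this
  rw [this, add_sub_cancel_right]

lemma functional_polynomial (hω : IsRadialWeight ω) (hp : 0 < p) (hq : 0 < q)
    (hL : IsLinearOn (InApq ω p q) L) (a : ℕ → ℂ) (N : ℕ) :
    InApq ω p q (fun z => ∑ n ∈ Finset.range N, a n * z ^ n) ∧
      L (fun z => ∑ n ∈ Finset.range N, a n * z ^ n) =
        ∑ n ∈ Finset.range N, a n * L (fun z => z ^ n) := by
  have hmem : ∀ {f : ℂ → ℂ} {K : ℝ}, DifferentiableOn ℂ f (Metric.ball 0 1) →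
      (∀ z : ℂ, ‖z‖ < 1 → ‖f z‖ ≤ K) → InApq ω p q f := fun h1 h2 =>
    ⟨h1, (LpqNormE_le_of_norm_le hω hp hq h2).trans_lt ENNReal.ofReal_lt_top⟩
  have hpoly : ∀ N, InApq ω p q (fun z => ∑ n ∈ Finset.range N, a n * z ^ n) := fun N =>
    hmem (K := ∑ n ∈ Finset.range N, ‖a n‖) (by fun_prop) fun z hz => by
      refine (norm_sum_le _ _).trans (Finset.sum_le_sum fun n _ => ?_)
      rw [norm_mul, norm_pow]
      exact mul_le_of_le_one_right (norm_nonneg _) (pow_le_one₀ (norm_nonneg _) hz.le)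
  have hmono : ∀ n, InApq ω p q (fun z => z ^ n) := fun n =>
    hmem (K := 1) (by fun_prop) fun z hz => by
      rw [norm_pow]; exact pow_le_one₀ (norm_nonneg _) hz.le
  refine ⟨hpoly N, ?_⟩
  induction N with
  | zero =>
    have := hL.2 0 _ (hpoly 0)
    simp only [zero_smul, zero_mul] at this
    simpa [Pi.zero_def] using this
  | succ N ih =>
    have hsm : InApq ω p q (a N • fun z : ℂ => z ^ N) :=
      hmem (K := ‖a N‖) ((by fun_prop : Differentiable ℂ fun z : ℂ =>
        z ^ N).differentiableOn.const_smul _) fun z hz => by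
          simp only [Pi.smul_apply, smul_eq_mul, norm_mul, norm_pow]
          exact mul_le_of_le_one_right (norm_nonneg _) (pow_le_one₀ (norm_nonneg _) hz.le)
    have e : (fun z : ℂ => ∑ n ∈ Finset.range (N + 1), a n * z ^ n) =
        (fun z => ∑ n ∈ Finset.range N, a n * z ^ n) + a N • fun z : ℂ => z ^ N := by
      funext z
      simp [Finset.sum_range_succ]
    rw [e, hL.1 _ _ (hpoly N) hsm, hL.2 _ _ (hmono N), ih, Finset.sum_range_succ]

lemma hasSum_functional (hω : IsRadialWeight ω) (hp : 0 < p) (hq : 0 < q) (hM0 : 0 ≤ M)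
    (hL : IsLinearOn (InApq ω p q) L)
    (hM : ∀ f : ℂ → ℂ, InApq ω p q f → ‖L f‖ ≤ M * (LpqNormE ω p q f).toReal)
    {a : ℕ → ℂ} (ha : Summable fun n => ‖a n‖) {f : ℂ → ℂ}
    (hf : ∀ z : ℂ, ‖z‖ < 1 → HasSum (fun n => a n * z ^ n) (f z)) :
    InApq ω p q f ∧ HasSum (fun n => a n * L (fun z => z ^ n)) (L f) := by
  have hle : ∀ (n : ℕ) (z : ℂ), ‖z‖ < 1 → ‖a n * z ^ n‖ ≤ ‖a n‖ := fun n z hz => by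
    rw [norm_mul, norm_pow]
    exact mul_le_of_le_one_right (norm_nonneg _) (pow_le_one₀ (norm_nonneg _) hz.le)
  have hfd : DifferentiableOn ℂ f (Metric.ball 0 1) := by
    refine (Complex.differentiableOn_tsum_of_summable_norm (F := fun n z => a n * z ^ n) ha
      (fun n => by fun_prop) Metric.isOpen_ball fun n z hz => hle n z (by simpa using hz)).congr
      fun z hz => (hf z (by simpa using hz)).tsum_eq.symm
  have hfa : InApq ω p q f := (norm_functional_le_of_norm_le (K := ∑' n, ‖a n‖) hω hp hq hM0 hM hfd
    fun z hz => (hf z hz).tsum_eq ▸ tsum_of_norm_bounded ha.hasSum fun n => hle n z hz).1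
  refine ⟨hfa, ?_⟩
  have hsum : Summable fun n => a n * L (fun z => z ^ n) := by
    refine Summable.of_norm_bounded (ha.mul_right (M * (1 * normOne ω q))) fun n => ?_
    rw [norm_mul]
    gcongr
    refine (norm_functional_le_of_norm_le (K := 1) hω hp hq hM0 hM (by fun_prop) fun z hz => ?_).2
    rw [norm_pow]; exact pow_le_one₀ (norm_nonneg _) hz.le
  rw [hsum.hasSum_iff_tendsto_nat, tendsto_iff_norm_sub_tendsto_zero]
  have htail : Tendsto (fun N => M * ((∑' n, ‖a (n + N)‖) * normOne ω q)) atTop (nhds 0) := by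
    simpa using ((tendsto_sum_nat_add fun n => ‖a n‖).mul_const (normOne ω q)).const_mul M
  refine squeeze_zero (fun _ => norm_nonneg _) (fun N => ?_) htail
  obtain ⟨h1, h2⟩ := functional_polynomial hω hp hq hL a N
  have h3 := norm_functional_le_of_norm_le (K := ∑' n, ‖a (n + N)‖) hω hp hq hM0 hM
    (f := f - fun z => ∑ n ∈ Finset.range N, a n * z ^ n) (hfd.sub h1.1) fun z hz => by
      have := (hasSum_nat_add_iff' N).2 (hf z hz)
      rw [Pi.sub_apply, ← this.tsum_eq]
      exact tsum_of_norm_bounded ((summable_nat_add_iff N).2 ha).hasSum fun n => hle _ z hz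
  rw [norm_sub_rev, ← h2, ← functional_sub hL h1 h3.1]
  exact h3.2

lemma tendsto_functional_dilateF (hω : IsRadialWeight ω) (hp : 0 < p) (hp1 : p ≤ 1) (hq : 0 < q)
    (hL : IsLinearOn (InApq ω p q) L)
    (hM : ∀ f : ℂ → ℂ, InApq ω p q f → ‖L f‖ ≤ M * (LpqNormE ω p q f).toReal)
    {f : ℂ → ℂ} (hf : InApq ω p q f) :
    Tendsto (fun ρ => L (dilateF f ρ)) (nhdsWithin 1 (Iio 1)) (nhds (L f)) := by
  have h0 := tendsto_LpqNormE_sub_dilateF hω hp hp1 hq hf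
  have h1 := ((ENNReal.tendsto_toReal ENNReal.zero_ne_top).comp h0).const_mul M
  rw [ENNReal.toReal_zero, mul_zero] at h1
  rw [tendsto_iff_norm_sub_tendsto_zero]
  refine squeeze_zero' (Eventually.of_forall fun _ => norm_nonneg _) ?_ h1
  have hev : ∀ᶠ ρ : ℝ in nhdsWithin 1 (Iio 1), ρ ∈ Ioo (0:ℝ) 1 :=
    Ioo_mem_nhdsLT zero_lt_one
  filter_upwards [hev, h0.eventually_lt_const ENNReal.zero_lt_top] with ρ hρ hlt
  have hd := differentiableOn_dilateF_ball hf.1 hρ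
  have hsub : InApq ω p q (f - dilateF f ρ) := ⟨hf.1.sub hd, hlt⟩
  have hdil : InApq ω p q (dilateF f ρ) := by
    refine ⟨hd, lt_of_le_of_lt (ENNReal.rpow_le_rpow ?_ (by positivity)) hf.2⟩
    refine setLIntegral_mono' measurableSet_Ioo fun s hs => ?_
    gcongr
    have : MpE p s (dilateF f ρ) = MpE p (ρ * s) f := by
      simp only [MpE, dilateF, circlePt_mul]
    rw [this]
    exact MpE_mono hp hf.1 (mul_nonneg hρ.1.le hs.1.le)
      (mul_le_of_le_one_left hs.1.le hρ.2.le) hs.2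
  rw [norm_sub_rev, ← functional_sub hL hdil hsub]
  exact hM _ hsub

end Functional

/-! ### Test functions -/

lemma integral_norm_inv_one_sub_sq {ζ : ℂ} (hζ : ‖ζ‖ < 1) :
    ∫ θ, ‖(1 - ζ * circlePt 1 θ)⁻¹‖ ^ 2 ∂arcMeasure = (1 - ‖ζ‖ ^ 2)⁻¹ := by
  have hs : Summable fun n : ℕ => ‖ζ ^ n‖ := by
    simpa only [norm_pow] using summable_geometric_of_lt_one (norm_nonneg _) hζ
  have h := integral_norm_sq_tsum hs
  have e : ∀ θ, ∑' n : ℕ, ζ ^ n * circlePt 1 θ ^ n = (1 - ζ * circlePt 1 θ)⁻¹ := fun θ => by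
    simp_rw [← mul_pow]
    refine tsum_geometric_of_norm_lt_one ?_
    rw [norm_mul, norm_circlePt zero_le_one, mul_one]
    exact hζ
  simp_rw [e] at h
  rw [h]
  simp_rw [norm_pow, ← pow_mul, mul_comm _ 2, pow_mul]
  exact tsum_geometric_of_lt_one (sq_nonneg _) (by nlinarith [norm_nonneg ζ])

lemma one_sub_mul_circlePt_ne_zero {ζ : ℂ} (hζ : ‖ζ‖ < 1) (θ : ℝ) :
    1 - ζ * circlePt 1 θ ≠ 0 := by
  intro h
  have h1 : ζ * circlePt 1 θ = 1 := (sub_eq_zero.1 h).symm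
  have h2 := congrArg norm h1
  rw [norm_mul, norm_circlePt zero_le_one, mul_one, norm_one] at h2
  exact hζ.ne h2

lemma continuous_inv_one_sub_mul_circlePt {ζ : ℂ} (hζ : ‖ζ‖ < 1) :
    Continuous fun θ => (1 - ζ * circlePt 1 θ)⁻¹ :=
  (continuous_const.sub (continuous_const.mul (continuous_circlePt_right 1))).inv₀
    (one_sub_mul_circlePt_ne_zero hζ)

lemma MpE_kernel_le {p : ℝ} (hp : 0 < p) {m : ℕ} (hm : 2 ≤ m * p) {ζ : ℂ} (hζ : ‖ζ‖ < 1)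
    {r : ℝ} (hr : r ∈ Ioo (0:ℝ) 1) :
    MpE p r (fun w => w * (1 / (1 - ζ * w) ^ m)) ≤
      ENNReal.ofReal ((1 - ‖ζ‖ * r) ^ (1 / p - m)) := by
  have hx : ‖ζ * (r:ℂ)‖ = ‖ζ‖ * r := by rw [norm_mul, Complex.norm_of_nonneg hr.1.le]
  have hx1 : ‖ζ * (r:ℂ)‖ < 1 := by rw [hx]; nlinarith [hr.1, hr.2, norm_nonneg ζ]
  set x := ‖ζ‖ * r with hxd
  have hx0 : 0 ≤ x := mul_nonneg (norm_nonneg _) hr.1.le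
  have h1x : 0 < 1 - x := by linarith
  have hpt : ∀ θ, ‖circlePt r θ * (1 / (1 - ζ * circlePt r θ) ^ m)‖ ^ p ≤
      (1 - x) ^ (2 - m * p) * ‖(1 - ζ * (r:ℂ) * circlePt 1 θ)⁻¹‖ ^ 2 := by
    intro θ
    have hcz : ζ * circlePt r θ = ζ * (r:ℂ) * circlePt 1 θ := by
      rw [circlePt_eq_mul, mul_assoc]
    have hn0 : 0 < ‖1 - ζ * (r:ℂ) * circlePt 1 θ‖ :=
      norm_pos_iff.2 (one_sub_mul_circlePt_ne_zero hx1 θ)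
    have hge : 1 - x ≤ ‖1 - ζ * (r:ℂ) * circlePt 1 θ‖ := by
      have := norm_sub_norm_le (1:ℂ) (ζ * (r:ℂ) * circlePt 1 θ)
      rw [norm_mul, norm_circlePt zero_le_one, hx, norm_one] at this
      linarith
    rw [hcz]
    set d := ‖1 - ζ * (r:ℂ) * circlePt 1 θ‖ with hd
    have e1 : ‖circlePt r θ * (1 / (1 - ζ * (r:ℂ) * circlePt 1 θ) ^ m)‖ ≤ d ^ (-(m:ℝ)) := by
      rw [norm_mul, norm_circlePt hr.1.le, norm_div, norm_one, norm_pow, ← hd,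
        Real.rpow_neg hn0.le, Real.rpow_natCast, one_div]
      exact mul_le_of_le_one_left (by positivity) hr.2.le
    calc _ ≤ (d ^ (-(m:ℝ))) ^ p := Real.rpow_le_rpow (norm_nonneg _) e1 hp.le
      _ = d ^ (2 - m * p) * d ^ (-(2:ℝ)) := by
          rw [← Real.rpow_mul hn0.le, ← Real.rpow_add hn0]; congr 1; ring
      _ ≤ (1 - x) ^ (2 - m * p) * d ^ (-(2:ℝ)) := by
          exact mul_le_mul_of_nonneg_right
            (Real.rpow_le_rpow_of_nonpos h1x hge (by linarith)) (by positivity)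
      _ = _ := by
          rw [norm_inv, ← hd, Real.rpow_neg hn0.le, inv_pow]
          norm_num
  rw [MpE_eq]
  have hint : ∫⁻ θ, ENNReal.ofReal (‖circlePt r θ * (1 / (1 - ζ * circlePt r θ) ^ m)‖ ^ p)
      ∂arcMeasure ≤ ENNReal.ofReal ((1 - x) ^ (1 - m * p)) := by
    have hcont : Continuous fun θ => (1 - x) ^ (2 - m * p) *
        ‖(1 - ζ * (r:ℂ) * circlePt 1 θ)⁻¹‖ ^ 2 :=
      continuous_const.mul ((continuous_inv_one_sub_mul_circlePt hx1).norm.pow 2)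
    calc _ ≤ ∫⁻ θ, ENNReal.ofReal ((1 - x) ^ (2 - m * p) *
        ‖(1 - ζ * (r:ℂ) * circlePt 1 θ)⁻¹‖ ^ 2) ∂arcMeasure :=
          lintegral_mono fun θ => ENNReal.ofReal_le_ofReal (hpt θ)
      _ = ENNReal.ofReal ((1 - x) ^ (2 - m * p) * (1 - x ^ 2)⁻¹) := by
          rw [← ofReal_integral_eq_lintegral_ofReal hcont.integrable_arcMeasure
            (Eventually.of_forall fun θ => by positivity), integral_const_mul,
            integral_norm_inv_one_sub_sq hx1, hx]
      _ ≤ _ := by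
          refine ENNReal.ofReal_le_ofReal ?_
          have : (1 - x) ^ (1 - m * p) = (1 - x) ^ (2 - m * p) * (1 - x)⁻¹ := by
            rw [← Real.rpow_neg_one, ← Real.rpow_add h1x]; congr 1; ring
          rw [this]
          gcongr
          nlinarith
  refine (ENNReal.rpow_le_rpow hint (by positivity)).trans (le_of_eq ?_)
  rw [ENNReal.ofReal_rpow_of_nonneg (by positivity) (by positivity), ← Real.rpow_mul h1x.le]
  congr 2
  field_simp

lemma LpqNormE_kernel_le {ω : ℝ → ℝ} (hω : IsRadialWeight ω) {C : ℝ} (hC1 : 1 ≤ C)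
    (hC : ∀ r ∈ Ico (0:ℝ) 1, omegaHat ω r ≤ C * omegaHat ω ((1 + r) / 2)) {p q : ℝ}
    (hp : 0 < p) (hq : 0 < q) {m : ℕ} (hm : 2 ≤ m * p)
    (hmC : 2 ^ (-(q * (m - 1 / p))) * C ≤ 1 / 2) {ζ : ℂ} (hζ : ‖ζ‖ < 1) :
    LpqNormE ω p q (fun w => w * (1 / (1 - ζ * w) ^ m)) ≤
      ENNReal.ofReal ((3 * C) ^ (1 / q) * ((1 - ‖ζ‖) ^ (1 / p - m) *
        omegaHat ω ‖ζ‖ ^ (1 / q))) := by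
  have hmp : 0 ≤ (m:ℝ) - 1 / p := by
    rw [sub_nonneg, div_le_iff₀ hp]; linarith
  have hl0 : 0 ≤ q * (m - 1 / p) := by positivity
  have h1 : 0 < 1 - ‖ζ‖ := by linarith
  have hW := omegaHat_nonneg hω (a := ‖ζ‖) ⟨norm_nonneg _, hζ.le⟩
  have hx : ∀ r ∈ Ioo (0:ℝ) 1, 0 < 1 - ‖ζ‖ * r := fun r hr => by
    nlinarith [hr.1, hr.2, norm_nonneg ζ]
  have hii : IntegrableOn (fun r => (1 - ‖ζ‖ * r) ^ (-(q * (m - 1 / p))) * ω r) (Ioo 0 1) := by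
    have := intervalIntegrable_mul_one_sub_rpow hω (l := -(q * (m - 1 / p))) (norm_nonneg ζ)
      le_rfl zero_le_one le_rfl (by linarith)
    rwa [intervalIntegrable_iff_integrableOn_Ioo_of_le zero_le_one] at this
  have key : ∫⁻ r in Ioo (0:ℝ) 1, MpE p r (fun w => w * (1 / (1 - ζ * w) ^ m)) ^ q *
      ENNReal.ofReal (r * ω r) ≤
      ENNReal.ofReal (3 * C * ((1 - ‖ζ‖) ^ (-(q * (m - 1 / p))) * omegaHat ω ‖ζ‖)) := by
    calc _ ≤ ∫⁻ r in Ioo (0:ℝ) 1,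
          ENNReal.ofReal ((1 - ‖ζ‖ * r) ^ (-(q * (m - 1 / p))) * ω r) := by
          refine setLIntegral_mono' measurableSet_Ioo fun r hr => ?_
          have h0 := hω.nonneg_Ioo r hr
          have h2 := hx r hr
          rw [ENNReal.ofReal_mul (p := (1 - ‖ζ‖ * r) ^ (-(q * (m - 1 / p)))) (by positivity)]
          gcongr
          · refine (ENNReal.rpow_le_rpow (MpE_kernel_le hp hm hζ hr) hq.le).trans (le_of_eq ?_)
            rw [ENNReal.ofReal_rpow_of_nonneg (by positivity) hq.le, ← Real.rpow_mul h2.le]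
            congr 2
            ring
          · exact mul_le_of_le_one_left h0 hr.2.le
      _ = ENNReal.ofReal (∫ r in (0:ℝ)..1, (1 - ‖ζ‖ * r) ^ (-(q * (m - 1 / p))) * ω r) := by
          rw [intervalIntegral.integral_of_le zero_le_one, integral_Ioc_eq_integral_Ioo,
            ofReal_integral_eq_lintegral_ofReal hii]
          filter_upwards [ae_restrict_mem measurableSet_Ioo] with r hr
          exact mul_nonneg (Real.rpow_nonneg (hx r hr).le _) (hω.nonneg_Ioo r hr)
      _ ≤ _ := ENNReal.ofReal_le_ofReal
          (integral_one_sub_mul_rpow_le hω hC1 hC hl0 hmC (norm_nonneg _) hζ)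
  rw [LpqNormE]
  refine (ENNReal.rpow_le_rpow key (by positivity)).trans (le_of_eq ?_)
  rw [ENNReal.ofReal_rpow_of_nonneg (by positivity) (by positivity),
    Real.mul_rpow (by positivity) (by positivity), Real.mul_rpow (by positivity) hW,
    ← Real.rpow_mul h1.le]
  congr 4
  field_simp
  ring

lemma norm_tsum_choose_functional_le {ω : ℝ → ℝ} (hω : IsRadialWeight ω) {C : ℝ} (hC1 : 1 ≤ C)
    (hC : ∀ r ∈ Ico (0:ℝ) 1, omegaHat ω r ≤ C * omegaHat ω ((1 + r) / 2)) {p q M : ℝ}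
    (hp : 0 < p) (hq : 0 < q) {k : ℕ} (hm : 2 ≤ (k + 1 : ℕ) * p)
    (hmC : 2 ^ (-(q * ((k + 1 : ℕ) - 1 / p))) * C ≤ 1 / 2) {L : (ℂ → ℂ) → ℂ} (hM0 : 0 ≤ M)
    (hL : IsLinearOn (InApq ω p q) L)
    (hM : ∀ f : ℂ → ℂ, InApq ω p q f → ‖L f‖ ≤ M * (LpqNormE ω p q f).toReal) {ζ : ℂ}
    (hζ : ‖ζ‖ < 1) :
    ‖∑' n : ℕ, ((n + k).choose k : ℂ) * L (fun z => z ^ (n + 1)) * ζ ^ n‖ ≤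
      M * ((3 * C) ^ (1 / q) * ((1 - ‖ζ‖) ^ (1 / p - (k + 1 : ℕ)) *
        omegaHat ω ‖ζ‖ ^ (1 / q))) := by
  have h1 : 0 < 1 - ‖ζ‖ := by linarith
  have hW := omegaHat_nonneg hω (a := ‖ζ‖) ⟨norm_nonneg _, hζ.le⟩
  set a : ℕ → ℂ := fun n => Nat.casesOn n 0 fun n => ((n + k).choose k : ℂ) * ζ ^ n with ha
  have a0 : a 0 = 0 := rfl
  have a1 : ∀ n, a (n + 1) = ((n + k).choose k : ℂ) * ζ ^ n := fun n => rfl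
  have has : Summable fun n => ‖a n‖ := by
    rw [← summable_nat_add_iff 1]
    exact (hasSum_choose_mul_geometric_of_norm_lt_one k hζ).summable.norm
  have hf : ∀ z : ℂ, ‖z‖ < 1 →
      HasSum (fun n => a n * z ^ n) (z * (1 / (1 - ζ * z) ^ (k + 1))) := by
    intro z hz
    rw [← hasSum_nat_add_iff' 1]
    have hζz : ‖ζ * z‖ < 1 := by
      rw [norm_mul]; nlinarith [norm_nonneg z, norm_nonneg ζ]
    have := (hasSum_choose_mul_geometric_of_norm_lt_one k hζz).mul_left z
    rw [Finset.sum_range_one, a0, zero_mul, sub_zero]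
    refine this.congr_fun fun n => ?_
    rw [a1, mul_pow]
    ring
  obtain ⟨hA, hsum⟩ := hasSum_functional hω hp hq hM0 hL hM has hf
  have e : ∑' n : ℕ, ((n + k).choose k : ℂ) * L (fun z => z ^ (n + 1)) * ζ ^ n =
      L (fun z => z * (1 / (1 - ζ * z) ^ (k + 1))) := by
    rw [← hasSum_nat_add_iff' 1] at hsum
    rw [Finset.sum_range_one, a0, zero_mul, sub_zero] at hsum
    rw [← hsum.tsum_eq]
    exact tsum_congr fun n => by rw [a1]; ring
  rw [e]
  refine (hM _ hA).trans ?_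
  gcongr
  exact ENNReal.toReal_le_of_le_ofReal (by positivity)
    (LpqNormE_kernel_le hω hC1 hC hp hq hm hmC hζ)

/-! ### The multiplier `(n + 1) / c (n + 1)` -/

lemma succ_div_sub_div_mem_Icc {c : ℕ → ℝ} {K : ℝ} (hc0 : ∀ n, 0 < c n)
    (hanti : ∀ n, c (n + 1) ≤ c n) (hK : ∀ n : ℕ, n * (c n - c (n + 1)) ≤ K * c n) (n : ℕ) :
    ((n:ℝ) + 1) / c (n + 1) - n / c n ∈ Icc 0 ((1 + K) / c (n + 1)) := by
  have h0 := hc0 n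
  have h1 := hc0 (n + 1)
  have e : ((n:ℝ) + 1) / c (n + 1) - n / c n =
      (1 + n * (c n - c (n + 1)) / c n) / c (n + 1) := by
    field_simp
    ring
  rw [e]
  have h2 : 0 ≤ n * (c n - c (n + 1)) / c n :=
    div_nonneg (mul_nonneg n.cast_nonneg (sub_nonneg.2 (hanti n))) h0.le
  have h3 : n * (c n - c (n + 1)) / c n ≤ K := (div_le_iff₀ h0).2 (hK n)
  exact ⟨by positivity, by gcongr⟩

lemma one_sub_mul_tsum_succ_div {c : ℕ → ℝ} {x : ℝ} {w : ℂ}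
    (hs : Summable fun n : ℕ => (((((n:ℝ) + 1) / c (n + 1) * x ^ n : ℝ)) : ℂ) * w ^ n) :
    (1 - x * w) * ∑' n : ℕ, (((((n:ℝ) + 1) / c (n + 1) * x ^ n : ℝ)) : ℂ) * w ^ n =
      ∑' n : ℕ, ((((((n:ℝ) + 1) / c (n + 1) - n / c n) * x ^ n : ℝ)) : ℂ) * w ^ n := by
  have h1 := hs.hasSum
  have h2 : HasSum (fun n : ℕ => (((n:ℝ) / c n * x ^ n : ℝ) : ℂ) * w ^ n)
      (x * w * ∑' n : ℕ, (((((n:ℝ) + 1) / c (n + 1) * x ^ n : ℝ)) : ℂ) * w ^ n) := by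
    rw [← hasSum_nat_add_iff' 1]
    simp only [Finset.range_one, Finset.sum_singleton, Nat.cast_zero, zero_div, zero_mul,
      Complex.ofReal_zero, sub_zero]
    refine (h1.mul_left ((x:ℂ) * w)).congr_fun fun n => ?_
    push_cast
    ring
  rw [sub_mul, one_mul]
  refine ((h1.sub h2).congr_fun fun n => ?_).tsum_eq.symm
  push_cast
  ring

lemma summable_succ_div_mul_pow {c : ℕ → ℝ} (hc0 : ∀ n, 0 < c n) {x t H : ℝ} (hx : 0 ≤ x)
    (ht0 : 0 ≤ t) (ht1 : t < 1) (hH : ∀ n, x ^ n / c (n + 1) ≤ H * t ^ n) :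
    Summable fun n : ℕ => ((n:ℝ) + 1) / c (n + 1) * x ^ n := by
  have h1 : Summable fun n : ℕ => (n:ℝ) * t ^ n := by
    simpa using summable_pow_mul_geometric_of_norm_lt_one (R := ℝ) 1
      (r := t) (by rwa [Real.norm_of_nonneg ht0])
  have h2 : Summable fun n : ℕ => H * ((n:ℝ) * t ^ n + t ^ n) :=
    (h1.add (summable_geometric_of_lt_one ht0 ht1)).mul_left H
  refine h2.of_nonneg_of_le (fun n => ?_) fun n => ?_
  · have := hc0 (n + 1)
    positivity
  · calc ((n:ℝ) + 1) / c (n + 1) * x ^ n = ((n:ℝ) + 1) * (x ^ n / c (n + 1)) := by ring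
      _ ≤ ((n:ℝ) + 1) * (H * t ^ n) := by gcongr; exact hH n
      _ = _ := by ring

lemma integral_norm_tsum_succ_div_le {c : ℕ → ℝ} {K : ℝ} (hc0 : ∀ n, 0 < c n)
    (hanti : ∀ n, c (n + 1) ≤ c n) (hK0 : 0 < K)
    (hK : ∀ n : ℕ, n * (c n - c (n + 1)) ≤ K * c n) {x t H : ℝ} (hx : x ∈ Ico (0:ℝ) 1)
    (ht0 : 0 ≤ t) (ht1 : t < 1) (hxt : (1 - t ^ 2)⁻¹ ≤ 8 / (1 - x)) (hH0 : 0 < H)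
    (hH : ∀ n, x ^ n / c (n + 1) ≤ H * t ^ n) :
    ∫ θ, ‖∑' n : ℕ, (((((n:ℝ) + 1) / c (n + 1) * x ^ n : ℝ)) : ℂ) * circlePt 1 θ ^ n‖
      ∂arcMeasure ≤ (4 * (1 + K) ^ 2 + 1) * (H / (1 - x)) := by
  obtain ⟨hx0, hx1⟩ := hx
  have h1x : 0 < 1 - x := by linarith
  set α : ℕ → ℂ := fun n => (((((n:ℝ) + 1) / c (n + 1) * x ^ n : ℝ)) : ℂ) with hα
  set d : ℕ → ℂ := fun n =>
    ((((((n:ℝ) + 1) / c (n + 1) - n / c n) * x ^ n : ℝ)) : ℂ) with hd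
  have hαs : Summable fun n => ‖α n‖ := by
    simpa only [hα, Complex.norm_real] using
      (summable_succ_div_mul_pow hc0 hx0 ht0 ht1 hH).norm
  have hdle : ∀ n, ‖d n‖ ≤ (1 + K) * H * t ^ n := fun n => by
    have h := succ_div_sub_div_mem_Icc hc0 hanti hK n
    rw [hd, Complex.norm_real, Real.norm_of_nonneg (mul_nonneg h.1 (by positivity))]
    calc _ ≤ (1 + K) / c (n + 1) * x ^ n := by gcongr; exact h.2
      _ = (1 + K) * (x ^ n / c (n + 1)) := by ring
      _ ≤ (1 + K) * (H * t ^ n) := by gcongr; exact hH n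
      _ = _ := by ring
  have hds : Summable fun n => ‖d n‖ :=
    ((summable_geometric_of_lt_one ht0 ht1).mul_left _).of_nonneg_of_le
      (fun _ => norm_nonneg _) hdle
  have ht2 : t ^ 2 < 1 := by nlinarith
  have hS : ∫ θ, ‖∑' n, d n * circlePt 1 θ ^ n‖ ^ 2 ∂arcMeasure ≤
      ((1 + K) * H) ^ 2 * (8 / (1 - x)) := by
    rw [integral_norm_sq_tsum hds]
    have hg : HasSum (fun n : ℕ => ((1 + K) * H) ^ 2 * (t ^ 2) ^ n)
        (((1 + K) * H) ^ 2 * (1 - t ^ 2)⁻¹) :=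
      (hasSum_geometric_of_lt_one (sq_nonneg t) ht2).mul_left _
    have hle : ∀ n, ‖d n‖ ^ 2 ≤ ((1 + K) * H) ^ 2 * (t ^ 2) ^ n := fun n => by
      refine (pow_le_pow_left₀ (norm_nonneg _) (hdle n) 2).trans (le_of_eq ?_)
      ring
    calc _ ≤ ((1 + K) * H) ^ 2 * (1 - t ^ 2)⁻¹ := by
          rw [← hg.tsum_eq]
          exact (hg.summable.of_nonneg_of_le (fun _ => sq_nonneg _) hle).tsum_le_tsum hle
            hg.summable
      _ ≤ _ := by gcongr
  have hxn : ‖(x:ℂ)‖ = x := Complex.norm_of_nonneg hx0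
  have hxl : ‖(x:ℂ)‖ < 1 := by rwa [hxn]
  have hT : ∫ θ, ‖(1 - (x:ℂ) * circlePt 1 θ)⁻¹‖ ^ 2 ∂arcMeasure ≤ 1 / (1 - x) := by
    rw [integral_norm_inv_one_sub_sq hxl, hxn, ← one_div]
    gcongr
    nlinarith
  have hpt : ∀ θ, ‖∑' n, α n * circlePt 1 θ ^ n‖ ≤
      1 / (2 * H) * ‖∑' n, d n * circlePt 1 θ ^ n‖ ^ 2 +
        H / 2 * ‖(1 - (x:ℂ) * circlePt 1 θ)⁻¹‖ ^ 2 := by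
    intro θ
    have hne := one_sub_mul_circlePt_ne_zero hxl θ
    have e : ∑' n, α n * circlePt 1 θ ^ n =
        (∑' n, d n * circlePt 1 θ ^ n) * (1 - (x:ℂ) * circlePt 1 θ)⁻¹ := by
      rw [eq_mul_inv_iff_mul_eq₀ hne, mul_comm]
      exact one_sub_mul_tsum_succ_div
        (summable_mul_pow_of_norm hαs (norm_circlePt zero_le_one θ).le).of_norm
    rw [e, norm_mul]
    set u := ‖∑' n, d n * circlePt 1 θ ^ n‖
    set v := ‖(1 - (x:ℂ) * circlePt 1 θ)⁻¹‖
    have : 1 / (2 * H) * u ^ 2 + H / 2 * v ^ 2 - u * v = (u - H * v) ^ 2 / (2 * H) := by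
      field_simp
      ring
    have : 0 ≤ (u - H * v) ^ 2 / (2 * H) := by positivity
    linarith
  have i1 : Integrable (fun θ => 1 / (2 * H) * ‖∑' n, d n * circlePt 1 θ ^ n‖ ^ 2) arcMeasure :=
    (continuous_const.mul ((continuous_tsum_circlePt hds).norm.pow 2)).integrable_arcMeasure
  have i2 : Integrable (fun θ => H / 2 * ‖(1 - (x:ℂ) * circlePt 1 θ)⁻¹‖ ^ 2) arcMeasure :=
    (continuous_const.mul
      ((continuous_inv_one_sub_mul_circlePt hxl).norm.pow 2)).integrable_arcMeasure
  calc _ ≤ ∫ θ, (1 / (2 * H) * ‖∑' n, d n * circlePt 1 θ ^ n‖ ^ 2 +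
        H / 2 * ‖(1 - (x:ℂ) * circlePt 1 θ)⁻¹‖ ^ 2) ∂arcMeasure :=
        integral_mono (continuous_tsum_circlePt hαs).norm.integrable_arcMeasure (i1.add i2) hpt
    _ ≤ 1 / (2 * H) * (((1 + K) * H) ^ 2 * (8 / (1 - x))) + H / 2 * (1 / (1 - x)) := by
        rw [integral_add i1 i2, integral_const_mul, integral_const_mul]
        gcongr
    _ = (4 * (1 + K) ^ 2 + 1 / 2) * (H / (1 - x)) := by
        field_simp
        ring
    _ ≤ _ := by
        gcongr
        norm_num

lemma exists_pow_div_le {ω : ℝ → ℝ}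
    (hpos : ∀ r ∈ Ico (0:ℝ) 1, 0 < omegaHat ω r) {C : ℝ} (hC1 : 1 ≤ C)
    (hC : ∀ r ∈ Ico (0:ℝ) 1, omegaHat ω r ≤ C * omegaHat ω ((1 + r) / 2)) {a κ c₀ : ℝ}
    (ha : 0 ≤ a) (hc₀ : 0 < c₀) {c : ℕ → ℝ} (hc0 : ∀ n, 0 < c n)
    (hc : ∀ x ∈ Ico (0:ℝ) 1, ∀ n : ℕ,
      c₀ * (x ^ (4 * n + 1) * (omegaHat ω x ^ (1 + a) * (1 - x) ^ κ)) ≤ c n) :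
    ∃ A > 0, ∀ x ∈ Ico (0:ℝ) 1, ∀ n : ℕ, x ^ n / c (n + 1) ≤
      A / (omegaHat ω x ^ (1 + a) * (1 - x) ^ κ) * ((1 - (1 - x) / 8) ^ 4) ^ n := by
  refine ⟨2 * (C ^ 3) ^ (1 + a) * 8 ^ κ / c₀, by positivity, fun x hx n => ?_⟩
  obtain ⟨hx0, hx1⟩ := hx
  set y := 1 - (1 - x) / 8 with hy
  have hy0 : 7 / 8 ≤ y := by rw [hy]; linarith
  have hy1 : y < 1 := by rw [hy]; linarith
  have hyp : 0 < y := by linarith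
  have h1x : 0 < 1 - x := by linarith
  have hWx := hpos x ⟨hx0, hx1⟩
  have hWy := hpos y ⟨hyp.le, hy1⟩
  have hW : omegaHat ω x ≤ C ^ 3 * omegaHat ω y := by
    have h1 := hC x ⟨hx0, hx1⟩
    have h2 := hC ((1 + x) / 2) ⟨by linarith, by linarith⟩
    have h3 := hC ((1 + (1 + x) / 2) / 2) ⟨by linarith, by linarith⟩
    have e : (1 + (1 + (1 + x) / 2) / 2) / 2 = y := by rw [hy]; ring
    rw [e] at h3
    calc _ ≤ C * (C * (C * omegaHat ω y)) := by
          refine h1.trans ?_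
          gcongr
          refine h2.trans ?_
          gcongr
      _ = _ := by ring
  have hxy : x ≤ y ^ 8 := by
    have := one_add_mul_le_pow (a := -(1 - x) / 8) (by linarith) 8
    have e : 1 + -(1 - x) / 8 = y := by rw [hy]; ring
    rw [e] at this
    push_cast at this
    linarith
  have h1y : (1 - x) ^ κ = 8 ^ κ * (1 - y) ^ κ := by
    rw [← Real.mul_rpow (by norm_num) (by linarith)]
    congr 1
    rw [hy]; ring
  have hc' := hc y ⟨hyp.le, hy1⟩ (n + 1)
  have hG : omegaHat ω x ^ (1 + a) * (1 - x) ^ κ ≤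
      (C ^ 3) ^ (1 + a) * 8 ^ κ * (omegaHat ω y ^ (1 + a) * (1 - y) ^ κ) := by
    have h1 : omegaHat ω x ^ (1 + a) ≤ (C ^ 3) ^ (1 + a) * omegaHat ω y ^ (1 + a) := by
      rw [← Real.mul_rpow (by positivity) hWy.le]
      gcongr
    rw [h1y]
    have h1y0 : 0 ≤ 1 - y := by linarith
    calc _ ≤ (C ^ 3) ^ (1 + a) * omegaHat ω y ^ (1 + a) * (8 ^ κ * (1 - y) ^ κ) := by
          gcongr
      _ = _ := by ring
  set G := omegaHat ω x ^ (1 + a) * (1 - x) ^ κ with hGd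
  have hG0 : 0 < G := by positivity
  set G' := omegaHat ω y ^ (1 + a) * (1 - y) ^ κ with hGd'
  have hy5 : 1 ≤ 2 * y ^ 5 := by
    have : (7 / 8 : ℝ) ^ 5 ≤ y ^ 5 := by gcongr
    norm_num at this ⊢
    linarith
  have hxn : x ^ n ≤ y ^ (8 * n) := by
    rw [pow_mul]; gcongr
  rw [div_mul_eq_mul_div, div_le_div_iff₀ (hc0 _) hG0]
  set B := (C ^ 3) ^ (1 + a) * 8 ^ κ with hB
  have hB0 : 0 < B := by positivity
  have hG'0 : 0 < G' := by
    have : 0 < 1 - y := by linarith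
    positivity
  calc x ^ n * G ≤ y ^ (8 * n) * (B * G') := by gcongr
    _ ≤ 2 * y ^ 5 * (y ^ (8 * n) * (B * G')) :=
        le_mul_of_one_le_left (by positivity) hy5
    _ = 2 * B / c₀ * (y ^ 4) ^ n * (c₀ * (y ^ (4 * (n + 1) + 1) * G')) := by
        field_simp
        ring_nf
    _ ≤ 2 * B / c₀ * (y ^ 4) ^ n * c (n + 1) := by gcongr
    _ = _ := by rw [hB]; ring

/-! ### Fractional integration of power series -/

lemma summable_choose_mul_pow {v : ℕ → ℂ}
    (hv : ∀ x ∈ Ico (0:ℝ) 1, Summable fun n => ‖v n‖ * x ^ n) (j : ℕ) {x : ℝ}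
    (hx : x ∈ Ico (0:ℝ) 1) : Summable fun n => ((n + j).choose j : ℝ) * (‖v n‖ * x ^ n) := by
  obtain ⟨hx0, hx1⟩ := hx
  set ρ := (1 + x) / 2 with hρ
  have hρ0 : 0 < ρ := by rw [hρ]; linarith
  have hρ1 : ρ < 1 := by rw [hρ]; linarith
  obtain ⟨B, hB⟩ := (hv ρ ⟨hρ0.le, hρ1⟩).tendsto_atTop_zero.bddAbove_range
  have ht1 : x / ρ < 1 := by rw [div_lt_one hρ0, hρ]; linarith
  have ht0 : 0 ≤ x / ρ := by positivity
  have hg := summable_choose_mul_geometric_of_norm_lt_one j (r := x / ρ)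
    (by rwa [Real.norm_of_nonneg ht0])
  refine (hg.mul_left B).of_nonneg_of_le (fun n => by positivity) fun n => ?_
  have hBn : ‖v n‖ * ρ ^ n ≤ B := hB ⟨n, rfl⟩
  calc _ = (‖v n‖ * ρ ^ n) * (((n + j).choose j : ℝ) * (x / ρ) ^ n) := by
        have e : x ^ n = ρ ^ n * (x / ρ) ^ n := by rw [← mul_pow, mul_div_cancel₀ _ hρ0.ne']
        rw [e]
        ring
    _ ≤ _ := by gcongr

lemma hasSum_choose_mul_integral {v : ℕ → ℂ}
    (hv : ∀ x ∈ Ico (0:ℝ) 1, Summable fun n => ‖v n‖ * x ^ n) (j : ℕ) {ζ : ℂ} (hζ : ‖ζ‖ < 1) :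
    HasSum (fun n => ((n + j).choose j : ℂ) * v n * ζ ^ n)
      (∫ t in (0:ℝ)..1, ((j:ℂ) + 1) * (t:ℂ) ^ j *
        ∑' n, ((n + (j + 1)).choose (j + 1) : ℂ) * v n * ((t:ℂ) * ζ) ^ n) := by
  have hs := (summable_choose_mul_pow hv (j + 1) ⟨norm_nonneg ζ, hζ⟩).mul_left ((j:ℝ) + 1)
  have hnorm : ∀ n, ∀ t ∈ Icc (0:ℝ) 1,
      ‖((n + (j + 1)).choose (j + 1) : ℂ) * v n * ((t:ℂ) * ζ) ^ n‖ ≤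
        ((n + (j + 1)).choose (j + 1) : ℝ) * (‖v n‖ * ‖ζ‖ ^ n) := fun n t ht => by
    rw [norm_mul, norm_mul, Complex.norm_natCast, norm_pow, norm_mul,
      Complex.norm_of_nonneg ht.1, mul_assoc]
    have ht0 := ht.1
    gcongr
    exact mul_le_of_le_one_left (norm_nonneg ζ) ht.2
  have key : HasSum (fun n => ∫ t in (0:ℝ)..1, ((j:ℂ) + 1) * (t:ℂ) ^ j *
        (((n + (j + 1)).choose (j + 1) : ℂ) * v n * ((t:ℂ) * ζ) ^ n))
      (∫ t in (0:ℝ)..1, ((j:ℂ) + 1) * (t:ℂ) ^ j *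
        ∑' n, ((n + (j + 1)).choose (j + 1) : ℂ) * v n * ((t:ℂ) * ζ) ^ n) := by
    refine intervalIntegral.hasSum_integral_of_dominated_convergence
      (fun n _ => ((j:ℝ) + 1) * (((n + (j + 1)).choose (j + 1) : ℝ) * (‖v n‖ * ‖ζ‖ ^ n)))
      (fun n => (Continuous.aestronglyMeasurable (by fun_prop))) (fun n => ?_)
      (Eventually.of_forall fun _ _ => hs) intervalIntegrable_const
      (Eventually.of_forall fun t ht => ?_)
    · refine Eventually.of_forall fun t ht => ?_
      rw [uIoc_of_le zero_le_one] at ht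
      have e : ‖(j:ℂ) + 1‖ = (j:ℝ) + 1 := by
        rw [← Nat.cast_add_one, Complex.norm_natCast, Nat.cast_add_one]
      rw [norm_mul, norm_mul, norm_pow, Complex.norm_of_nonneg ht.1.le, e]
      refine mul_le_mul ?_ (hnorm n t ⟨ht.1.le, ht.2⟩) (norm_nonneg _) (by positivity)
      exact mul_le_of_le_one_right (by positivity) (pow_le_one₀ ht.1.le ht.2)
    · rw [uIoc_of_le zero_le_one] at ht
      refine HasSum.mul_left _ (Summable.hasSum ?_)
      exact .of_norm_bounded (summable_choose_mul_pow hv (j + 1) ⟨norm_nonneg ζ, hζ⟩)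
        fun n => hnorm n t ⟨ht.1.le, ht.2⟩
  refine key.congr_fun fun n => ?_
  have e1 : ∀ t : ℝ, ((j:ℂ) + 1) * (t:ℂ) ^ j *
      (((n + (j + 1)).choose (j + 1) : ℂ) * v n * ((t:ℂ) * ζ) ^ n) =
      ((t ^ (n + j) : ℝ) : ℂ) *
        (((j:ℂ) + 1) * ((n + (j + 1)).choose (j + 1) : ℂ) * v n * ζ ^ n) := fun t => by
    push_cast
    ring
  simp_rw [e1]
  rw [intervalIntegral.integral_mul_const, intervalIntegral.integral_ofReal, integral_pow]
  have hch : ((n:ℂ) + j + 1) * ((n + j).choose j : ℂ) =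
      ((n + (j + 1)).choose (j + 1) : ℂ) * ((j:ℂ) + 1) := by
    exact_mod_cast Nat.add_one_mul_choose_eq (n + j) j
  have hne : (n:ℂ) + j + 1 ≠ 0 := by exact_mod_cast Nat.succ_ne_zero (n + j)
  rw [mul_comm ((j:ℂ) + 1), ← hch]
  push_cast
  rw [one_pow, zero_pow (Nat.succ_ne_zero _), sub_zero]
  field_simp

lemma integral_pow_div_one_sub_mul_pow (j : ℕ) {ρ : ℝ} (hρ : ρ ∈ Ico (0:ℝ) 1) :
    IntervalIntegrable (fun t : ℝ => ((j:ℝ) + 1) * t ^ j / (1 - t * ρ) ^ (j + 2)) volume 0 1 ∧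
    ∫ t in (0:ℝ)..1, ((j:ℝ) + 1) * t ^ j / (1 - t * ρ) ^ (j + 2) = 1 / (1 - ρ) ^ (j + 1) := by
  have hne : ∀ t ∈ uIcc (0:ℝ) 1, 1 - t * ρ ≠ 0 := fun t ht => by
    rw [uIcc_of_le zero_le_one] at ht
    nlinarith [ht.1, ht.2, hρ.1, hρ.2]
  have hint : IntervalIntegrable (fun t : ℝ => ((j:ℝ) + 1) * t ^ j / (1 - t * ρ) ^ (j + 2))
      volume 0 1 := by
    refine ContinuousOn.intervalIntegrable (ContinuousOn.div (by fun_prop) (by fun_prop) ?_)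
    exact fun t ht => pow_ne_zero _ (hne t ht)
  refine ⟨hint, ?_⟩
  have hd : ∀ t ∈ uIcc (0:ℝ) 1, HasDerivAt (fun t : ℝ => t ^ (j + 1) / (1 - t * ρ) ^ (j + 1))
      (((j:ℝ) + 1) * t ^ j / (1 - t * ρ) ^ (j + 2)) t := fun t ht => by
    have h0 := hne t ht
    have h1 : HasDerivAt (fun t : ℝ => 1 - t * ρ) (-ρ) t := by
      simpa using ((hasDerivAt_id t).mul_const ρ).const_sub 1
    have h2 := (hasDerivAt_pow (j + 1) t).div (h1.pow (j + 1)) (pow_ne_zero _ h0)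
    refine h2.congr_deriv ?_
    push_cast
    simp only [Pi.pow_apply]
    field_simp
    ring
  rw [intervalIntegral.integral_eq_sub_of_hasDerivAt hd hint]
  simp

lemma norm_tsum_choose_le_of_succ {W : ℝ → ℝ} (hW0 : ∀ r ∈ Ico (0:ℝ) 1, 0 < W r)
    (hW : AntitoneOn W (Ico 0 1)) {v : ℕ → ℂ}
    (hv : ∀ x ∈ Ico (0:ℝ) 1, Summable fun n => ‖v n‖ * x ^ n) {D : ℝ} (hD : 0 ≤ D) {j : ℕ}
    (h : ∀ ζ : ℂ, ‖ζ‖ < 1 → ‖∑' n, ((n + (j + 1)).choose (j + 1) : ℂ) * v n * ζ ^ n‖ ≤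
      D / ((1 - ‖ζ‖) ^ (j + 2) * W ‖ζ‖)) {ζ : ℂ} (hζ : ‖ζ‖ < 1) :
    ‖∑' n, ((n + j).choose j : ℂ) * v n * ζ ^ n‖ ≤ D / ((1 - ‖ζ‖) ^ (j + 1) * W ‖ζ‖) := by
  rw [(hasSum_choose_mul_integral hv j hζ).tsum_eq]
  have hρ : ‖ζ‖ ∈ Ico (0:ℝ) 1 := ⟨norm_nonneg ζ, hζ⟩
  obtain ⟨hint, heq⟩ := integral_pow_div_one_sub_mul_pow j hρ
  have hWρ := hW0 _ hρ
  have e : D / ((1 - ‖ζ‖) ^ (j + 1) * W ‖ζ‖) = ∫ t in (0:ℝ)..1,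
      D / W ‖ζ‖ * (((j:ℝ) + 1) * t ^ j / (1 - t * ‖ζ‖) ^ (j + 2)) := by
    rw [intervalIntegral.integral_const_mul, heq]
    have : 1 - ‖ζ‖ ≠ 0 := by linarith
    field_simp
  rw [e]
  refine intervalIntegral.norm_integral_le_of_norm_le zero_le_one
    (Eventually.of_forall fun t ht => ?_) (hint.const_mul _)
  have hn : ‖(t:ℂ) * ζ‖ = t * ‖ζ‖ := by rw [norm_mul, Complex.norm_of_nonneg ht.1.le]
  have hle : t * ‖ζ‖ ≤ ‖ζ‖ := mul_le_of_le_one_left (norm_nonneg _) ht.2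
  have hlt : t * ‖ζ‖ < 1 := hle.trans_lt hζ
  have hmem : t * ‖ζ‖ ∈ Ico (0:ℝ) 1 := ⟨mul_nonneg ht.1.le (norm_nonneg _), hlt⟩
  have h1 := h ((t:ℂ) * ζ) (by rwa [hn])
  rw [hn] at h1
  have hpos : 0 < 1 - t * ‖ζ‖ := by linarith
  have e : ‖(j:ℂ) + 1‖ = (j:ℝ) + 1 := by
    rw [← Nat.cast_add_one, Complex.norm_natCast, Nat.cast_add_one]
  have ht0 := ht.1.le
  rw [norm_mul, norm_mul, norm_pow, Complex.norm_of_nonneg ht0, e]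
  calc _ ≤ ((j:ℝ) + 1) * t ^ j * (D / ((1 - t * ‖ζ‖) ^ (j + 2) * W ‖ζ‖)) := by
        gcongr
        refine h1.trans ?_
        gcongr
        exact hW hmem hρ hle
    _ = _ := by
        field_simp

lemma norm_tsum_le_of_norm_tsum_choose_le {W : ℝ → ℝ} (hW0 : ∀ r ∈ Ico (0:ℝ) 1, 0 < W r)
    (hW : AntitoneOn W (Ico 0 1)) {v : ℕ → ℂ}
    (hv : ∀ x ∈ Ico (0:ℝ) 1, Summable fun n => ‖v n‖ * x ^ n) {D : ℝ} (hD : 0 ≤ D) {k : ℕ}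
    (h : ∀ ζ : ℂ, ‖ζ‖ < 1 → ‖∑' n, ((n + k).choose k : ℂ) * v n * ζ ^ n‖ ≤
      D / ((1 - ‖ζ‖) ^ (k + 1) * W ‖ζ‖)) {ζ : ℂ} (hζ : ‖ζ‖ < 1) :
    ‖∑' n, v n * ζ ^ n‖ ≤ D / ((1 - ‖ζ‖) * W ‖ζ‖) := by
  induction k with
  | zero => simpa using h ζ hζ
  | succ j ih => exact ih fun ζ hζ => norm_tsum_choose_le_of_succ hW0 hW hv hD h hζ

/-! ### Growth of the coefficient series of a functional -/

lemma norm_tsum_mul_le_mul_integral {q : ℕ → ℂ} {α : ℕ → ℝ} {u : ℂ} {x B : ℝ}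
    (hq : Summable fun n => ‖q n * u ^ n‖) (hα : Summable fun n => ‖((α n * x ^ n : ℝ) : ℂ)‖)
    (hB : ∀ ζ : ℂ, ‖ζ‖ = ‖u‖ → ‖∑' n, q n * ζ ^ n‖ ≤ B) :
    ‖∑' n, q n * α n * (x * u) ^ n‖ ≤
      B * ∫ θ, ‖∑' n, ((α n * x ^ n : ℝ) : ℂ) * circlePt 1 θ ^ n‖ ∂arcMeasure := by
  have e : ∑' n, q n * α n * (x * u) ^ n =
      ∑' n, q n * u ^ n * (starRingEnd ℂ) ((α n * x ^ n : ℝ) : ℂ) := tsum_congr fun n => by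
    rw [Complex.conj_ofReal, mul_pow]
    push_cast
    ring
  rw [e, ← integral_tsum_mul_conj_tsum hq hα, ← integral_const_mul]
  refine norm_integral_le_of_norm_le
    (continuous_const.mul (continuous_tsum_circlePt hα).norm).integrable_arcMeasure
    (Eventually.of_forall fun θ => ?_)
  rw [norm_mul, RCLike.norm_conj]
  gcongr
  have := hB (u * circlePt 1 θ) (by rw [norm_mul, norm_circlePt zero_le_one, mul_one])
  simpa only [mul_pow, mul_assoc] using this

lemma exists_nat_two_le_mul_and_rpow_mul_le {p q C : ℝ} (hp : 0 < p) (hq : 0 < q) (hC : 1 ≤ C) :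
    ∃ k : ℕ, 2 ≤ (k + 1 : ℕ) * p ∧ 2 ^ (-(q * ((k + 1 : ℕ) - 1 / p))) * C ≤ 1 / 2 := by
  obtain ⟨k, hk⟩ := exists_nat_ge (2 / p + 2 * C / q)
  have hC0 : 0 < C := by linarith
  have h1 : 0 < 2 * C / q := by positivity
  have h2 : 0 < 1 / p := by positivity
  have h3 : 2 / p = 2 * (1 / p) := by ring
  refine ⟨k, ?_, ?_⟩
  · rw [← div_le_iff₀ hp]
    push_cast
    linarith
  · have ht : 2 * C ≤ q * ((k + 1 : ℕ) - 1 / p) := by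
      rw [mul_comm q, ← div_le_iff₀ hq]
      push_cast
      linarith
    have := one_add_mul_self_le_rpow_one_add (s := 1) (by norm_num)
      (p := q * ((k + 1 : ℕ) - 1 / p)) (by linarith)
    rw [Real.rpow_neg zero_le_two, inv_mul_le_iff₀ (by positivity)]
    norm_num at this ht ⊢
    linarith

lemma norm_functional_pow_le {ω : ℝ → ℝ} (hω : IsRadialWeight ω) {p q M : ℝ} (hp : 0 < p)
    (hq : 0 < q) {L : (ℂ → ℂ) → ℂ} (hM0 : 0 ≤ M)
    (hM : ∀ f : ℂ → ℂ, InApq ω p q f → ‖L f‖ ≤ M * (LpqNormE ω p q f).toReal) (n : ℕ) :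
    ‖L (fun z => z ^ n)‖ ≤ M * normOne ω q := by
  simpa using (norm_functional_le_of_norm_le hω hp hq hM0 hM (f := fun z => z ^ n) (K := 1)
    (by fun_prop) fun z hz => by
      rw [norm_pow]; exact pow_le_one₀ (norm_nonneg _) hz.le).2

lemma summable_functional_mul_succ_div {c : ℕ → ℝ} {b : ℕ → ℂ} {B : ℝ} (hb : ∀ n, ‖b n‖ ≤ B)
    (hc : ∀ x ∈ Ico (0:ℝ) 1, Summable fun n : ℕ => ((n:ℝ) + 1) / c (n + 1) * x ^ n)
    (hc0 : ∀ n, 0 < c n) {x : ℝ} (hx : x ∈ Ico (0:ℝ) 1) :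
    Summable fun n : ℕ => ‖b (n + 1) * (((n + 1) / c (n + 1) : ℝ) : ℂ)‖ * x ^ n := by
  have hx0 := hx.1
  refine ((hc x hx).mul_left B).of_nonneg_of_le (fun n => by positivity) fun n => ?_
  have h := hc0 (n + 1)
  rw [norm_mul, Complex.norm_of_nonneg (by positivity), mul_assoc]
  gcongr
  exact hb _

lemma exists_norm_tsum_functional_le {ω : ℝ → ℝ} (hω : IsRadialWeight ω)
    (hpos : ∀ r ∈ Ico (0:ℝ) 1, 0 < omegaHat ω r) (hD : InDhat ω) {p q : ℝ} (hp0 : 0 < p)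
    (hp1 : p < 1) (hq0 : 0 < q) {c : ℕ → ℝ} (hc : ∀ n, c n =
      momentCoeff (fun r => ω r * omegaHat ω r ^ (1 / q)) n *
        momentCoeff (nuWeight (1 / p - 2)) n) :
    (∀ n, 0 < c n) ∧
    (∀ x ∈ Ico (0:ℝ) 1, Summable fun n : ℕ => ((n:ℝ) + 1) / c (n + 1) * x ^ n) ∧
    ∃ A > 0, ∀ (L : (ℂ → ℂ) → ℂ) (M : ℝ), 0 ≤ M → IsLinearOn (InApq ω p q) L →
      (∀ f : ℂ → ℂ, InApq ω p q f → ‖L f‖ ≤ M * (LpqNormE ω p q f).toReal) →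
      ∀ ζ : ℂ, ‖ζ‖ < 1 →
        ‖∑' n : ℕ, L (fun z => z ^ (n + 1)) * (((n + 1) / c (n + 1) : ℝ) : ℂ) * ζ ^ n‖ ≤
          A * M / ((1 - ‖ζ‖) * omegaHat ω ‖ζ‖) := by
  have hκ : 0 < 1 / p - 1 := by
    rw [sub_pos, lt_div_iff₀ hp0]; linarith
  have ha : 0 ≤ 1 / q := by positivity
  obtain ⟨K, hK0, c₀, hc₀, hcpos, hanti, hK, hlow⟩ :=
    exists_pairingCoeff_bounds hω hpos hD ha hκ (c := c)
      (by intro n; rw [hc]; congr 3; ring)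
  obtain ⟨C, -, hC⟩ := hD
  have hC1 : 1 ≤ C := one_le_doubling_const hω hpos hC
  obtain ⟨A₁, hA₁, hpow⟩ := exists_pow_div_le hpos hC1 hC ha hc₀ hcpos hlow
  have hy : ∀ x ∈ Ico (0:ℝ) 1, 0 ≤ (1 - (1 - x) / 8) ^ 4 ∧ (1 - (1 - x) / 8) ^ 4 < 1 ∧
      (1 - ((1 - (1 - x) / 8) ^ 4) ^ 2)⁻¹ ≤ 8 / (1 - x) := fun x hx => by
    obtain ⟨hx0, hx1⟩ := hx
    set y := 1 - (1 - x) / 8 with hy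
    have hy0 : 0 ≤ y := by rw [hy]; linarith
    have hy1 : y < 1 := by rw [hy]; linarith
    refine ⟨by positivity, pow_lt_one₀ hy0 hy1 (by norm_num), ?_⟩
    have h8 : y ^ 8 ≤ y := pow_le_of_le_one hy0 hy1.le (by norm_num)
    have h1x : 0 < 1 - x := by linarith
    rw [← pow_mul, ← one_div, div_le_div_iff₀ (by norm_num; linarith) h1x]
    norm_num
    linarith
  have hsum : ∀ x ∈ Ico (0:ℝ) 1, Summable fun n : ℕ => ((n:ℝ) + 1) / c (n + 1) * x ^ n :=
    fun x hx => summable_succ_div_mul_pow hcpos hx.1 (hy x hx).1 (hy x hx).2.1 (hpow x hx)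
  obtain ⟨k, hk1, hk2⟩ := exists_nat_two_le_mul_and_rpow_mul_le hp0 hq0 hC1
  refine ⟨hcpos, hsum, (3 * C) ^ (1 / q) * (4 * (1 + K) ^ 2 + 1) * A₁ * 2 ^ (k + 1) * C,
    by positivity, fun L M hM0 hL hM ζ hζ => ?_⟩
  have hb := norm_functional_pow_le hω hp0 hq0 hM0 hM
  refine norm_tsum_le_of_norm_tsum_choose_le (k := k) hpos
    (fun a ha b hb hab => omegaHat_anti hω ha.1 hab hb.2.le)
    (fun x hx => summable_functional_mul_succ_div hb hsum hcpos hx) (by positivity) ?_ hζ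
  intro ζ hζ
  set ρ := ‖ζ‖ with hρ
  have hρ0 : 0 ≤ ρ := norm_nonneg ζ
  set x := √ρ with hx
  have hx0 : 0 ≤ x := Real.sqrt_nonneg _
  have hxx : x * x = ρ := Real.mul_self_sqrt hρ0
  have hx1 : x < 1 := by nlinarith
  obtain ⟨u, hu, hxu⟩ : ∃ u : ℂ, ‖u‖ = x ∧ x * u = ζ := by
    by_cases h0 : x = 0
    · refine ⟨0, by rw [norm_zero, h0], ?_⟩
      rw [mul_zero, eq_comm, ← norm_eq_zero, ← hρ, ← hxx, h0, mul_zero]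
    · refine ⟨ζ / x, ?_, mul_div_cancel₀ _ (by exact_mod_cast h0)⟩
      rw [norm_div, Complex.norm_of_nonneg hx0, ← hρ, ← hxx, mul_div_cancel_right₀ _ h0]
  have hxm : x ∈ Ico (0:ℝ) 1 := ⟨hx0, hx1⟩
  have h1x : 0 < 1 - x := by linarith
  have hWx := hpos x hxm
  have hWρ := hpos ρ ⟨hρ0, hζ⟩
  set H := A₁ / (omegaHat ω x ^ (1 + 1 / q) * (1 - x) ^ (1 / p - 1)) with hH
  have hH0 : 0 < H := by positivity
  have hI := integral_norm_tsum_succ_div_le hcpos hanti hK0 hK hxm (hy x hxm).1 (hy x hxm).2.1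
    (hy x hxm).2.2 hH0 (hpow x hxm)
  have hq' : Summable fun n : ℕ =>
      ‖((n + k).choose k : ℂ) * L (fun z => z ^ (n + 1)) * u ^ n‖ := by
    have hg := summable_choose_mul_geometric_of_norm_lt_one k (r := x)
      (by rwa [Real.norm_of_nonneg hx0])
    refine (hg.mul_left (M * normOne ω q)).of_nonneg_of_le (fun _ => norm_nonneg _) fun n => ?_
    rw [norm_mul, norm_mul, norm_pow, hu, Complex.norm_natCast]
    calc _ = ‖L (fun z => z ^ (n + 1))‖ * (((n + k).choose k : ℝ) * x ^ n) := by ring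
      _ ≤ _ := by gcongr; exact hb _
  have hα : Summable fun n : ℕ => ‖((((n:ℝ) + 1) / c (n + 1) * x ^ n : ℝ) : ℂ)‖ := by
    simpa only [Complex.norm_real] using (hsum x hxm).norm
  have hmain := norm_tsum_mul_le_mul_integral (α := fun n => ((n:ℝ) + 1) / c (n + 1)) hq' hα
    (B := M * ((3 * C) ^ (1 / q) * ((1 - x) ^ (1 / p - (k + 1 : ℕ)) * omegaHat ω x ^ (1 / q))))
    fun ξ hξ => by
      have := norm_tsum_choose_functional_le hω hC1 hC hp0 hq0 hk1 hk2 hM0 hL hM (ζ := ξ)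
        (by rw [hξ, hu]; exact hx1)
      rwa [hξ, hu] at this
  rw [hxu] at hmain
  have e : ∑' n : ℕ, ((n + k).choose k : ℂ) *
      (L (fun z => z ^ (n + 1)) * (((n + 1) / c (n + 1) : ℝ) : ℂ)) * ζ ^ n =
      ∑' n : ℕ, ((n + k).choose k : ℂ) * L (fun z => z ^ (n + 1)) *
        (((n + 1) / c (n + 1) : ℝ) : ℂ) * ζ ^ n := tsum_congr fun n => by ring
  rw [e]
  have hWle : omegaHat ω ρ ≤ C * omegaHat ω x := by
    refine (hC ρ ⟨hρ0, hζ⟩).trans ?_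
    gcongr
    refine omegaHat_anti hω hx0 ?_ (by linarith)
    nlinarith [sq_nonneg (1 - x)]
  have hρx : 1 - ρ ≤ 2 * (1 - x) := by nlinarith
  have h1ρ : 0 < 1 - ρ := by linarith
  have hprod : (1 - x) ^ (1 / p - (k + 1 : ℕ)) * omegaHat ω x ^ (1 / q) * (H / (1 - x)) =
      A₁ / ((1 - x) ^ (k + 1) * omegaHat ω x) := by
    rw [hH, Real.rpow_sub h1x, Real.rpow_natCast, Real.rpow_sub h1x, Real.rpow_one,
      Real.rpow_add hWx, Real.rpow_one]
    have h1 : (1 - x) ^ (1 / p) ≠ 0 := by positivity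
    have h2 : omegaHat ω x ^ (1 / q) ≠ 0 := by positivity
    field_simp
  calc _ ≤ M * ((3 * C) ^ (1 / q) * ((1 - x) ^ (1 / p - (k + 1 : ℕ)) * omegaHat ω x ^ (1 / q))) *
        ((4 * (1 + K) ^ 2 + 1) * (H / (1 - x))) := by
        refine hmain.trans ?_
        gcongr
    _ = M * (3 * C) ^ (1 / q) * (4 * (1 + K) ^ 2 + 1) *
        ((1 - x) ^ (1 / p - (k + 1 : ℕ)) * omegaHat ω x ^ (1 / q) * (H / (1 - x))) := by ring
    _ = M * (3 * C) ^ (1 / q) * (4 * (1 + K) ^ 2 + 1) * A₁ * 2 ^ (k + 1) * C *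
        (1 / ((2 * (1 - x)) ^ (k + 1) * (C * omegaHat ω x))) := by
        rw [hprod, mul_pow]
        field_simp
    _ ≤ M * (3 * C) ^ (1 / q) * (4 * (1 + K) ^ 2 + 1) * A₁ * 2 ^ (k + 1) * C *
        (1 / ((1 - ρ) ^ (k + 1) * omegaHat ω ρ)) := by gcongr
    _ = _ := by ring

/-! ### Representation of bounded functionals -/

lemma XInfNormE_BlochNormE_le {ω : ℝ → ℝ} (hω : IsRadialWeight ω)
    (hpos : ∀ r ∈ Ico (0:ℝ) 1, 0 < omegaHat ω r) {g : ℂ → ℂ} {D : ℝ} (hD : 0 ≤ D)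
    (hg : ∀ ζ : ℂ, ‖ζ‖ < 1 → ‖deriv g ζ‖ ≤ D / ((1 - ‖ζ‖) * omegaHat ω ‖ζ‖)) :
    XInfNormE BlochNormE ω g ≤ ENNReal.ofReal (‖g 0‖ * omegaHat ω 0 + 2 * D) := by
  refine iSup₂_le fun r hr => ?_
  have hWr := hpos r ⟨hr.1.le, hr.2⟩
  have hW0 : omegaHat ω r ≤ omegaHat ω 0 := omegaHat_anti hω le_rfl hr.1.le hr.2.le
  have hB : BlochNormE (dilateF g r) ≤ ENNReal.ofReal (‖g 0‖ + 2 * D / omegaHat ω r) := by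
    rw [BlochNormE, ENNReal.ofReal_add (norm_nonneg _) (by positivity)]
    refine add_le_add (by simp [dilateF]) (iSup₂_le fun z hz => ENNReal.ofReal_le_ofReal ?_)
    have hz1 : ‖z‖ < 1 := mem_ball_zero_iff.1 hz
    have hz0 := norm_nonneg z
    have hrz : ‖(r:ℂ) * z‖ = r * ‖z‖ := by rw [norm_mul, Complex.norm_of_nonneg hr.1.le]
    have h1rz : 0 ≤ 1 - r * ‖z‖ := by nlinarith [hr.1, hr.2]
    have hle : r * ‖z‖ ≤ ‖z‖ := mul_le_of_le_one_left hz0 hr.2.le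
    have hler : r * ‖z‖ ≤ r := mul_le_of_le_one_right hr.1.le hz1.le
    have hd := hg (r * z) (by rw [hrz]; linarith)
    have hW : omegaHat ω r ≤ omegaHat ω (r * ‖z‖) :=
      omegaHat_anti hω (mul_nonneg hr.1.le hz0) hler hr.2.le
    have h1z : 0 < 1 - ‖z‖ := by linarith
    have h1z2 : 0 ≤ 1 - ‖z‖ ^ 2 := by nlinarith
    have he : deriv (dilateF g r) z = r * deriv g (r * z) := deriv_comp_mul_left _ _ _
    rw [he, norm_mul, Complex.norm_of_nonneg hr.1.le]
    rw [hrz] at hd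
    calc (1 - ‖z‖ ^ 2) * (r * ‖deriv g (r * z)‖) ≤ (1 - ‖z‖ ^ 2) *
          (1 * (D / ((1 - ‖z‖) * omegaHat ω r))) := by
          gcongr
          · exact hr.2.le
          · refine hd.trans ?_
            gcongr
      _ = (1 + ‖z‖) * (D / omegaHat ω r) := by
          field_simp
          ring
      _ ≤ 2 * (D / omegaHat ω r) := by gcongr; linarith
      _ = _ := by ring
  calc _ ≤ ENNReal.ofReal (‖g 0‖ + 2 * D / omegaHat ω r) * ENNReal.ofReal (omegaHat ω r) := by
        gcongr
    _ = ENNReal.ofReal (‖g 0‖ * omegaHat ω r + 2 * D) := by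
        rw [← ENNReal.ofReal_mul (by positivity)]
        congr 1
        field_simp
    _ ≤ _ := by gcongr

lemma LpqNormE_one_ne_zero {ω : ℝ → ℝ} (hω : IsRadialWeight ω) (h0 : 0 < omegaHat ω 0) {p q : ℝ}
    (hq : 0 < q) : LpqNormE ω p q (fun _ => 1) ≠ 0 := by
  intro h
  rw [LpqNormE, ENNReal.rpow_eq_zero_iff_of_pos (by positivity)] at h
  have hM : ∀ r, MpE p r (fun _ => (1:ℂ)) = 1 := fun r => by
    rw [MpE_eq]
    simp
  simp only [hM, ENNReal.one_rpow, one_mul] at h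
  have hm : AEMeasurable (fun r => ENNReal.ofReal (r * ω r)) (volume.restrict (Ioo 0 1)) :=
    (aemeasurable_id.mul hω.integrableOn_Ioo.aemeasurable).ennreal_ofReal
  rw [lintegral_eq_zero_iff' hm] at h
  have hz : ω =ᵐ[volume.restrict (Ioo 0 1)] 0 := by
    filter_upwards [h, ae_restrict_mem measurableSet_Ioo] with r hr hr1
    have h1 := ENNReal.ofReal_eq_zero.1 hr
    have h2 := hω.nonneg_Ioo r hr1
    exact le_antisymm (nonpos_of_mul_nonpos_right h1 hr1.1) h2
  rw [omegaHat, intervalIntegral.integral_of_le zero_le_one, integral_Ioc_eq_integral_Ioo,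
    integral_congr_ae hz] at h0
  simp at h0

lemma nonneg_of_norm_functional_le {ω : ℝ → ℝ} (hω : IsRadialWeight ω) (h0 : 0 < omegaHat ω 0)
    {p q M : ℝ} (hp : 0 < p) (hq : 0 < q) {L : (ℂ → ℂ) → ℂ}
    (hM : ∀ f : ℂ → ℂ, InApq ω p q f → ‖L f‖ ≤ M * (LpqNormE ω p q f).toReal) : 0 ≤ M := by
  have hlt : LpqNormE ω p q (fun _ => 1) < ⊤ :=
    (LpqNormE_le_of_norm_le hω hp hq (K := 1) (by simp)).trans_lt ENNReal.ofReal_lt_top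
  have h := (norm_nonneg _).trans (hM (fun _ => 1) ⟨by fun_prop, hlt⟩)
  exact nonneg_of_mul_nonneg_left h
    (ENNReal.toReal_pos (LpqNormE_one_ne_zero hω h0 hq) hlt.ne)

lemma exists_representing_function {ω : ℝ → ℝ} (hω : IsRadialWeight ω)
    (hpos : ∀ r ∈ Ico (0:ℝ) 1, 0 < omegaHat ω r) (hD : InDhat ω) {p q : ℝ} (hp0 : 0 < p)
    (hp1 : p < 1) (hq0 : 0 < q) {c : ℕ → ℝ} (hc : ∀ n, c n =
      momentCoeff (fun r => ω r * omegaHat ω r ^ (1 / q)) n *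
        momentCoeff (nuWeight (1 / p - 2)) n) :
    ∃ C₁ > (0:ℝ), ∀ L : (ℂ → ℂ) → ℂ, IsLinearOn (InApq ω p q) L →
      (∃ M : ℝ, ∀ f : ℂ → ℂ, InApq ω p q f → ‖L f‖ ≤ M * (LpqNormE ω p q f).toReal) →
      ∃ g : ℂ → ℂ, DifferentiableOn ℂ g (Metric.ball 0 1) ∧ XInfNormE BlochNormE ω g < ⊤ ∧
        (∀ f : ℂ → ℂ, InApq ω p q f → HasPairingC c f g (L f)) ∧
        (∀ M : ℝ, (∀ f : ℂ → ℂ, InApq ω p q f → ‖L f‖ ≤ M * (LpqNormE ω p q f).toReal) →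
          (XInfNormE BlochNormE ω g).toReal ≤ C₁ * M) := by
  obtain ⟨hcpos, hsum, A, hA, hgrowth⟩ := exists_norm_tsum_functional_le hω hpos hD hp0 hp1 hq0 hc
  have hW0 := hpos 0 (by simp)
  have hc00 := hcpos 0
  have hN0 : 0 ≤ normOne ω q := ENNReal.toReal_nonneg
  refine ⟨normOne ω q / c 0 * omegaHat ω 0 + 2 * A, by positivity, fun L hL hex => ?_⟩
  set b : ℕ → ℂ := fun n => L (fun z => z ^ n) with hb
  set a : ℕ → ℂ := fun n => (starRingEnd ℂ) (b n) / c n with ha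
  obtain ⟨M₀, hM₀⟩ := hex
  have hM₀0 := nonneg_of_norm_functional_le hω hW0 hp0 hq0 hM₀
  have hbB : ∀ n, ‖b n‖ ≤ M₀ * normOne ω q := norm_functional_pow_le hω hp0 hq0 hM₀0 hM₀
  have hcn : ∀ n, (c n : ℂ) ≠ 0 := fun n => by exact_mod_cast (hcpos n).ne'
  have has : ∀ x ∈ Ico (0:ℝ) 1, Summable fun n => ‖a n‖ * x ^ n := fun x hx => by
    have hx0 := hx.1
    rw [← summable_nat_add_iff 1]
    refine (summable_functional_mul_succ_div hbB hsum hcpos hx).of_nonneg_of_le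
      (fun n => by positivity) fun n => ?_
    have h := hcpos (n + 1)
    have e : ‖a (n + 1)‖ = ‖b (n + 1)‖ * (1 / c (n + 1)) := by
      rw [ha, norm_div, RCLike.norm_conj, Complex.norm_of_nonneg h.le, mul_one_div]
    have e' : ‖(((n + 1) / c (n + 1) : ℝ) : ℂ)‖ = ((n:ℝ) + 1) / c (n + 1) :=
      Complex.norm_of_nonneg (by positivity)
    rw [e, norm_mul, e']
    have hx1 : x ^ (n + 1) ≤ x ^ n := pow_le_pow_of_le_one hx0 hx.2.le n.le_succ
    gcongr
    exact le_add_of_nonneg_left n.cast_nonneg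
  set g : ℂ → ℂ := fun z => ∑' n, a n * z ^ n with hg
  have hgs : ∀ z : ℂ, ‖z‖ < 1 → HasSum (fun n => a n * z ^ n) (g z) := fun z hz =>
    (Summable.of_norm (by
      simpa only [norm_mul, norm_pow] using has ‖z‖ ⟨norm_nonneg z, hz⟩)).hasSum
  have hgd : DifferentiableOn ℂ g (Metric.ball 0 1) := by
    intro z hz
    have hz1 : ‖z‖ < 1 := mem_ball_zero_iff.1 hz
    obtain ⟨ρ, hzρ, hρ1⟩ := exists_between hz1
    have hρ0 : 0 ≤ ρ := (norm_nonneg z).trans hzρ.le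
    have hd : DifferentiableOn ℂ g (Metric.ball 0 ρ) :=
      Complex.differentiableOn_tsum_of_summable_norm (F := fun n z => a n * z ^ n)
        (has ρ ⟨hρ0, hρ1⟩) (fun n => by fun_prop) Metric.isOpen_ball fun n w hw => by
          rw [norm_mul, norm_pow]
          gcongr
          exact (mem_ball_zero_iff.1 hw).le
    exact (hd.differentiableAt (Metric.isOpen_ball.mem_nhds
      (mem_ball_zero_iff.2 hzρ))).differentiableWithinAt
  have hgt : ∀ n, taylorCoeff g n = a n := taylorCoeff_eq_of_hasSum one_pos hgs
  have hg0 : g 0 = a 0 := by simpa using (hgs 0 (by simp)).unique (hasSum_single 0 (by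
    intro n hn; rw [zero_pow hn, mul_zero]))
  have hgderiv : ∀ ζ : ℂ, ‖ζ‖ < 1 → deriv g ζ = (starRingEnd ℂ)
      (∑' n : ℕ, b (n + 1) * (((n + 1) / c (n + 1) : ℝ) : ℂ) * (starRingEnd ℂ) ζ ^ n) := by
    intro ζ hζ
    rw [← (hasSum_taylorCoeff (hgd.deriv Metric.isOpen_ball) hζ).tsum_eq, Complex.conj_tsum]
    refine tsum_congr fun n => ?_
    rw [taylorCoeff_deriv, hgt, ha]
    simp only [map_mul, map_pow, Complex.conj_conj, Complex.conj_ofReal]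
    push_cast
    ring
  have hX : ∀ M : ℝ, (∀ f : ℂ → ℂ, InApq ω p q f → ‖L f‖ ≤ M * (LpqNormE ω p q f).toReal) →
      0 ≤ M ∧ XInfNormE BlochNormE ω g ≤
        ENNReal.ofReal ((normOne ω q / c 0 * omegaHat ω 0 + 2 * A) * M) := by
    intro M hM
    have hM0 := nonneg_of_norm_functional_le hω hW0 hp0 hq0 hM
    refine ⟨hM0, (XInfNormE_BlochNormE_le hω hpos (D := A * M) (by positivity)
      fun ζ hζ => ?_).trans (ENNReal.ofReal_le_ofReal ?_)⟩
    · rw [hgderiv ζ hζ, RCLike.norm_conj]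
      have := hgrowth L M hM0 hL hM ((starRingEnd ℂ) ζ) (by rwa [RCLike.norm_conj])
      rwa [RCLike.norm_conj] at this
    · have h0 : ‖g 0‖ ≤ M * normOne ω q / c 0 := by
        rw [hg0, ha, norm_div, RCLike.norm_conj, Complex.norm_of_nonneg hc00.le]
        gcongr
        exact norm_functional_pow_le hω hp0 hq0 hM0 hM 0
      calc _ ≤ M * normOne ω q / c 0 * omegaHat ω 0 + 2 * (A * M) := by gcongr
        _ = _ := by ring
  refine ⟨g, hgd, (hX M₀ hM₀).2.trans_lt ENNReal.ofReal_lt_top, fun f hf => ?_, fun M hM => ?_⟩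
  · have hterm : ∀ r ∈ Ico (0:ℝ) 1, HasSum (fun n => taylorCoeff f n *
        (starRingEnd ℂ) (taylorCoeff g n) * (c n : ℂ) * (r:ℂ) ^ n) (L (dilateF f r)) := by
      intro r hr
      have hfs : Summable fun n => ‖taylorCoeff f n * (r:ℂ) ^ n‖ :=
        (hasSum_taylorCoeff hf.1
          (by rw [Complex.norm_of_nonneg hr.1]; exact hr.2)).summable.norm
      have := (hasSum_functional hω hp0 hq0 hM₀0 hL hM₀ hfs (f := dilateF f r)
        fun z hz => by
          have hrz : ‖(r:ℂ) * z‖ < 1 := by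
            rw [norm_mul, Complex.norm_of_nonneg hr.1]
            nlinarith [hr.1, hr.2, norm_nonneg z]
          refine (hasSum_taylorCoeff hf.1 hrz).congr_fun fun n => ?_
          rw [mul_pow, mul_assoc]).2
      refine this.congr_fun fun n => ?_
      rw [hgt, ha]
      simp only [map_div₀, Complex.conj_conj, Complex.conj_ofReal]
      have := hcn n
      field_simp
      rw [hb]
      ring
    refine ⟨fun r hr => (hterm r hr).summable, ?_⟩
    refine (tendsto_functional_dilateF hω hp0 hp1.le hq0 hL hM₀ hf).congr' ?_
    filter_upwards [Ioo_mem_nhdsLT zero_lt_one] with r hr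
    exact (hterm r ⟨hr.1.le, hr.2⟩).tsum_eq.symm
  · obtain ⟨hM0, h⟩ := hX M hM
    exact ENNReal.toReal_le_of_le_ofReal (by positivity) h

/-- For `ω ∈ D̂`, `0<p<1` and `0<q≤1`, `(A^{p,q}_ω)* ≃ B(∞,ω)` under the
pairing with coefficients `(μ_q)_{2n+1} (ν_{1/p-2})_{2n+1}`, `μ_q = ω ω̂^{1/q}`,
with equivalence of norms. -/
theorem duality_Apq_psmall_qsmall
    (ω : ℝ → ℝ) (hω : IsRadialWeight ω)
    (hpos : ∀ r ∈ Set.Ico (0:ℝ) 1, 0 < omegaHat ω r)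
    (hD : InDhat ω)
    (p q : ℝ) (hp0 : 0 < p) (hp1 : p < 1) (hq0 : 0 < q) (hq1 : q ≤ 1)
    (μq : ℝ → ℝ) (hμq : μq = fun r => ω r * omegaHat ω r ^ (1 / q)) :
    ∃ C₁ > (0:ℝ), ∃ C₂ > (0:ℝ),
      (∀ g : ℂ → ℂ, DifferentiableOn ℂ g (Metric.ball 0 1) →
        XInfNormE BlochNormE ω g < ⊤ →
        ∀ f : ℂ → ℂ, InApq ω p q f →
          ∃ l : ℂ, HasPairingC
              (fun k => momentCoeff μq k * momentCoeff (nuWeight (1 / p - 2)) k) f g l ∧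
            ‖l‖ ≤ C₂ * (XInfNormE BlochNormE ω g).toReal * (LpqNormE ω p q f).toReal) ∧
      (∀ L : (ℂ → ℂ) → ℂ, IsLinearOn (InApq ω p q) L →
        (∃ M : ℝ, ∀ f : ℂ → ℂ, InApq ω p q f → ‖L f‖ ≤ M * (LpqNormE ω p q f).toReal) →
        ∃ g : ℂ → ℂ, DifferentiableOn ℂ g (Metric.ball 0 1) ∧
          XInfNormE BlochNormE ω g < ⊤ ∧
          (∀ f : ℂ → ℂ, InApq ω p q f → HasPairingC
              (fun k => momentCoeff μq k * momentCoeff (nuWeight (1 / p - 2)) k) f g (L f)) ∧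
          (∀ M : ℝ, (∀ f : ℂ → ℂ, InApq ω p q f → ‖L f‖ ≤ M * (LpqNormE ω p q f).toReal) →
            (XInfNormE BlochNormE ω g).toReal ≤ C₁ * M)) := by
  subst hμq
  obtain ⟨C₁, hC₁, hb⟩ := exists_representing_function hω hpos hD hp0 hp1 hq0 fun _ => rfl
  obtain ⟨C₂, hC₂, ha⟩ := exists_hasPairingC_of_bloch hω hpos hD hp0 hp1 hq0 hq1
  exact ⟨C₁, hC₁, C₂, hC₂, ha, hb⟩
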